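/- arXiv:1509.04990 — 3 statements merged into one kernel-verified Lean document; each statement's English description precedes it below -/
import Mathlib

section
/- Let f : X → Y be a finite-to-one holomorphic map between complex manifolds with dim X = n. Then for all 1 ≤ k ≤ n, the set of points x ∈ X where the differential df_x has corank at least k has dimension at most n - k. -/
open Filter Topology

/-- The corank of a holomorphic map `f : ℂⁿ → ℂᵖ` at `x` is `n` minus the rank of
its differential at `x`. -/
noncomputable def corankAt (n p : ℕ) (f : (Fin n → ℂ) → (Fin p → ℂ)) (x : Fin n → ℂ) : ℕ :=
  n - Module.finrank ℂ (LinearMap.range ((fderiv ℂ f x : (Fin n → ℂ) →L[ℂ] (Fin p → ℂ)) :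
      (Fin n → ℂ) →ₗ[ℂ] (Fin p → ℂ)))

section Holomorphic

variable {E F : Type} [NormedAddCommGroup E] [NormedSpace ℂ E]
  [NormedAddCommGroup F] [NormedSpace ℂ F]

/-- Cauchy estimate for the differential of a bounded holomorphic map. -/
theorem norm_fderiv_le_of_forall_mem_closedBall {f : E → F} {y : E} {R M : ℝ} (hR : 0 < R)
    (hM : 0 ≤ M) (hf : ∀ x ∈ Metric.closedBall y R, DifferentiableAt ℂ f x)
    (hb : ∀ x ∈ Metric.closedBall y R, ‖f x‖ ≤ M) : ‖fderiv ℂ f y‖ ≤ M / R := by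
  refine ContinuousLinearMap.opNorm_le_bound _ (by positivity) fun w => ?_
  rcases eq_or_ne w 0 with rfl | hw
  · simp
  have hw' : 0 < ‖w‖ := norm_pos_iff.2 hw
  have hmem : ∀ z ∈ Metric.closedBall (0 : ℂ) (R / ‖w‖), y + z • w ∈ Metric.closedBall y R := by
    intro z hz
    rw [mem_closedBall_zero_iff, le_div_iff₀ hw'] at hz
    simpa [norm_smul] using hz
  have hline : ∀ z : ℂ, HasDerivAt (fun z : ℂ => y + z • w) w z := fun z => by
    simpa using ((hasDerivAt_id z).smul_const w).const_add y
  have hder : HasDerivAt (fun z : ℂ => f (y + z • w)) (fderiv ℂ f y w) 0 := by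
    have h0 := (hf _ (Metric.mem_closedBall_self hR.le)).hasFDerivAt
    have : HasFDerivAt f (fderiv ℂ f y) (y + (0 : ℂ) • w) := by simpa using h0
    exact this.comp_hasDerivAt 0 (hline 0)
  have hdiff : DifferentiableOn ℂ (fun z : ℂ => f (y + z • w))
      (Metric.closedBall (0 : ℂ) (R / ‖w‖)) := fun z hz =>
    ((hf _ (hmem z hz)).comp z (hline z).differentiableAt).differentiableWithinAt
  have := Complex.norm_deriv_le_of_forall_mem_sphere_norm_le (f := fun z : ℂ => f (y + z • w))
    (c := 0) (R := R / ‖w‖) (C := M) (by positivity)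
    (hdiff.mono Metric.closure_ball_subset_closedBall).diffContOnCl
    fun z hz => hb _ (hmem z (Metric.sphere_subset_closedBall hz))
  rw [hder.deriv] at this
  calc _ ≤ _ := this
    _ = _ := by field_simp

variable [FiniteDimensional ℂ E] [FiniteDimensional ℂ F]

/-- The differential of a holomorphic map in several variables is holomorphic. -/
theorem differentiableOn_fderiv_of_isOpen {U : Set E} (hU : IsOpen U) {f : E → F}
    (hf : DifferentiableOn ℂ f U) : DifferentiableOn ℂ (fderiv ℂ f) U := by
  have := FiniteDimensional.complete ℂ E
  have := FiniteDimensional.complete ℂ F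
  have : ProperSpace E := FiniteDimensional.proper ℂ E
  have : ProperSpace (E →L[ℂ] F) := FiniteDimensional.proper ℂ _
  borelize E
  borelize (E →L[ℂ] F)
  have hfU : ∀ x ∈ U, DifferentiableAt ℂ f x := fun x hx => hf.differentiableAt (hU.mem_nhds hx)
  intro x₀ hx₀
  obtain ⟨δ, hδ, hδU⟩ := Metric.isOpen_iff.1 hU x₀ hx₀
  obtain ⟨R, hR, hRδ⟩ : ∃ R : ℝ, 0 < R ∧ 3 * R < δ := ⟨δ / 4, by positivity, by linarith⟩
  have hKU : Metric.closedBall x₀ (3 * R) ⊆ U :=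
    (Metric.closedBall_subset_ball hRδ).trans hδU
  obtain ⟨M, hMb⟩ := (isCompact_closedBall x₀ (3 * R)).exists_bound_of_continuousOn
    (hf.continuousOn.mono hKU)
  have hM : 0 ≤ M := (norm_nonneg _).trans (hMb x₀ (Metric.mem_closedBall_self (by positivity)))
  have hbound : ∀ y ∈ Metric.closedBall x₀ (2 * R), ‖fderiv ℂ f y‖ ≤ M / R := by
    intro y hy
    have hsub : Metric.closedBall y R ⊆ Metric.closedBall x₀ (3 * R) :=
      Metric.closedBall_subset_closedBall' (by rw [Metric.mem_closedBall] at hy; linarith)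
    exact norm_fderiv_le_of_forall_mem_closedBall hR hM (fun x hx => hfU x (hKU (hsub hx)))
      fun x hx => hMb x (hsub hx)
  suffices h : DifferentiableAt ℂ (fderiv ℂ f) x₀ from h.differentiableWithinAt
  have happly : ∀ v : E, DifferentiableAt ℂ (fun x => fderiv ℂ f x v) x₀ := by
    intro v
    obtain ⟨ρ, hρ, hρv⟩ : ∃ ρ : ℝ, 0 < ρ ∧ ρ * ‖v‖ ≤ R := by
      refine ⟨R / (‖v‖ + 1), by positivity, ?_⟩
      rw [div_mul_eq_mul_div, div_le_iff₀ (by positivity)]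
      nlinarith [norm_nonneg v]
    have hmem : ∀ x ∈ Metric.ball x₀ R, ∀ z ∈ Metric.closedBall (0 : ℂ) ρ,
        x + z • v ∈ Metric.closedBall x₀ (2 * R) := by
      intro x hx z hz
      rw [mem_closedBall_zero_iff] at hz
      rw [mem_ball_iff_norm] at hx
      rw [mem_closedBall_iff_norm]
      calc ‖x + z • v - x₀‖ = ‖(x - x₀) + z • v‖ := by congr 1; abel
        _ ≤ ‖x - x₀‖ + ‖z‖ * ‖v‖ := (norm_add_le _ _).trans (by rw [norm_smul])
        _ ≤ R + ρ * ‖v‖ := by gcongr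
        _ ≤ 2 * R := by linarith
    have hmemU : ∀ x ∈ Metric.ball x₀ R, ∀ z ∈ Metric.closedBall (0 : ℂ) ρ, x + z • v ∈ U :=
      fun x hx z hz => hKU (Metric.closedBall_subset_closedBall (by linarith) (hmem x hx z hz))
    have hline : ∀ (x : E) (z : ℂ), HasDerivAt (fun z : ℂ => x + z • v) v z := fun x z => by
      simpa using ((hasDerivAt_id z).smul_const v).const_add x
    have hcauchy : ∀ x ∈ Metric.ball x₀ R,
        ((2 * Real.pi * Complex.I : ℂ)⁻¹ • ∮ z in C(0, ρ), (1 / (z - 0) ^ 2) • f (x + z • v)) =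
          fderiv ℂ f x v := by
      intro x hx
      have hd : DifferentiableOn ℂ (fun z : ℂ => f (x + z • v)) (Metric.closedBall 0 ρ) :=
        fun z hz => ((hfU _ (hmemU x hx z hz)).comp z
          (hline x z).differentiableAt).differentiableWithinAt
      rw [DifferentiableOn.deriv_eq_smul_circleIntegral hρ hd, inv_smul_smul₀]
      · have h0 := (hfU _ (hmemU x hx 0 (Metric.mem_closedBall_self hρ.le))).hasFDerivAt
        have := (h0.comp_hasDerivAt 0 (hline x 0)).deriv
        simpa [Function.comp_def] using this
      · exact Complex.two_pi_I_ne_zero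
    have hball : Metric.ball x₀ R ∈ 𝓝 x₀ := Metric.ball_mem_nhds _ hR
    have hcm : ∀ θ : ℝ, circleMap 0 ρ θ ∈ Metric.closedBall (0 : ℂ) ρ := fun θ =>
      circleMap_mem_closedBall _ hρ.le _
    set c : ℝ → ℂ := fun θ => deriv (circleMap 0 ρ) θ * (1 / (circleMap 0 ρ θ - 0) ^ 2) with hc
    have hcc : Continuous c := by
      have h1 : ∀ θ, (circleMap 0 ρ θ - 0) ^ 2 ≠ 0 := fun θ => by
        simp [hρ.ne']
      simp only [hc, deriv_circleMap]
      exact ((continuous_circleMap 0 ρ).mul continuous_const).mul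
        (continuous_const.div (((continuous_circleMap 0 ρ).sub continuous_const).pow 2) h1)
    have hFc : ∀ x ∈ Metric.ball x₀ R,
        Continuous fun θ : ℝ => c θ • f (x + circleMap 0 ρ θ • v) := by
      intro x hx
      refine hcc.smul (hf.continuousOn.comp_continuous (by fun_prop) fun θ => hmemU x hx _ (hcm θ))
    have hint : HasFDerivAt (fun x => ∫ θ in (0 : ℝ)..2 * Real.pi, c θ • f (x + circleMap 0 ρ θ • v))
        (∫ θ in (0 : ℝ)..2 * Real.pi, c θ • fderiv ℂ f (x₀ + circleMap 0 ρ θ • v)) x₀ := by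
      refine intervalIntegral.hasFDerivAt_integral_of_dominated_of_fderiv_le
        (F' := fun x θ => c θ • fderiv ℂ f (x + circleMap 0 ρ θ • v))
        (bound := fun θ => ‖c θ‖ * (M / R)) hball ?_ ?_ ?_ ?_ ?_ ?_
      · filter_upwards [hball] with x hx
        exact (hFc x hx).aestronglyMeasurable
      · exact (hFc x₀ (mem_of_mem_nhds hball)).intervalIntegrable _ _
      · have hm : Measurable fun θ : ℝ => fderiv ℂ f (x₀ + circleMap 0 ρ θ • v) :=
          (measurable_fderiv ℂ f).comp (by fun_prop : Continuous
            fun θ : ℝ => x₀ + circleMap 0 ρ θ • v).measurable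
        exact (hcc.measurable.smul hm).aestronglyMeasurable
      · refine Eventually.of_forall fun θ _ x hx => ?_
        rw [norm_smul]
        gcongr
        exact hbound _ (hmem x hx _ (hcm θ))
      · exact (hcc.norm.mul continuous_const).intervalIntegrable _ _
      · refine Eventually.of_forall fun θ _ x hx => ?_
        have h1 : HasFDerivAt (fun x : E => x + circleMap 0 ρ θ • v)
            (ContinuousLinearMap.id ℂ E) x := (hasFDerivAt_id x).add_const _
        have h2 := (hfU _ (hmemU x hx _ (hcm θ))).hasFDerivAt
        exact (h2.comp x h1).const_smul (c θ)
    refine (hint.differentiableAt.const_smul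
      (2 * Real.pi * Complex.I : ℂ)⁻¹).congr_of_eventuallyEq ?_
    filter_upwards [hball] with x hx
    rw [← hcauchy x hx]
    simp only [circleIntegral, smul_smul, hc, Pi.smul_apply]
  let e₁ := ContinuousLinearEquiv.ofFinrankEq (𝕜 := ℂ) (E := E)
    (F := Fin (Module.finrank ℂ E) → ℂ) (Module.finrank_fin_fun ℂ).symm
  let e₂ := (e₁.arrowCongr (1 : F ≃L[ℂ] F)).trans (ContinuousLinearEquiv.piRing _)
  rw [← e₂.comp_differentiableAt_iff, differentiableAt_pi]
  exact fun i => happly _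

/-- A holomorphic map in several variables is smooth. -/
theorem contDiffOn_of_differentiableOn_isOpen {U : Set E} (hU : IsOpen U) {f : E → F}
    (hf : DifferentiableOn ℂ f U) : ContDiffOn ℂ ((⊤ : ℕ∞) : WithTop ℕ∞) f U := by
  rw [contDiffOn_infty]
  intro n
  induction n generalizing F with
  | zero => exact contDiffOn_zero.2 hf.continuousOn
  | succ n ih =>
    push_cast
    rw [contDiffOn_succ_iff_fderiv_of_isOpen hU]
    exact ⟨hf, by simp, ih (differentiableOn_fderiv_of_isOpen hU hf)⟩

end Holomorphic

section Slice

variable {E : Type} [NormedAddCommGroup E] [NormedSpace ℂ E] [FiniteDimensional ℂ E]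

/-- A holomorphic function whose derivatives of all orders vanish at a point vanishes on a
neighbourhood of that point of controlled size. -/
theorem eq_zero_of_iteratedFDeriv_eq_zero {F : Type} [NormedAddCommGroup F] [NormedSpace ℂ F]
    [FiniteDimensional ℂ F] {g : E → F} {x y z : E} {r : ℝ}
    (hg : DifferentiableOn ℂ g (Metric.ball x (4 * r))) (hy : y ∈ Metric.ball x r)
    (hz : z ∈ Metric.ball x r) (h0 : ∀ k, iteratedFDeriv ℂ k g y = 0) : g z = 0 := by
  have := FiniteDimensional.complete ℂ F
  set v := z - y with hv
  have hmem : ∀ w ∈ Metric.ball (0 : ℂ) (3 / 2), y + w • v ∈ Metric.ball x (4 * r) := by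
    intro w hw
    rw [mem_ball_zero_iff] at hw
    rw [mem_ball_iff_norm] at hy hz ⊢
    have hzy : ‖v‖ ≤ ‖z - x‖ + ‖y - x‖ := by
      rw [hv, ← sub_sub_sub_cancel_right z y x]
      exact norm_sub_le _ _
    have hle : ‖y + w • v - x‖ ≤ ‖y - x‖ + ‖w‖ * ‖v‖ := by
      rw [← norm_smul, add_sub_right_comm]
      exact norm_add_le _ _
    nlinarith [norm_nonneg v, norm_nonneg w]
  have hline : ∀ w : ℂ, HasDerivAt (fun w : ℂ => y + w • v) v w := fun w => by
    simpa using ((hasDerivAt_id w).smul_const v).const_add y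
  have hsmooth := contDiffOn_of_differentiableOn_isOpen Metric.isOpen_ball hg
  have hder : ∀ k : ℕ, ∀ w ∈ Metric.ball (0 : ℂ) (3 / 2),
      iteratedDeriv k (fun w : ℂ => g (y + w • v)) w =
        iteratedFDeriv ℂ k g (y + w • v) fun _ => v := by
    intro k
    induction k with
    | zero => intro w _; simp
    | succ k ih =>
      intro w hw
      have heq : iteratedDeriv k (fun w : ℂ => g (y + w • v)) =ᶠ[𝓝 w]
          fun w => iteratedFDeriv ℂ k g (y + w • v) fun _ => v :=
        Filter.eventuallyEq_of_mem (Metric.isOpen_ball.mem_nhds hw) ih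
      rw [iteratedDeriv_succ, heq.deriv_eq, iteratedFDeriv_succ_apply_left]
      have hd := ((hsmooth.contDiffAt (Metric.isOpen_ball.mem_nhds
        (hmem w hw))).differentiableAt_iteratedFDeriv (m := k)
        (by exact_mod_cast WithTop.coe_lt_top k)).hasFDerivAt.comp_hasDerivAt w (hline w)
      have := ((ContinuousMultilinearMap.apply ℂ (fun _ : Fin k => E) F
        fun _ => v).hasFDerivAt.comp_hasDerivAt w hd).deriv
      exact this
  have hu : DifferentiableOn ℂ (fun w : ℂ => g (y + w • v)) (Metric.ball 0 (3 / 2)) := fun w hw =>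
    ((hg.differentiableAt (Metric.isOpen_ball.mem_nhds (hmem w hw))).comp w
      (hline w).differentiableAt).differentiableWithinAt
  have hsum := Complex.taylorSeries_eq_on_ball hu (z := 1) (by norm_num)
  have hzero : ∀ k, iteratedDeriv k (fun w : ℂ => g (y + w • v)) 0 = 0 := fun k => by
    rw [hder k 0 (by norm_num)]
    simp [h0]
  simp only [hzero, smul_zero, tsum_zero] at hsum
  simpa [hv] using hsum.symm

/-- Local parametrization of a regular level set of a holomorphic function by an open subset of
the kernel of the differential. -/
theorem exists_parametrization_of_fderiv_ne_zero {U : Set E} (hU : IsOpen U) {φ : E → ℂ}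
    (hφ : DifferentiableOn ℂ φ U) {x₀ : E} (hx₀ : x₀ ∈ U) (h0 : fderiv ℂ φ x₀ ≠ 0) :
    ∃ (N : Set E) (W : Set (fderiv ℂ φ x₀).ker) (h : (fderiv ℂ φ x₀).ker → E),
      N ∈ 𝓝 x₀ ∧ IsOpen W ∧ DifferentiableOn ℂ h W ∧ Set.InjOn h W ∧ Set.MapsTo h W U ∧
      N ∩ {x | φ x = φ x₀} ⊆ h '' W ∧
      ∀ w ∈ W, ∀ v, fderiv ℂ φ (h w) v = 0 → ∃ u, fderiv ℂ h w u = v := by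
  have := FiniteDimensional.complete ℂ E
  have hφU : ∀ x ∈ U, DifferentiableAt ℂ φ x := fun x hx => hφ.differentiableAt (hU.mem_nhds hx)
  set L := fderiv ℂ φ x₀ with hL
  obtain ⟨P, hP⟩ := L.ker_closedComplemented_of_finiteDimensional_range
  obtain ⟨e, he⟩ : ∃ e, L e = 1 := by
    obtain ⟨v, hv⟩ : ∃ v, L v ≠ 0 := by
      by_contra! h
      exact h0 (ContinuousLinearMap.ext h)
    exact ⟨(L v)⁻¹ • v, by simp [hv]⟩
  have hker : (L.prod P).ker = ⊥ := by
    rw [LinearMap.ker_eq_bot']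
    intro v hv
    obtain ⟨h1, h2⟩ := Prod.mk.inj hv
    have := congrArg Subtype.val (hP ⟨v, h1⟩)
    have hPv : P v = 0 := h2
    simpa [hPv] using this.symm
  have hrange : (L.prod P).range = ⊤ := by
    rw [LinearMap.range_eq_top]
    rintro ⟨a, k⟩
    refine ⟨a • e + (k - P (a • e) : L.ker), Prod.ext ?_ ?_⟩
    · have : L (k - P (a • e) : L.ker) = 0 := (k - P (a • e) : L.ker).2
      simp only [ContinuousLinearMap.coe_coe, ContinuousLinearMap.prod_apply, map_add, this]
      simp [he]
    · simp only [ContinuousLinearMap.coe_coe, ContinuousLinearMap.prod_apply, map_add P, hP]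
      abel
  let A : E ≃L[ℂ] ℂ × L.ker := ContinuousLinearEquiv.ofBijective (L.prod P) hker hrange
  let Φ : E → ℂ × L.ker := fun x => (φ x, P x)
  have hΦ : ∀ x ∈ U, HasFDerivAt Φ ((fderiv ℂ φ x).prod P) x := fun x hx =>
    (hφU x hx).hasFDerivAt.prodMk P.hasFDerivAt
  have hcd : ContDiffAt ℂ 1 Φ x₀ :=
    ((((contDiffOn_of_differentiableOn_isOpen hU hφ).contDiffAt (hU.mem_nhds hx₀)).of_le
      (by exact_mod_cast le_top)).prodMk P.contDiff.contDiffAt)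
  have hA : HasFDerivAt Φ (A : E →L[ℂ] ℂ × L.ker) x₀ := hΦ x₀ hx₀
  let Ψ := hcd.toOpenPartialHomeomorph Φ hA one_ne_zero
  have hsource : x₀ ∈ Ψ.source := hcd.mem_toOpenPartialHomeomorph_source hA one_ne_zero
  have htarget : Φ x₀ ∈ Ψ.target := hcd.image_mem_toOpenPartialHomeomorph_target hA one_ne_zero
  have hinv : Ψ.symm (Φ x₀) = x₀ := Ψ.left_inv hsource
  have hsymm : ContDiffAt ℂ 1 Ψ.symm (Φ x₀) := hcd.to_localInverse hA one_ne_zero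
  have hev : ∀ᶠ y in 𝓝 (Φ x₀), y ∈ Ψ.target ∧ DifferentiableAt ℂ Ψ.symm y ∧ Ψ.symm y ∈ U := by
    filter_upwards [Ψ.open_target.mem_nhds htarget, hsymm.eventually (by simp),
      hsymm.continuousAt (hU.mem_nhds (hinv.symm ▸ hx₀))] with y h1 h2 h3
    exact ⟨h1, h2.differentiableAt one_ne_zero, h3⟩
  obtain ⟨V, hV, hVo, hxV⟩ := eventually_nhds_iff.1 hev
  have hι : ∀ w : L.ker, HasFDerivAt (fun u : L.ker => (φ x₀, u))
      (ContinuousLinearMap.inr ℂ ℂ L.ker) w := fun w => hasFDerivAt_prodMk_right _ _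
  have hh : ∀ w : L.ker, (φ x₀, w) ∈ V → HasFDerivAt (fun u : L.ker => Ψ.symm (φ x₀, u))
      ((fderiv ℂ Ψ.symm (φ x₀, w)).comp (ContinuousLinearMap.inr ℂ ℂ L.ker)) w := fun w hw =>
    (hV _ hw).2.1.hasFDerivAt.comp w (hι w)
  refine ⟨Ψ.source ∩ Φ ⁻¹' V, {u | (φ x₀, u) ∈ V}, fun u => Ψ.symm (φ x₀, u),
    ?_, ?_, ?_, ?_, ?_, ?_, ?_⟩
  · exact inter_mem (Ψ.open_source.mem_nhds hsource) (hcd.continuousAt (hVo.mem_nhds hxV))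
  · exact hVo.preimage (by fun_prop)
  · exact fun w hw => (hh w hw).differentiableAt.differentiableWithinAt
  · intro u hu w hw huw
    exact (Prod.mk.inj (Ψ.symm.injOn (hV _ hu).1 (hV _ hw).1 huw)).2
  · exact fun u hu => (hV _ hu).2.2
  · rintro x ⟨⟨hx, hxV⟩, hx0⟩
    have hx1 : Φ x = (φ x₀, P x) := Prod.ext hx0 rfl
    refine ⟨P x, ?_, ?_⟩
    · rw [Set.mem_preimage, hx1] at hxV
      exact hxV
    · change Ψ.symm (φ x₀, P x) = x
      rw [← hx1]
      exact Ψ.left_inv hx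
  · intro w hw v hv
    refine ⟨P v, ?_⟩
    rw [(hh w hw).fderiv]
    set y := Ψ.symm (φ x₀, w) with hy
    have hΦy : Φ y = (φ x₀, w) := Ψ.right_inv (hV _ hw).1
    have hys : y ∈ Ψ.source := Ψ.map_target (hV _ hw).1
    have h1 : HasFDerivAt Ψ.symm (fderiv ℂ Ψ.symm (φ x₀, w)) (Φ y) :=
      hΦy ▸ (hV _ hw).2.1.hasFDerivAt
    have h2 := h1.comp y (hΦ y (hV _ hw).2.2)
    have h3 : HasFDerivAt (Ψ.symm ∘ Φ) (ContinuousLinearMap.id ℂ E) y :=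
      (hasFDerivAt_id y).congr_of_eventuallyEq <|
        eventually_of_mem (Ψ.open_source.mem_nhds hys) fun z hz => Ψ.left_inv hz
    have h4 := congrArg (fun T : E →L[ℂ] E => T v) (h2.unique h3)
    have hvy : fderiv ℂ φ y v = 0 := hv
    simpa [hvy] using h4

end Slice

section Dim

/-- An upper bound on the Hausdorff dimension can be checked locally. -/
theorem dimH_le_of_forall_exists_mem_nhdsWithin {X : Type*} [EMetricSpace X]
    [SecondCountableTopology X] {s : Set X} {c : ENNReal}
    (h : ∀ x ∈ s, ∃ t ∈ 𝓝[s] x, dimH t ≤ c) : dimH s ≤ c := by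
  by_contra! hlt
  obtain ⟨x, hx, hxt⟩ := exists_mem_nhdsWithin_lt_dimH_of_lt_dimH hlt
  obtain ⟨t, ht, htc⟩ := h x hx
  exact (hxt t ht).not_ge htc

variable {E F : Type} [NormedAddCommGroup E] [NormedSpace ℂ E] [FiniteDimensional ℂ E]
  [NormedAddCommGroup F] [NormedSpace ℂ F] [FiniteDimensional ℂ F]

/-- Holomorphic maps do not increase the Hausdorff dimension. -/
theorem dimH_image_le_of_differentiableOn {W : Set E} (hW : IsOpen W) {h : E → F}
    (hh : DifferentiableOn ℂ h W) {s : Set E} (hs : s ⊆ W) : dimH (h '' s) ≤ dimH s := by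
  have : ProperSpace E := FiniteDimensional.proper ℂ E
  refine dimH_image_le_of_locally_lipschitzOn fun x hx => ?_
  have hc : ContDiffAt ℂ 1 h x :=
    ((contDiffOn_of_differentiableOn_isOpen hW hh).contDiffAt (hW.mem_nhds (hs hx))).of_le
      (by exact_mod_cast le_top)
  obtain ⟨K, t, ht, hL⟩ := hc.exists_lipschitzOnWith
  exact ⟨K, t, mem_nhdsWithin_of_mem_nhds ht, hL⟩

theorem dimH_le_two_mul_finrank (s : Set E) : dimH s ≤ 2 * (Module.finrank ℂ E : ℕ) := by
  have : FiniteDimensional ℝ E := FiniteDimensional.complexToReal E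
  calc dimH s ≤ dimH (Set.univ : Set E) := dimH_mono (Set.subset_univ s)
    _ = (Module.finrank ℝ E : ENNReal) := Real.dimH_univ_eq_finrank E
    _ = _ := by rw [finrank_real_of_complex]; push_cast; rfl

/-- Minors detect rank: near a point where the rank of the differential exceeds `r` there is a
holomorphic function not vanishing there but vanishing wherever the rank is at most `r`. -/
theorem exists_minor {U : Set E} (hU : IsOpen U) {f : E → F} (hf : DifferentiableOn ℂ f U) {r : ℕ}
    {x₁ : E} (hr : r < Module.finrank ℂ (fderiv ℂ f x₁).range) :
    ∃ g : E → ℂ, DifferentiableOn ℂ g U ∧ g x₁ ≠ 0 ∧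
      ∀ x, Module.finrank ℂ (fderiv ℂ f x).range ≤ r → g x = 0 := by
  obtain ⟨b, hb⟩ := exists_linearIndependent_of_le_finrank (Nat.succ_le_of_lt hr)
  choose v hv using fun i => (b i).2
  have hLv : LinearIndependent ℂ fun i => fderiv ℂ f x₁ (v i) := by
    have := hb.map' (Submodule.subtype _) (Submodule.ker_subtype _)
    rw [show (fun i => fderiv ℂ f x₁ (v i)) = Submodule.subtype _ ∘ b from funext hv]
    exact this
  obtain ⟨A, hA⟩ :=
    (Fintype.linearCombination ℂ fun i => fderiv ℂ f x₁ (v i)).exists_leftInverse_of_injective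
      (LinearMap.ker_eq_bot.2 hLv.fintypeLinearCombination_injective)
  have hAv : ∀ i, A (fderiv ℂ f x₁ (v i)) = Pi.single i 1 := fun i => by
    have := LinearMap.congr_fun hA (Pi.single i 1)
    simpa [Fintype.linearCombination_apply_single] using this
  refine ⟨fun x => (Matrix.of fun i j => A (fderiv ℂ f x (v j)) i).det, ?_, ?_, ?_⟩
  · simp only [Matrix.det_apply]
    have hd := differentiableOn_fderiv_of_isOpen hU hf
    have hentry : ∀ i j, DifferentiableOn ℂ (fun x => A (fderiv ℂ f x (v j)) i) U := fun i j =>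
      (((ContinuousLinearMap.proj (R := ℂ) (φ := fun _ => ℂ) i).comp
        A.toContinuousLinearMap).differentiable.comp_differentiableOn
          (hd.clm_apply (differentiableOn_const (v j))))
    refine DifferentiableOn.fun_sum fun σ _ => DifferentiableOn.const_smul ?_ _
    exact fun x hx => (HasFDerivWithinAt.finsetProd fun i _ =>
      (hentry (σ i) i x hx).hasFDerivWithinAt).differentiableWithinAt
  · have : (Matrix.of fun i j => A (fderiv ℂ f x₁ (v j)) i) = 1 := by
      ext i j
      simp [hAv, Matrix.one_apply, Pi.single_apply]
    simp [this]
  · intro x hx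
    by_contra hdet
    have hcol := Matrix.linearIndependent_cols_of_det_ne_zero hdet
    have hli : LinearIndependent ℂ fun j => fderiv ℂ f x (v j) := LinearIndependent.of_comp A hcol
    have hli' : LinearIndependent ℂ fun j =>
        (⟨fderiv ℂ f x (v j), LinearMap.mem_range_self _ _⟩ : (fderiv ℂ f x).range) :=
      LinearIndependent.of_comp (Submodule.subtype _) hli
    have := hli'.fintype_card_le_finrank
    simp at this
    omega

/-- The fibers of a finite-to-one map stay finite after composition with an injection. -/
theorem finite_fiber_comp {X Y Z : Type*} {f : X → Y} {h : Z → X} {U : Set X} {W : Set Z}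
    (hfin : ∀ y, {x ∈ U | f x = y}.Finite) (hinj : Set.InjOn h W) (hmap : Set.MapsTo h W U)
    (y : Y) : {w ∈ W | (f ∘ h) w = y}.Finite :=
  Set.Finite.of_finite_image ((hfin y).subset (by
    rintro _ ⟨u, ⟨hu, huy⟩, rfl⟩
    exact ⟨hmap hu, huy⟩)) (hinj.mono fun u hu => hu.1)

theorem finrank_ker_lt_of_ne_zero {E : Type*} [NormedAddCommGroup E] [NormedSpace ℂ E]
    [FiniteDimensional ℂ E] {L : E →L[ℂ] ℂ} (hL : L ≠ 0) :
    Module.finrank ℂ L.ker < Module.finrank ℂ E :=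
  Submodule.finrank_lt fun htop => hL <| by
    ext u
    exact (htop ▸ Submodule.mem_top : u ∈ L.ker)

/-- A finite-to-one holomorphic map is immersive at some point. -/
theorem exists_ker_fderiv_eq_bot {F : Type} [NormedAddCommGroup F] [NormedSpace ℂ F]
    [FiniteDimensional ℂ F] (d : ℕ) : ∀ (E : Type) [NormedAddCommGroup E] [NormedSpace ℂ E]
    [FiniteDimensional ℂ E], Module.finrank ℂ E = d → ∀ (U : Set E), IsOpen U → U.Nonempty →
    ∀ f : E → F, DifferentiableOn ℂ f U → (∀ y, {x ∈ U | f x = y}.Finite) →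
    ∃ x ∈ U, ∀ v, fderiv ℂ f x v = 0 → v = 0 := by
  induction d using Nat.strong_induction_on with
  | _ d ih =>
  intro E _ _ _ hd U hU hne f hf hfin
  rcases subsingleton_or_nontrivial E with hE | hE
  · obtain ⟨x, hx⟩ := hne
    exact ⟨x, hx, fun v _ => Subsingleton.elim _ _⟩
  obtain ⟨x₀, hx₀, h0⟩ : ∃ x₀ ∈ U, fderiv ℂ f x₀ ≠ 0 := by
    by_contra! hzero
    obtain ⟨x, hx⟩ := hne
    obtain ⟨δ, hδ, hδU⟩ := Metric.isOpen_iff.1 hU x hx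
    have hconst : ∀ y ∈ Metric.ball x δ, f y = f x := fun y hy =>
      Metric.isOpen_ball.is_const_of_fderiv_eq_zero (convex_ball x δ).isPreconnected
        (hf.mono hδU) (fun z hz => hzero z (hδU hz)) hy (Metric.mem_ball_self hδ)
    have : (𝓝[≠] x).NeBot := Module.punctured_nhds_neBot ℂ E x
    exact infinite_of_mem_nhds x (Metric.ball_mem_nhds x hδ)
      ((hfin (f x)).subset fun y hy => ⟨hδU hy, hconst y hy⟩)
  obtain ⟨v, hv⟩ : ∃ v, fderiv ℂ f x₀ v ≠ 0 := by
    by_contra! h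
    exact h0 (ContinuousLinearMap.ext h)
  obtain ⟨ℓ, hℓ⟩ := SeparatingDual.exists_ne_zero (R := ℂ) hv
  have hder : ∀ x ∈ U, HasFDerivAt (fun x => ℓ (f x)) (ℓ.comp (fderiv ℂ f x)) x := fun x hx =>
    ℓ.hasFDerivAt.comp x (hf.differentiableAt (hU.mem_nhds hx)).hasFDerivAt
  have hφ0 : fderiv ℂ (fun x => ℓ (f x)) x₀ ≠ 0 := fun h => by
    rw [(hder x₀ hx₀).fderiv] at h
    exact hℓ (congrArg (fun T : E →L[ℂ] ℂ => T v) h)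
  obtain ⟨N, W, h, hN, hW, hh, hinj, hmap, hcov, hker⟩ :=
    exists_parametrization_of_fderiv_ne_zero hU
      (fun x hx => (hder x hx).differentiableAt.differentiableWithinAt) hx₀ hφ0
  have hWne : W.Nonempty := by
    obtain ⟨w, hw, -⟩ := hcov ⟨mem_of_mem_nhds hN, rfl⟩
    exact ⟨w, hw⟩
  have hlt : Module.finrank ℂ (fderiv ℂ (fun x => ℓ (f x)) x₀).ker < d :=
    hd ▸ finrank_ker_lt_of_ne_zero hφ0
  obtain ⟨w, hw, himm⟩ := ih _ hlt _ rfl W hW hWne (f ∘ h) (hf.comp hh hmap)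
    (finite_fiber_comp hfin hinj hmap)
  refine ⟨h w, hmap hw, fun v hv => ?_⟩
  obtain ⟨u, rfl⟩ := hker w hw v (by rw [(hder _ (hmap hw)).fderiv]; simp [hv])
  have hu : u = 0 := himm u <| by
    rw [fderiv_comp w (hf.differentiableAt (hU.mem_nhds (hmap hw)))
      (hh.differentiableAt (hW.mem_nhds hw))]
    exact hv
  simp [hu]

end Dim

section Main

/-- If a holomorphic function does not vanish identically on a ball, its zeros there are
stratified by the order of vanishing. -/
theorem exists_iteratedFDeriv_eq_zero_and_ne_zero {E : Type} [NormedAddCommGroup E]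
    [NormedSpace ℂ E] [FiniteDimensional ℂ E] {g : E → ℂ} {x y z : E} {r : ℝ}
    (hg : DifferentiableOn ℂ g (Metric.ball x (4 * r))) (hy : y ∈ Metric.ball x r)
    (hz : z ∈ Metric.ball x r) (hgz : g z ≠ 0) (hgy : g y = 0) :
    ∃ m, iteratedFDeriv ℂ m g y = 0 ∧ fderiv ℂ (iteratedFDeriv ℂ m g) y ≠ 0 := by
  by_contra! h
  refine hgz (eq_zero_of_iteratedFDeriv_eq_zero hg hy hz fun k => ?_)
  induction k with
  | zero => ext v; simpa using hgy
  | succ k ih => ext v; simp [iteratedFDeriv_succ_apply_left, h k ih]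

variable {F : Type} [NormedAddCommGroup F] [NormedSpace ℂ F] [FiniteDimensional ℂ F]

/-- For a finite-to-one holomorphic map, the locus where the rank is at most `r` has Hausdorff
dimension at most `2 * r`. -/
theorem dimH_setOf_finrank_range_fderiv_le (r d : ℕ) : ∀ (E : Type) [NormedAddCommGroup E]
    [NormedSpace ℂ E] [FiniteDimensional ℂ E], Module.finrank ℂ E = d → ∀ U : Set E, IsOpen U →
    ∀ f : E → F, DifferentiableOn ℂ f U → (∀ y, {x ∈ U | f x = y}.Finite) →
    dimH {x ∈ U | Module.finrank ℂ (fderiv ℂ f x).range ≤ r} ≤ 2 * (r : ℕ) := by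
  induction d using Nat.strong_induction_on with
  | _ d ih =>
  intro E _ _ _ hd U hU f hf hfin
  rcases le_or_gt d r with hdr | hdr
  · refine (dimH_le_two_mul_finrank _).trans ?_
    rw [hd]
    gcongr
  have : ProperSpace E := FiniteDimensional.proper ℂ E
  refine dimH_le_of_forall_exists_mem_nhdsWithin fun x hx => ?_
  set S := {x ∈ U | Module.finrank ℂ (fderiv ℂ f x).range ≤ r} with hS
  obtain ⟨δ, hδ, hδU⟩ := Metric.isOpen_iff.1 hU x hx.1
  obtain ⟨ρ, hρ, hρU⟩ : ∃ ρ : ℝ, 0 < ρ ∧ Metric.ball x (4 * ρ) ⊆ U :=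
    ⟨δ / 4, by positivity, by rwa [mul_div_cancel₀ δ four_ne_zero]⟩
  have hBU : Metric.ball x ρ ⊆ U := (Metric.ball_subset_ball (by linarith)).trans hρU
  obtain ⟨x₁, hx₁, hr₁⟩ : ∃ x₁ ∈ Metric.ball x ρ, r < Module.finrank ℂ (fderiv ℂ f x₁).range := by
    obtain ⟨x₁, hx₁, himm⟩ := exists_ker_fderiv_eq_bot d E hd (Metric.ball x ρ) Metric.isOpen_ball
      ⟨x, Metric.mem_ball_self hρ⟩ f (hf.mono hBU)
      fun y => (hfin y).subset fun z hz => ⟨hBU hz.1, hz.2⟩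
    refine ⟨x₁, hx₁, ?_⟩
    rwa [LinearMap.finrank_range_of_inj
      ((injective_iff_map_eq_zero (fderiv ℂ f x₁ : E →ₗ[ℂ] F)).2 himm), hd]
  obtain ⟨g, hg, hg₁, hgS⟩ := exists_minor hU hf hr₁
  refine ⟨S ∩ Metric.ball x ρ, inter_mem_nhdsWithin _ (Metric.ball_mem_nhds x hρ), ?_⟩
  let T : ℕ → Set E := fun m => {y ∈ S ∩ Metric.ball x ρ |
    iteratedFDeriv ℂ m g y = 0 ∧ fderiv ℂ (iteratedFDeriv ℂ m g) y ≠ 0}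
  have hT : S ∩ Metric.ball x ρ ⊆ ⋃ m, T m := fun y hy => by
    obtain ⟨m, hm⟩ := exists_iteratedFDeriv_eq_zero_and_ne_zero (hg.mono hρU) hy.2 hx₁ hg₁
      (hgS y hy.1.2)
    exact Set.mem_iUnion.2 ⟨m, hy, hm⟩
  refine (dimH_mono hT).trans ?_
  rw [dimH_iUnion]
  refine iSup_le fun m => dimH_le_of_forall_exists_mem_nhdsWithin fun y hy => ?_
  obtain ⟨w, hw⟩ : ∃ w, fderiv ℂ (iteratedFDeriv ℂ m g) y w ≠ 0 := by
    by_contra! h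
    exact hy.2.2 (ContinuousLinearMap.ext h)
  obtain ⟨v, hv⟩ : ∃ v, fderiv ℂ (iteratedFDeriv ℂ m g) y w v ≠ 0 := by
    by_contra! h
    exact hw (ContinuousMultilinearMap.ext h)
  have hφ : ∀ z ∈ U, HasFDerivAt (fun z => iteratedFDeriv ℂ m g z v)
      ((ContinuousMultilinearMap.apply ℂ (fun _ : Fin m => E) ℂ v).comp
        (fderiv ℂ (iteratedFDeriv ℂ m g) z)) z := fun z hz =>
    (ContinuousMultilinearMap.apply ℂ (fun _ : Fin m => E) ℂ v).hasFDerivAt.comp z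
      (((contDiffOn_of_differentiableOn_isOpen hU hg).contDiffAt
        (hU.mem_nhds hz)).differentiableAt_iteratedFDeriv
          (by exact_mod_cast WithTop.coe_lt_top m)).hasFDerivAt
  have hφ0 : fderiv ℂ (fun z => iteratedFDeriv ℂ m g z v) y ≠ 0 := fun h => by
    rw [(hφ y hy.1.1.1).fderiv] at h
    exact hv (congrArg (fun L : E →L[ℂ] ℂ => L w) h)
  obtain ⟨N, W, h, hN, hW, hh, hinj, hmap, hcov, -⟩ := exists_parametrization_of_fderiv_ne_zero hU
    (fun z hz => (hφ z hz).differentiableAt.differentiableWithinAt) hy.1.1.1 hφ0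
  have hlt : Module.finrank ℂ (fderiv ℂ (fun z => iteratedFDeriv ℂ m g z v) y).ker < d :=
    hd ▸ finrank_ker_lt_of_ne_zero hφ0
  refine ⟨T m ∩ N, inter_mem_nhdsWithin _ hN, ?_⟩
  have hsub : T m ∩ N ⊆ h '' {u ∈ W | Module.finrank ℂ (fderiv ℂ (f ∘ h) u).range ≤ r} := by
    rintro z ⟨hz, hzN⟩
    obtain ⟨u, hu, rfl⟩ := hcov ⟨hzN, by simp [hz.2.1, hy.2.1]⟩
    refine ⟨u, ⟨hu, ?_⟩, rfl⟩
    rw [fderiv_comp u (hf.differentiableAt (hU.mem_nhds (hmap hu)))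
      (hh.differentiableAt (hW.mem_nhds hu))]
    exact (Submodule.finrank_mono (LinearMap.range_comp_le_range _ _)).trans hz.1.1.2
  calc dimH (T m ∩ N) ≤ _ := dimH_mono hsub
    _ ≤ dimH {u ∈ W | Module.finrank ℂ (fderiv ℂ (f ∘ h) u).range ≤ r} :=
      dimH_image_le_of_differentiableOn hW hh fun u hu => hu.1
    _ ≤ _ := ih _ hlt _ rfl W hW (f ∘ h) (hf.comp hh hmap)
      (finite_fiber_comp hfin hinj hmap)

end Main

/-- If `f` is a finite-to-one holomorphic map defined on an open subset `U` of `ℂⁿ`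
(a chart of a complex manifold), then for all `1 ≤ k ≤ n` the set
`Σ̂ᵏ(f) = {x ∈ U | corank df_x ≥ k}` has complex dimension at most `n - k`, i.e.
Hausdorff dimension at most `2(n - k)`. -/
theorem dim_hatSigma_le_of_finite_to_one (n p : ℕ) (U : Set (Fin n → ℂ))
    (hU : IsOpen U) (f : (Fin n → ℂ) → (Fin p → ℂ))
    (hf : DifferentiableOn ℂ f U)
    (hfin : ∀ y : Fin p → ℂ, {x ∈ U | f x = y}.Finite)
    (k : ℕ) (hk1 : 1 ≤ k) (hkn : k ≤ n) :
    dimH {x ∈ U | k ≤ corankAt n p f x} ≤ 2 * (n - k : ℕ) := by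
  refine (dimH_mono ?_).trans (dimH_setOf_finrank_range_fderiv_le (n - k) n (Fin n → ℂ)
    (Module.finrank_fin_fun ℂ) U hU f hf hfin)
  rintro x ⟨hx, hkx⟩
  refine ⟨hx, ?_⟩
  unfold corankAt at hkx
  omega
end

section
/- Mond's double point ideal is independent of the choice of matrix: if f : (C^n,0) → (C^p,0) is holomorphic and α, β are two p × n matrices of germs each satisfying f(x) - f(x') = M·(x - x'), then the ideal generated by the pullback of the diagonal ideal (f_j(x) - f_j(x'), j ≤ p) together with the n × n minors of α equals the corresponding ideal formed with β. -/
open Filter Topology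

/-- The local ring of germs at `z` of complex-analytic functions, as a subring of the
ring of germs of all functions at `z`. -/
noncomputable def analyticGerms (E : Type*) [NormedAddCommGroup E] [NormedSpace ℂ E]
    (z : E) : Subring (Filter.Germ (nhds z) ℂ) where
  carrier := {γ | ∃ g : E → ℂ, AnalyticAt ℂ g z ∧ γ = (g : Filter.Germ (nhds z) ℂ)}
  mul_mem' := by rintro a b ⟨g, hg, rfl⟩ ⟨h, hh, rfl⟩; exact ⟨g * h, hg.mul hh, rfl⟩
  one_mem' := ⟨1, analyticAt_const, rfl⟩
  add_mem' := by rintro a b ⟨g, hg, rfl⟩ ⟨h, hh, rfl⟩; exact ⟨g + h, hg.add hh, rfl⟩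
  zero_mem' := ⟨0, analyticAt_const, rfl⟩
  neg_mem' := by rintro a ⟨g, hg, rfl⟩; exact ⟨-g, hg.neg, rfl⟩

/-- Mond's double point ideal `I²(f)` in the local ring `O_{2n}` of holomorphic germs at
the origin of `ℂⁿ × ℂⁿ`, formed from a matrix `α` with `f(x)-f(x') = α(x,x')(x-x')`:
it is generated by the germs of the components `fⱼ(x) - fⱼ(x')` together with the
`n × n` minors of `α`. -/
noncomputable def mondDoubleIdeal (n p : ℕ) (f : (Fin n → ℂ) → (Fin p → ℂ))
    (α : Fin p → Fin n → ((Fin n → ℂ) × (Fin n → ℂ)) → ℂ) :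
    Ideal (analyticGerms ((Fin n → ℂ) × (Fin n → ℂ)) (0, 0)) :=
  Ideal.span
    ({γ | ∃ j : Fin p, (γ : Filter.Germ (nhds ((0, 0) : (Fin n → ℂ) × (Fin n → ℂ))) ℂ)
          = ((fun w : (Fin n → ℂ) × (Fin n → ℂ) => f w.1 j - f w.2 j) : Filter.Germ (nhds ((0, 0) : (Fin n → ℂ) × (Fin n → ℂ))) ℂ)}
      ∪ {γ | ∃ rows : Fin n → Fin p, StrictMono rows ∧
          (γ : Filter.Germ (nhds ((0, 0) : (Fin n → ℂ) × (Fin n → ℂ))) ℂ)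
          = ((fun w : (Fin n → ℂ) × (Fin n → ℂ) => (Matrix.of fun i i' : Fin n => α (rows i) i' w).det) :
              Filter.Germ (nhds ((0, 0) : (Fin n → ℂ) × (Fin n → ℂ))) ℂ)})

section Koszul

variable {R ι : Type*} [CommRing R] [DecidableEq ι]

/-- The submodule of `ι → R` spanned by the Koszul relations between the elements `u i`. -/
def koszulRelations (u : ι → R) : Submodule R (ι → R) :=
  Submodule.span R (Set.range fun ab : ι × ι =>
    u ab.1 • (Pi.single ab.2 1 : ι → R) - u ab.2 • (Pi.single ab.1 1 : ι → R))

theorem koszul_mem_koszulRelations (u : ι → R) (a b : ι) :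
    u a • (Pi.single b 1 : ι → R) - u b • (Pi.single a 1 : ι → R) ∈ koszulRelations u :=
  Submodule.subset_span ⟨(a, b), rfl⟩

theorem dotProduct_eq_zero_of_mem_koszulRelations [Fintype ι] {u v : ι → R}
    (hv : v ∈ koszulRelations u) : v ⬝ᵥ u = 0 := by
  induction hv using Submodule.span_induction with
  | mem x hx =>
    obtain ⟨⟨a, b⟩, rfl⟩ := hx
    simp [sub_dotProduct, mul_comm]
  | zero => simp
  | add x y _ _ hx hy => simp [add_dotProduct, hx, hy]
  | smul c x _ hx => simp [hx]

theorem map_mem_koszulRelations {S : Type*} [CommRing S] (φ : R →+* S) {u v : ι → R}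
    (hv : v ∈ koszulRelations u) : φ ∘ v ∈ koszulRelations (φ ∘ u) := by
  induction hv using Submodule.span_induction with
  | mem x hx =>
    obtain ⟨⟨a, b⟩, rfl⟩ := hx
    convert koszul_mem_koszulRelations (φ ∘ u) a b using 1
    ext i
    simp [Pi.single_apply, apply_ite φ]
  | zero =>
    convert (koszulRelations (φ ∘ u)).zero_mem using 1
    ext i
    simp
  | add x y _ _ hx hy =>
    convert add_mem hx hy using 1
    ext i
    simp
  | smul c x _ hx =>
    convert (koszulRelations (φ ∘ u)).smul_mem (φ c) hx using 1
    ext i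
    simp

/-- If every `u a` is a nonzerodivisor modulo the ideal generated by any finite subfamily not
containing `u a`, then all linear relations between the `u i` are Koszul. -/
theorem mem_koszulRelations_of_regular [Fintype ι] {u : ι → R}
    (hreg : ∀ (s : Finset ι) (a : ι), a ∉ s → ∀ r : R,
      r * u a ∈ Ideal.span (u '' s) → r ∈ Ideal.span (u '' s))
    {v : ι → R} (hv : v ⬝ᵥ u = 0) : v ∈ koszulRelations u := by
  suffices H : ∀ (s : Finset ι) (v : ι → R), (∀ i ∉ s, v i = 0) → v ⬝ᵥ u = 0 →
      v ∈ koszulRelations u from H Finset.univ v (by simp) hv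
  intro s
  induction s using Finset.induction_on with
  | empty =>
    intro v hs _
    rw [show v = 0 from funext fun i => hs i (by simp)]
    exact zero_mem _
  | insert a s ha ih =>
    intro v hs hv
    have hsum : v a * u a = -∑ i ∈ s, v i * u i := by
      rw [dotProduct, ← Finset.sum_subset (Finset.subset_univ (insert a s))
        (fun i _ hi => by rw [hs i hi, zero_mul]), Finset.sum_insert ha] at hv
      exact eq_neg_of_add_eq_zero_left hv
    have hva : v a ∈ Ideal.span (u '' s) := by
      refine hreg s a ha _ (hsum ▸ neg_mem (sum_mem fun i hi => ?_))
      exact Ideal.mul_mem_left _ _ (Ideal.subset_span ⟨i, hi, rfl⟩)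
    obtain ⟨c, hc⟩ := (Submodule.mem_span_image_finset_iff_exists_fun' R).1 hva
    have hk : ∑ i ∈ s, c i • (u i • (Pi.single a 1 : ι → R) - u a • (Pi.single i 1 : ι → R)) ∈
        koszulRelations u :=
      sum_mem fun i _ => Submodule.smul_mem _ _ (koszul_mem_koszulRelations u i a)
    refine (Submodule.sub_mem_iff_left _ hk).1 (ih _ ?_ ?_)
    · intro i hi
      by_cases hia : i = a
      · subst hia
        simp only [Pi.sub_apply, Finset.sum_apply, Pi.smul_apply, Pi.single_eq_same, smul_eq_mul,
          mul_one]
        rw [sub_eq_zero, ← hc]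
        refine Finset.sum_congr rfl fun j hj => ?_
        simp [ne_of_mem_of_not_mem hj hi |>.symm]
      · have : ∀ j ∈ s, i ≠ j := fun j hj h => hi (h ▸ hj)
        simp only [Pi.sub_apply, Finset.sum_apply, Pi.smul_apply, smul_eq_mul]
        rw [hs i (by simp [hia, hi]), Finset.sum_eq_zero, sub_zero]
        intro j hj
        simp [hia, this j hj]
    · rw [sub_dotProduct, hv, dotProduct_eq_zero_of_mem_koszulRelations hk, sub_zero]

end Koszul

section Det

variable {R ι : Type*} [CommRing R] [DecidableEq ι] [Fintype ι]

open Matrix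

theorem det_updateRow_eq_zero_of_mem_koszulRelations {M : Matrix ι ι R} {u k : ι → R} {j : ι}
    (hM : ∀ i ≠ j, M i ⬝ᵥ u = 0) (hk : k ∈ koszulRelations u) :
    (M.updateRow j k).det = 0 := by
  induction hk using Submodule.span_induction with
  | mem x hx =>
    obtain ⟨⟨a, b⟩, rfl⟩ := hx
    have hu : M.updateRow j (Pi.single b 1) *ᵥ u = u b • (Pi.single j 1 : ι → R) := by
      ext i
      by_cases hij : i = j
      · subst hij
        simp [mulVec]
      · simp [mulVec, hij, hM i hij]
    have h := congrFun (congrArg (fun w => (M.updateRow j (Pi.single b 1)).adjugate *ᵥ w) hu) a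
    simp only [mulVec_mulVec, adjugate_mul, smul_mulVec, one_mulVec, mulVec_smul, mulVec_single_one,
      Pi.smul_apply, smul_eq_mul, col_apply, adjugate_apply, updateRow_idem] at h
    change (M.updateRow j (u a • Pi.single b 1 - u b • Pi.single a 1)).det = 0
    rw [sub_eq_add_neg, ← neg_smul, det_updateRow_add, det_updateRow_smul, det_updateRow_smul]
    linear_combination h
  | zero => exact det_eq_zero_of_row_eq_zero j (by simp)
  | add x y _ _ hx hy => rw [det_updateRow_add, hx, hy, add_zero]
  | smul c x _ hx => rw [det_updateRow_smul, hx, mul_zero]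

/-- Two square matrices killing `u` whose rows differ by Koszul relations between the `u i` have
the same determinant. -/
theorem det_eq_det_of_sub_mem_koszulRelations {A B : Matrix ι ι R} {u : ι → R}
    (hA : A *ᵥ u = 0) (hAB : ∀ i, B i - A i ∈ koszulRelations u) : A.det = B.det := by
  have hB : B *ᵥ u = 0 := by
    ext i
    have h := dotProduct_eq_zero_of_mem_koszulRelations (hAB i)
    rw [sub_dotProduct, sub_eq_zero] at h
    exact h.trans (congrFun hA i)
  suffices H : ∀ s : Finset ι,
      A.det = (Matrix.of fun i l => if i ∈ s then B i l else A i l).det by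
    convert H Finset.univ using 2
    ext i l
    simp
  intro s
  induction s using Finset.induction_on with
  | empty =>
    congr 1
  | insert j s hj ih =>
    set M : Matrix ι ι R := Matrix.of fun i l => if i ∈ s then B i l else A i l with hMdef
    have hM : ∀ i, M i ⬝ᵥ u = 0 := fun i => by
      by_cases his : i ∈ s
      · rw [show M i = B i by ext l; simp [hMdef, his]]
        exact congrFun hB i
      · rw [show M i = A i by ext l; simp [hMdef, his]]
        exact congrFun hA i
    have hins : (Matrix.of fun i l => if i ∈ insert j s then B i l else A i l) =
        M.updateRow j (M j + (B j - A j)) := by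
      ext i l
      by_cases hij : i = j
      · subst hij
        simp [hMdef, hj]
      · simp [hMdef, hij]
    rw [ih, hins, det_updateRow_add, updateRow_eq_self,
      det_updateRow_eq_zero_of_mem_koszulRelations (fun i _ => hM i) (hAB j), add_zero]

theorem det_sub_det_mem_of_sub_mem_koszulRelations {A B : Matrix ι ι R} {u : ι → R} {J : Ideal R}
    (hA : ∀ i, A i ⬝ᵥ u ∈ J) (hAB : ∀ i, B i - A i ∈ koszulRelations u) :
    A.det - B.det ∈ J := by
  rw [← Ideal.Quotient.eq, RingHom.map_det, RingHom.map_det]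
  refine det_eq_det_of_sub_mem_koszulRelations (u := Ideal.Quotient.mk J ∘ u) ?_ fun i => ?_
  · ext i
    rw [RingHom.mapMatrix_apply, ← RingHom.map_mulVec]
    exact Ideal.Quotient.eq_zero_iff_mem.2 (hA i)
  · convert map_mem_koszulRelations (Ideal.Quotient.mk J) (hAB i) using 1
    ext l
    simp

end Det

section Hadamard

variable {𝕜 E F : Type*} [NontriviallyNormedField 𝕜] [NormedAddCommGroup E] [NormedSpace 𝕜 E]
  [NormedAddCommGroup F] [NormedSpace 𝕜 F]

theorem ContinuousMultilinearMap.exists_divided_difference (P : E →L[𝕜] E) (l : E →L[𝕜] 𝕜) (v : E)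
    (hP : ∀ x, x = P x + l x • v) (n : ℕ) :
    ∃ D : ContinuousMultilinearMap 𝕜 (fun _ : Fin (n + 1) => E) F →L[𝕜]
        ContinuousMultilinearMap 𝕜 (fun _ : Fin n => E) F,
      (∀ p, ‖D p‖ ≤ (1 + ‖v‖ + ‖P‖) ^ (n + 1) * ‖p‖) ∧
      ∀ p x, p (fun _ => x) - p (fun _ => P x) = l x • D p (fun _ => x) := by
  set K := 1 + ‖v‖ + ‖P‖ with hK
  have hK1 : 1 ≤ K := by linarith [norm_nonneg v, norm_nonneg P]
  have hPK : ‖P‖ ≤ K := by linarith [norm_nonneg v]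
  have hcons : ∀ (m : ℕ) (x : E), (fun _ : Fin (m + 1) => x) = Fin.cons x fun _ => x := by
    intro m x
    ext i
    refine Fin.cases ?_ (fun _ => ?_) i <;> simp
  induction n with
  | zero =>
    have hbound : ∀ p : ContinuousMultilinearMap 𝕜 (fun _ : Fin (0 + 1) => E) F,
        ‖p.curryLeft v‖ ≤ ‖p‖ * ‖v‖ := fun p => by
      simpa using p.curryLeft.le_opNorm v
    refine ⟨LinearMap.mkContinuous
      { toFun := fun p => p.curryLeft v
        map_add' := fun _ _ => by ext; simp
        map_smul' := fun _ _ => by ext; simp } ‖v‖ fun p => ?_, fun p => ?_, fun p x => ?_⟩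
    · simpa [mul_comm] using hbound p
    · refine (hbound p).trans ?_
      rw [mul_comm, show K ^ (0 + 1) = K by simp]
      gcongr
      linarith [norm_nonneg P]
    · have h' : p (fun _ => x) - p (fun _ => P x) = p.curryLeft (x - P x) fun _ => x := by
        rw [map_sub, _root_.sub_apply, p.curryLeft_apply, p.curryLeft_apply,
          ← hcons, hcons 0 (P x), Subsingleton.elim (fun _ : Fin 0 => x) fun _ => P x]
      rw [h', sub_eq_of_eq_add' (hP x), map_smul]
      rfl
  | succ n ih =>
    obtain ⟨D, hD, hDp⟩ := ih
    have hbound : ∀ p : ContinuousMultilinearMap 𝕜 (fun _ : Fin (n + 1 + 1) => E) F,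
        ‖(p.curryLeft v).compContinuousLinearMap (fun _ => P) +
          ContinuousLinearMap.uncurryLeft (Ei := fun _ => E) (D ∘L p.curryLeft)‖ ≤ K ^ (n + 1 + 1) * ‖p‖ := by
      intro p
      have h1 : ‖(p.curryLeft v).compContinuousLinearMap (fun _ => P)‖ ≤
          ‖v‖ * K ^ (n + 1) * ‖p‖ := by
        refine (ContinuousMultilinearMap.norm_compContinuousLinearMap_le _ _).trans ?_
        have := p.curryLeft.le_opNorm v
        rw [ContinuousMultilinearMap.curryLeft_norm] at this
        rw [Finset.prod_const, Finset.card_univ, Fintype.card_fin]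
        calc _ ≤ (‖p‖ * ‖v‖) * K ^ (n + 1) := by gcongr
          _ = _ := by ring
      have h2 : ‖ContinuousLinearMap.uncurryLeft (Ei := fun _ => E) (D ∘L p.curryLeft)‖ ≤ K ^ (n + 1) * ‖p‖ := by
        rw [ContinuousLinearMap.uncurryLeft_norm]
        refine ContinuousLinearMap.opNorm_le_bound _ (by positivity) fun y => ?_
        refine (hD _).trans ?_
        have := p.curryLeft.le_opNorm y
        rw [ContinuousMultilinearMap.curryLeft_norm] at this
        rw [mul_assoc]
        exact mul_le_mul_of_nonneg_left this (by positivity)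
      refine (norm_add_le _ _).trans ((add_le_add h1 h2).trans ?_)
      have : 0 ≤ ‖P‖ * K ^ (n + 1) * ‖p‖ := by positivity
      rw [pow_succ K (n + 1)]
      nth_rewrite 4 [hK]
      linarith
    refine ⟨LinearMap.mkContinuous
      { toFun := fun p => (p.curryLeft v).compContinuousLinearMap (fun _ => P) +
          ContinuousLinearMap.uncurryLeft (Ei := fun _ => E) (D ∘L p.curryLeft)
        map_add' := fun p q => by
          ext x
          have hD : D ((p + q).curryLeft (x 0)) = D (p.curryLeft (x 0)) + D (q.curryLeft (x 0)) :=
            map_add D (p.curryLeft (x 0)) (q.curryLeft (x 0))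
          simp [hD]
          abel
        map_smul' := fun c p => by
          ext x
          have hD : D ((c • p).curryLeft (x 0)) = c • D (p.curryLeft (x 0)) :=
            map_smul D c (p.curryLeft (x 0))
          simp [hD] } (K ^ (n + 1 + 1)) hbound, hbound, fun p x => ?_⟩
    have h := hDp (p.curryLeft x) x
    simp only [ContinuousMultilinearMap.curryLeft_apply, ← hcons] at h
    have h' : p (Fin.cons x fun _ => P x) - p (Fin.cons (P x) fun _ => P x) =
        p.curryLeft (x - P x) fun _ => P x := by
      rw [map_sub, _root_.sub_apply, p.curryLeft_apply, p.curryLeft_apply]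
    rw [sub_eq_of_eq_add' (hP x), map_smul, ← hcons] at h'
    rw [← sub_add_sub_cancel _ (p (Fin.cons x fun _ => P x)), h, h', add_comm, _root_.smul_apply,
      ← smul_add]
    rfl

/-- Hadamard's lemma for analytic functions: if `x = P x + l x • v` with `P` and `l` linear, then
`g x - g (P x)` is the product of `l x` with an analytic function. -/
theorem AnalyticAt.exists_sub_comp_eq_smul [CompleteSpace F] {g : E → F} (hg : AnalyticAt 𝕜 g 0)
    (P : E →L[𝕜] E) (l : E →L[𝕜] 𝕜) (v : E) (hP : ∀ x, x = P x + l x • v) :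
    ∃ h : E → F, AnalyticAt 𝕜 h 0 ∧ ∀ᶠ x in 𝓝 0, g x - g (P x) = l x • h x := by
  obtain ⟨p, hp⟩ := hg
  choose D hD hDp using ContinuousMultilinearMap.exists_divided_difference (F := F) P l v hP
  set K := 1 + ‖v‖ + ‖P‖ with hK
  have hK0 : 0 < K := by positivity
  let q : FormalMultilinearSeries 𝕜 E F := fun n => D n (p (n + 1))
  have hq : 0 < q.radius := by
    obtain ⟨r, hr0, hr⟩ := ENNReal.lt_iff_exists_nnreal_btwn.1 hp.radius_pos
    obtain ⟨C, hC0, hC⟩ := p.norm_mul_pow_le_of_lt_radius hr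
    have hr0' : (0 : ℝ) < r := by exact_mod_cast hr0
    refine lt_of_lt_of_le (b := ((r / ⟨K, hK0.le⟩ : NNReal) : ENNReal)) ?_
      (q.le_radius_of_bound (K / r * C) fun n => ?_)
    · exact_mod_cast div_pos hr0' hK0
    · calc ‖q n‖ * ((r / ⟨K, hK0.le⟩ : NNReal) : ℝ) ^ n
          ≤ K ^ (n + 1) * ‖p (n + 1)‖ * (r / K) ^ n := by
            exact mul_le_mul_of_nonneg_right (hD n _) (by positivity)
        _ = K / r * (‖p (n + 1)‖ * r ^ (n + 1)) := by
            rw [div_pow]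
            field_simp
            ring
        _ ≤ K / r * C := by
            gcongr
            exact hC _
  refine ⟨q.sum, ⟨q, (q.hasFPowerSeriesOnBall hq).hasFPowerSeriesAt⟩, ?_⟩
  have hPt : Tendsto P (𝓝 0) (𝓝 0) := by simpa using P.continuous.tendsto 0
  have h1 := hp.eventually_hasSum
  filter_upwards [h1, hPt.eventually h1,
    (q.hasFPowerSeriesOnBall hq).hasFPowerSeriesAt.eventually_hasSum] with x hx hPx hqx
  simp only [zero_add] at hx hPx hqx
  have h2 := hx.sub hPx
  rw [← hasSum_nat_add_iff' 1] at h2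
  have h3 := hqx.const_smul (l x)
  simp only [q, ← hDp] at h3
  have := h2.unique h3
  rw [← this]
  simp [Subsingleton.elim (fun _ : Fin 0 => x) (fun _ => P x)]

end Hadamard

section Germs

variable {E : Type*} [NormedAddCommGroup E] [NormedSpace ℂ E] {z : E}

/-- The germ of an analytic function, as an element of the ring of analytic germs. -/
noncomputable def AnalyticAt.germ {g : E → ℂ} (hg : AnalyticAt ℂ g z) : analyticGerms E z :=
  ⟨(g : Germ (𝓝 z) ℂ), g, hg, rfl⟩

theorem analyticGerms.exists_eq_germ (r : analyticGerms E z) :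
    ∃ (g : E → ℂ) (hg : AnalyticAt ℂ g z), r = hg.germ := by
  obtain ⟨r, g, hg, rfl⟩ := r
  exact ⟨g, hg, rfl⟩

theorem AnalyticAt.coe_det_germ {ι : Type*} [Fintype ι] [DecidableEq ι] {α : ι → ι → E → ℂ}
    (hα : ∀ i l, AnalyticAt ℂ (α i l) z) :
    ((Matrix.of fun i l => (hα i l).germ).det : Germ (𝓝 z) ℂ) =
      ((fun w => (Matrix.of fun i l => α i l w).det : E → ℂ) : Germ (𝓝 z) ℂ) := by
  have h1 : (fun w => (Matrix.of fun i l => α i l w).det : E → ℂ) =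
      (Matrix.of fun i l => α i l).det := by
    ext w
    exact (RingHom.map_det (Pi.evalRingHom (fun _ : E => ℂ) w) (Matrix.of fun i l => α i l)).symm
  rw [h1]
  exact ((analyticGerms E z).subtype.map_det _).trans
    (RingHom.map_det (Germ.coeRingHom (R := ℂ) (𝓝 z)) (Matrix.of fun i l => α i l)).symm

end Germs

theorem eventually_eq_zero_of_mul_linear_eq_zero {𝕜 E : Type*} [NontriviallyNormedField 𝕜]
    [NormedAddCommGroup E] [NormedSpace 𝕜 E] {f : E → 𝕜} {z v : E} {l : E →L[𝕜] 𝕜}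
    (hf : ∀ᶠ w in 𝓝 z, ContinuousAt f w) (hv : l v = 1) (h : ∀ᶠ w in 𝓝 z, f w * l w = 0) :
    ∀ᶠ w in 𝓝 z, f w = 0 := by
  filter_upwards [hf, h.eventually_nhds] with w hfw hw
  by_cases hlw : l w = 0
  · have hline : Tendsto (fun t : 𝕜 => w + t • v) (𝓝[≠] 0) (𝓝 w) := by
      have : ContinuousAt (fun t : 𝕜 => w + t • v) 0 := by fun_prop
      simpa [ContinuousAt] using this.tendsto.mono_left (nhdsWithin_le_nhds (s := {0}ᶜ))
    refine tendsto_nhds_unique (hfw.tendsto.comp hline) (tendsto_const_nhds.congr' ?_)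
    filter_upwards [hline.eventually hw, self_mem_nhdsWithin] with t ht ht0
    simpa [hlw, hv, eq_comm, show t ≠ 0 from ht0] using ht
  · exact (mul_eq_zero.1 hw.self_of_nhds).resolve_right hlw

section DoublePoints

variable {n : ℕ}

/-- The linear form `(x, x') ↦ xᵢ - x'ᵢ`. -/
noncomputable def coordDiff (i : Fin n) : (Fin n → ℂ) × (Fin n → ℂ) →L[ℂ] ℂ :=
  (ContinuousLinearMap.proj i).comp (ContinuousLinearMap.fst ℂ _ _) -
    (ContinuousLinearMap.proj i).comp (ContinuousLinearMap.snd ℂ _ _)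

@[simp]
theorem coordDiff_apply (i : Fin n) (w : (Fin n → ℂ) × (Fin n → ℂ)) :
    coordDiff i w = w.1 i - w.2 i := rfl

/-- The projection replacing `xᵢ` by `x'ᵢ` for all `i ∈ s`. -/
noncomputable def diagonalProj (s : Finset (Fin n)) :
    (Fin n → ℂ) × (Fin n → ℂ) →L[ℂ] (Fin n → ℂ) × (Fin n → ℂ) :=
  (ContinuousLinearMap.pi fun i => (ContinuousLinearMap.proj (φ := fun _ : Fin n => ℂ) i).comp
    (if i ∈ s then ContinuousLinearMap.snd ℂ (Fin n → ℂ) (Fin n → ℂ)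
      else ContinuousLinearMap.fst ℂ (Fin n → ℂ) (Fin n → ℂ))).prod
  (ContinuousLinearMap.snd ℂ (Fin n → ℂ) (Fin n → ℂ))

theorem diagonalProj_apply (s : Finset (Fin n)) (w : (Fin n → ℂ) × (Fin n → ℂ)) :
    diagonalProj s w = (fun i => if i ∈ s then w.2 i else w.1 i, w.2) := by
  refine Prod.ext (funext fun i => ?_) rfl
  by_cases hi : i ∈ s <;> simp [diagonalProj, hi]

theorem diagonalProj_diagonalProj_singleton (s : Finset (Fin n)) (a : Fin n)
    (w : (Fin n → ℂ) × (Fin n → ℂ)) :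
    diagonalProj s (diagonalProj {a} w) = diagonalProj (insert a s) w := by
  simp only [diagonalProj_apply, Finset.mem_insert, Finset.mem_singleton, Prod.mk.injEq, and_true]
  ext i
  split_ifs <;> simp_all

theorem tendsto_diagonalProj (s : Finset (Fin n)) :
    Tendsto (diagonalProj s) (𝓝 (0, 0)) (𝓝 (0, 0)) := by
  have h := (diagonalProj s).continuous.tendsto 0
  rwa [map_zero] at h

theorem AnalyticAt.comp_diagonalProj {g : (Fin n → ℂ) × (Fin n → ℂ) → ℂ}
    (hg : AnalyticAt ℂ g (0, 0)) (s : Finset (Fin n)) :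
    AnalyticAt ℂ (fun w => g (diagonalProj s w)) (0, 0) := by
  refine AnalyticAt.comp (g := g) ?_ ((diagonalProj s).analyticAt _)
  rwa [show diagonalProj s (0, 0) = (0, 0) from map_zero _]

/-- The germ at the origin of `(x, x') ↦ xᵢ - x'ᵢ`. -/
noncomputable def coordDiffGerm (i : Fin n) :
    analyticGerms ((Fin n → ℂ) × (Fin n → ℂ)) (0, 0) :=
  ((coordDiff i).analyticAt (0, 0)).germ

theorem germ_sub_germ_comp_diagonalProj_mem_span {g : (Fin n → ℂ) × (Fin n → ℂ) → ℂ}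
    (hg : AnalyticAt ℂ g (0, 0)) (s : Finset (Fin n)) :
    hg.germ - (hg.comp_diagonalProj s).germ ∈ Ideal.span (coordDiffGerm '' (s : Set (Fin n))) := by
  induction s using Finset.induction_on with
  | empty =>
    suffices h : hg.germ = (hg.comp_diagonalProj ∅).germ by
      rw [h, sub_self]
      exact zero_mem _
    refine Subtype.ext (Germ.coe_eq.2 (Eventually.of_forall fun w => ?_))
    simp [diagonalProj_apply]
  | insert a s ha ih =>
    obtain ⟨h, hh, hgh⟩ := (hg.comp_diagonalProj s).exists_sub_comp_eq_smul (diagonalProj {a})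
      (coordDiff a) (Pi.single a 1, 0) fun w => by
        rw [diagonalProj_apply]
        refine Prod.ext (funext fun i => ?_) ?_
        · by_cases hi : i = a
          · subst hi
            simp
          · simp [hi]
        · simp
    have hstep : (hg.comp_diagonalProj s).germ - (hg.comp_diagonalProj (insert a s)).germ =
        AnalyticAt.germ (z := ((0, 0) : (Fin n → ℂ) × (Fin n → ℂ))) hh * coordDiffGerm a := by
      refine Subtype.ext (Germ.coe_eq.2 ?_)
      filter_upwards [hgh] with w hw
      rw [diagonalProj_diagonalProj_singleton] at hw
      exact hw.trans (mul_comm _ _)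
    rw [← sub_add_sub_cancel _ (hg.comp_diagonalProj s).germ, hstep]
    refine add_mem (Ideal.span_mono (Set.image_mono (by simp)) ih) ?_
    exact Ideal.mul_mem_left _ _ (Ideal.subset_span ⟨a, by simp, rfl⟩)

theorem exists_representative_comp_diagonalProj_eq_zero {s : Finset (Fin n)}
    {r : analyticGerms ((Fin n → ℂ) × (Fin n → ℂ)) (0, 0)}
    (hr : r ∈ Ideal.span (coordDiffGerm '' (s : Set (Fin n)))) :
    ∃ g : (Fin n → ℂ) × (Fin n → ℂ) → ℂ, (r : Germ (𝓝 ((0, 0) : (Fin n → ℂ) × (Fin n → ℂ))) ℂ) = (g : Germ (𝓝 ((0, 0) : (Fin n → ℂ) × (Fin n → ℂ))) ℂ) ∧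
      ∀ w, g (diagonalProj s w) = 0 := by
  induction hr using Submodule.span_induction with
  | mem x hx =>
    obtain ⟨i, hi, rfl⟩ := hx
    refine ⟨coordDiff i, rfl, fun w => ?_⟩
    simp [diagonalProj_apply, Finset.mem_coe.1 hi]
  | zero => exact ⟨0, rfl, fun _ => rfl⟩
  | add x y _ _ hx hy =>
    obtain ⟨g, hg, hg0⟩ := hx
    obtain ⟨h, hh, hh0⟩ := hy
    refine ⟨g + h, ?_, fun w => by simp [hg0, hh0]⟩
    rw [Subring.coe_add, hg, hh]
    rfl
  | smul c x _ hx =>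
    obtain ⟨g, hg, hg0⟩ := hx
    obtain ⟨d, hd, rfl⟩ := analyticGerms.exists_eq_germ c
    refine ⟨d * g, ?_, fun w => by simp [hg0]⟩
    rw [smul_eq_mul, Subring.coe_mul, hg]
    rfl

theorem coordDiffGerm_regular (s : Finset (Fin n)) (a : Fin n) (ha : a ∉ s)
    (r : analyticGerms ((Fin n → ℂ) × (Fin n → ℂ)) (0, 0))
    (hr : r * coordDiffGerm a ∈ Ideal.span (coordDiffGerm '' (s : Set (Fin n)))) :
    r ∈ Ideal.span (coordDiffGerm '' (s : Set (Fin n))) := by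
  obtain ⟨g, hg, rfl⟩ := analyticGerms.exists_eq_germ r
  obtain ⟨k, hk, hk0⟩ := exists_representative_comp_diagonalProj_eq_zero hr
  have hgk : ∀ᶠ w in 𝓝 (0, 0), g w * coordDiff a w = k w := Germ.coe_eq.1 hk
  have hzero : ∀ᶠ w in 𝓝 (0, 0), g (diagonalProj s w) = 0 := by
    refine eventually_eq_zero_of_mul_linear_eq_zero (l := coordDiff a) (v := (Pi.single a 1, 0))
      ((hg.comp_diagonalProj s).eventually_analyticAt.mono fun w hw => hw.continuousAt)
      (by simp) ?_
    filter_upwards [(tendsto_diagonalProj s).eventually hgk] with w hw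
    rw [hk0] at hw
    simpa [diagonalProj_apply, ha] using hw
  have hgerm : (hg.comp_diagonalProj s).germ = 0 := Subtype.ext (Germ.coe_eq.2 hzero)
  simpa [hgerm] using germ_sub_germ_comp_diagonalProj_mem_span hg s

variable {p : ℕ} {f : (Fin n → ℂ) → (Fin p → ℂ)}
  {α β : Fin p → Fin n → ((Fin n → ℂ) × (Fin n → ℂ)) → ℂ}

theorem coe_germ_dotProduct_coordDiffGerm (hα : ∀ j i, AnalyticAt ℂ (α j i) (0, 0))
    (hrelα : ∀ᶠ w : (Fin n → ℂ) × (Fin n → ℂ) in 𝓝 (0, 0),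
      ∀ j, f w.1 j - f w.2 j = ∑ i, α j i w * (w.1 i - w.2 i)) (j : Fin p) :
    (((fun i => (hα j i).germ) ⬝ᵥ coordDiffGerm :
        analyticGerms ((Fin n → ℂ) × (Fin n → ℂ)) (0, 0)) : Germ (𝓝 ((0, 0) : (Fin n → ℂ) × (Fin n → ℂ))) ℂ) =
      ((fun w => f w.1 j - f w.2 j : (Fin n → ℂ) × (Fin n → ℂ) → ℂ) : Germ (𝓝 ((0, 0) : (Fin n → ℂ) × (Fin n → ℂ))) ℂ) := by
  have h : (((fun i => (hα j i).germ) ⬝ᵥ coordDiffGerm :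
        analyticGerms ((Fin n → ℂ) × (Fin n → ℂ)) (0, 0)) : Germ (𝓝 ((0, 0) : (Fin n → ℂ) × (Fin n → ℂ))) ℂ) =
      ((∑ i, α j i * ⇑(coordDiff i) : (Fin n → ℂ) × (Fin n → ℂ) → ℂ) : Germ (𝓝 ((0, 0) : (Fin n → ℂ) × (Fin n → ℂ))) ℂ) :=
    (map_sum (analyticGerms ((Fin n → ℂ) × (Fin n → ℂ)) (0, 0)).subtype _ _).trans
      (map_sum (Germ.coeRingHom (R := ℂ) (𝓝 ((0, 0) : (Fin n → ℂ) × (Fin n → ℂ)))) _ _).symm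
  rw [h]
  refine Germ.coe_eq.2 (hrelα.mono fun w hw => ?_)
  simp [hw j]

theorem mondDoubleIdeal_le (hα : ∀ j i, AnalyticAt ℂ (α j i) (0, 0))
    (hβ : ∀ j i, AnalyticAt ℂ (β j i) (0, 0))
    (hrelα : ∀ᶠ w : (Fin n → ℂ) × (Fin n → ℂ) in 𝓝 (0, 0),
      ∀ j, f w.1 j - f w.2 j = ∑ i, α j i w * (w.1 i - w.2 i))
    (hrelβ : ∀ᶠ w : (Fin n → ℂ) × (Fin n → ℂ) in 𝓝 (0, 0),
      ∀ j, f w.1 j - f w.2 j = ∑ i, β j i w * (w.1 i - w.2 i)) :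
    mondDoubleIdeal n p f α ≤ mondDoubleIdeal n p f β := by
  refine Ideal.span_le.2 ?_
  rintro γ (hγ | ⟨rows, hrows, hγ⟩)
  · exact Ideal.subset_span (Or.inl hγ)
  · have hdet : (Matrix.of fun i l => (hβ (rows i) l).germ).det ∈ mondDoubleIdeal n p f β :=
      Ideal.subset_span (Or.inr ⟨rows, hrows, AnalyticAt.coe_det_germ fun i l => hβ (rows i) l⟩)
    rw [← AnalyticAt.coe_det_germ fun i l => hα (rows i) l] at hγ
    rw [Subtype.ext hγ, SetLike.mem_coe, ← Submodule.sub_mem_iff_left _ hdet]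
    refine det_sub_det_mem_of_sub_mem_koszulRelations (u := coordDiffGerm) (fun i => ?_)
      fun i => mem_koszulRelations_of_regular coordDiffGerm_regular ?_
    · exact Ideal.subset_span
        (Or.inl ⟨rows i, coe_germ_dotProduct_coordDiffGerm hα hrelα (rows i)⟩)
    · rw [sub_dotProduct, sub_eq_zero]
      exact Subtype.ext ((coe_germ_dotProduct_coordDiffGerm hβ hrelβ (rows i)).trans
        (coe_germ_dotProduct_coordDiffGerm hα hrelα (rows i)).symm)

end DoublePoints

/-- Mond's double point ideal is independent of the choice of matrix: if `α`, `β` are two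
`p × n` matrices of holomorphic germs each satisfying `f(x) - f(x') = M·(x - x')`, then
the two resulting ideals `I²(f)` coincide. -/
theorem mondDoubleIdeal_independent_of_matrix (n p : ℕ) (hnp : n ≤ p)
    (f : (Fin n → ℂ) → (Fin p → ℂ)) (hf : AnalyticAt ℂ f 0) (hf0 : f 0 = 0)
    (α β : Fin p → Fin n → ((Fin n → ℂ) × (Fin n → ℂ)) → ℂ)
    (hα : ∀ j i, AnalyticAt ℂ (α j i) (0, 0))
    (hβ : ∀ j i, AnalyticAt ℂ (β j i) (0, 0))
    (hrelα : ∀ᶠ w : (Fin n → ℂ) × (Fin n → ℂ) in nhds (0, 0),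
      ∀ j, f w.1 j - f w.2 j = ∑ i, α j i w * (w.1 i - w.2 i))
    (hrelβ : ∀ᶠ w : (Fin n → ℂ) × (Fin n → ℂ) in nhds (0, 0),
      ∀ j, f w.1 j - f w.2 j = ∑ i, β j i w * (w.1 i - w.2 i)) :
    mondDoubleIdeal n p f α = mondDoubleIdeal n p f β := by
  exact (mondDoubleIdeal_le hα hβ hrelα hrelβ).antisymm (mondDoubleIdeal_le hβ hα hrelβ hrelα)
end

section
/- Let f : (C^n,0) → (C^p,0) with n ≤ p, and let I^2(f) be Mond's double point ideal. If O_{2n}/I^2(f) ≠ 0 then dim O_{2n}/I^2(f) ≥ 2n - p, and if dim O_{2n}/I^2(f) = 2n - p then O_{2n}/I^2(f) is Cohen-Macaulay. -/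
open Filter Topology

/-- A (Noetherian, local) commutative ring is Cohen–Macaulay iff there is a regular
sequence, contained in the Jacobson radical (= the maximal ideal in the local case),
whose length equals the Krull dimension. -/
def IsCohenMacaulayRing (R : Type*) [CommRing R] : Prop :=
  ∃ rs : List R, (∀ r ∈ rs, r ∈ (Ideal.jacobson (⊥ : Ideal R))) ∧
    RingTheory.Sequence.IsRegular R rs ∧ ringKrullDim R = rs.length

namespace MondDoublePoint

open RingTheory.Sequence

section RegularModulo

variable {A B : Type*} [CommRing A] [CommRing B]

/-- The list `l` is a (weakly) regular sequence modulo the ideal `I`. -/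
def IsRegularModulo (I : Ideal A) : List A → Prop
  | [] => True
  | x :: l => (∀ a, x * a ∈ I → a ∈ I) ∧ IsRegularModulo (I ⊔ Ideal.span {x}) l

theorem isRegularModulo_append {I : Ideal A} {l₁ l₂ : List A} :
    IsRegularModulo I (l₁ ++ l₂) ↔
      IsRegularModulo I l₁ ∧ IsRegularModulo (I ⊔ Ideal.ofList l₁) l₂ := by
  induction l₁ generalizing I with
  | nil => simp [IsRegularModulo]
  | cons x l ih =>
    simp only [List.cons_append, IsRegularModulo, ih, Ideal.ofList_cons, sup_assoc, and_assoc]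

theorem comap_sup_span_singleton {ρ : A →+* B} (hρ : Function.Surjective ρ) (I : Ideal B)
    (x : A) : I.comap ρ ⊔ Ideal.span {x} = (I ⊔ Ideal.span {ρ x}).comap ρ := by
  have h := Ideal.comap_map_of_surjective' ρ hρ (I.comap ρ ⊔ Ideal.span {x})
  rw [Ideal.map_sup, Ideal.map_comap_of_surjective ρ hρ, Ideal.map_span, Set.image_singleton] at h
  rw [h]
  refine (sup_eq_left.2 ?_).symm
  exact le_sup_of_le_left (Ideal.comap_mono bot_le)

theorem comap_sup_ofList {ρ : A →+* B} (hρ : Function.Surjective ρ) (I : Ideal B)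
    (l : List A) : I.comap ρ ⊔ Ideal.ofList l = (I ⊔ Ideal.ofList (l.map ρ)).comap ρ := by
  induction l generalizing I with
  | nil => simp
  | cons x l ih =>
    rw [Ideal.ofList_cons, ← sup_assoc, comap_sup_span_singleton hρ, ih, List.map_cons,
      Ideal.ofList_cons, sup_assoc]

theorem isRegularModulo_comap {ρ : A →+* B} (hρ : Function.Surjective ρ) {I : Ideal B}
    {l : List A} : IsRegularModulo (I.comap ρ) l ↔ IsRegularModulo I (l.map ρ) := by
  induction l generalizing I with
  | nil => simp [IsRegularModulo]
  | cons x l ih =>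
    simp only [List.map_cons, IsRegularModulo, comap_sup_span_singleton hρ, ih, Ideal.mem_comap,
      map_mul, hρ.forall]

theorem IsRegularModulo.map_localization (M : Submonoid A) [Algebra A B] [IsLocalization M B]
    {I : Ideal A} {l : List A} (h : IsRegularModulo I l) :
    IsRegularModulo (I.map (algebraMap A B)) (l.map (algebraMap A B)) := by
  induction l generalizing I with
  | nil => trivial
  | cons x l ih =>
    refine ⟨fun b hb => ?_, ?_⟩
    · obtain ⟨a, s, rfl⟩ := IsLocalization.exists_mk'_eq M b
      rw [IsLocalization.mk'_mem_map_algebraMap_iff M]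
      rw [← IsLocalization.mk'_one (M := M) B x, ← IsLocalization.mk'_mul,
        IsLocalization.mk'_mem_map_algebraMap_iff M] at hb
      obtain ⟨t, ht, hta⟩ := hb
      exact ⟨t, ht, h.1 _ (by rwa [mul_left_comm] at hta)⟩
    · have := ih h.2
      rwa [Ideal.map_sup, Ideal.map_span, Set.image_singleton] at this

/-- The quotient of `A ⧸ I` by the multiples of `x` is `A ⧸ (I + (x))`. -/
noncomputable def quotSMulTopQuotientEquiv (I : Ideal A) (x : A) :
    QuotSMulTop x (A ⧸ I) ≃ₗ[A] A ⧸ (I ⊔ Ideal.span {x}) :=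
  (Submodule.quotEquivOfEq _ _ (by
    rw [← Submodule.ideal_span_singleton_smul, ← Submodule.range_mkQ I,
      ← Submodule.map_top, ← Submodule.map_smul'', smul_eq_mul, Ideal.mul_top])).trans
    (Submodule.quotientQuotientEquivQuotientSup I (Ideal.span {x}))

theorem IsRegularModulo.isWeaklyRegular {I : Ideal A} {l : List A} (h : IsRegularModulo I l) :
    IsWeaklyRegular (A ⧸ I) l := by
  induction l generalizing I with
  | nil => exact .nil _ _
  | cons x l ih =>
    refine .cons ?_ ?_
    · rw [isSMulRegular_quotient_iff_mem_of_smul_mem]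
      exact h.1
    · exact ((quotSMulTopQuotientEquiv I x).isWeaklyRegular_congr l).2 (ih h.2)

end RegularModulo

end MondDoublePoint

namespace MondDoublePoint

open RingTheory.Sequence CategoryTheory Abelian IsLocalRing
open scoped Pointwise

section Depth

variable {A : Type} [CommRing A] [IsLocalRing A]

/-- The depth of `M` is at least `k`, in terms of the vanishing of `Ext` groups. -/
def DepthGE (A : Type) [CommRing A] [IsLocalRing A] (M : Type) [AddCommGroup M] [Module A M]
    (k : ℕ) : Prop :=
  ∀ i < k, Subsingleton (Ext (ModuleCat.of A (A ⧸ maximalIdeal A)) (ModuleCat.of A M) i)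

variable {M M₁ M₂ M₃ : Type} [AddCommGroup M] [Module A M] [AddCommGroup M₁] [Module A M₁]
  [AddCommGroup M₂] [Module A M₂] [AddCommGroup M₃] [Module A M₃]

theorem DepthGE.mono {k l : ℕ} (h : DepthGE A M l) (hkl : k ≤ l) : DepthGE A M k :=
  fun i hi => h i (hi.trans_le hkl)

theorem DepthGE.of_subsingleton [Subsingleton M] (k : ℕ) : DepthGE A M k := by
  intro i _
  refine subsingleton_of_forall_eq 0 fun x => ?_
  rw [← x.comp_mk₀_id, show 𝟙 (ModuleCat.of A M) = 0 from by ext y; exact Subsingleton.elim _ _,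
    Ext.mk₀_zero, Ext.comp_zero]

/-- The short complex of modules attached to two composable linear maps. -/
abbrev shortComplexOf (f : M₁ →ₗ[A] M₂) (g : M₂ →ₗ[A] M₃) (h : Function.Exact f g) :
    ShortComplex (ModuleCat A) :=
  ModuleCat.shortComplexOfCompEqZero f g h.linearMap_comp_eq_zero

omit [IsLocalRing A] in
theorem shortExact_shortComplexOf {f : M₁ →ₗ[A] M₂} {g : M₂ →ₗ[A] M₃} (h : Function.Exact f g)
    (hf : Function.Injective f) (hg : Function.Surjective g) :
    (shortComplexOf f g h).ShortExact where
  exact := by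
    apply ModuleCat.shortComplex_exact
    exact h
  mono_f := (ModuleCat.mono_iff_injective _).2 hf
  epi_g := (ModuleCat.epi_iff_surjective _).2 hg

theorem DepthGE.of_exact_right {f : M₁ →ₗ[A] M₂} {g : M₂ →ₗ[A] M₃} (h : Function.Exact f g)
    (hf : Function.Injective f) (hg : Function.Surjective g) {k : ℕ}
    (h₂ : DepthGE A M₂ k) (h₁ : DepthGE A M₁ (k + 1)) : DepthGE A M₃ k := by
  intro i hi
  have hS := shortExact_shortComplexOf h hf hg
  have := h₂ i hi
  have := h₁ (i + 1) (by omega)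
  refine subsingleton_of_forall_eq 0 fun x => ?_
  obtain ⟨y, rfl⟩ := Ext.covariant_sequence_exact₃ _ hS x rfl
    (Subsingleton.elim _ _)
  rw [Subsingleton.elim y 0, Ext.zero_comp]

theorem DepthGE.of_exact_left {f : M₁ →ₗ[A] M₂} {g : M₂ →ₗ[A] M₃} (h : Function.Exact f g)
    (hf : Function.Injective f) (hg : Function.Surjective g) {k : ℕ}
    (h₂ : DepthGE A M₂ (k + 1)) (h₃ : DepthGE A M₃ k) : DepthGE A M₁ (k + 1) := by
  intro i hi
  have hS := shortExact_shortComplexOf h hf hg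
  have := h₂ i hi
  refine subsingleton_of_forall_eq 0 fun x => ?_
  cases i with
  | zero =>
    have := hS.mono_f
    apply Ext.postcomp_mk₀_injective_of_mono _ (shortComplexOf f g h).f
    exact Subsingleton.elim _ _
  | succ i =>
    have := h₃ i (by omega)
    obtain ⟨y, rfl⟩ := Ext.covariant_sequence_exact₁ _ hS x (Subsingleton.elim _ _) rfl
    rw [Subsingleton.elim y 0, Ext.zero_comp]

theorem DepthGE.congr {k : ℕ} (e : M₁ ≃ₗ[A] M₂) (h : DepthGE A M₁ k) : DepthGE A M₂ k := by
  refine DepthGE.of_exact_right (f := (0 : PUnit →ₗ[A] M₁)) (g := e.toLinearMap) ?_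
    (Function.injective_of_subsingleton _) e.surjective h (.of_subsingleton _)
  intro x
  simpa using eq_comm

theorem smul_top_lt_top [Module.Finite A M] [Nontrivial M] :
    maximalIdeal A • (⊤ : Submodule A M) < ⊤ :=
  (Submodule.top_ne_ideal_smul_of_le_jacobson_annihilator (maximalIdeal_le_jacobson _)).symm.lt_top

theorem IsRegularModulo.depthGE [IsNoetherianRing A] {I : Ideal A} {l : List A}
    (hl : ∀ x ∈ l, x ∈ maximalIdeal A) (h : IsRegularModulo I l) :
    DepthGE A (A ⧸ I) l.length := by
  by_cases hI : I = ⊤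
  · have : Subsingleton (A ⧸ I) := Ideal.Quotient.subsingleton_iff.2 hI
    exact .of_subsingleton _
  have : Nontrivial (A ⧸ I) := Ideal.Quotient.nontrivial_iff.2 hI
  have hreg : IsRegular (A ⧸ I) l :=
    .of_isWeaklyRegular_of_mem_maximalIdeal _ hl h.isWeaklyRegular
  refine ModuleCat.subsingleton_ext_of_exists_isRegular (maximalIdeal A)
    (ModuleCat.of A (A ⧸ maximalIdeal A)) ?_ (ModuleCat.of A (A ⧸ I)) ?_ l hl hreg
  · rw [Module.support_eq_zeroLocus, Ideal.annihilator_quotient]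
  · exact smul_top_lt_top

theorem DepthGE.exists_isSMulRegular [IsNoetherianRing A] [Module.Finite A M] [Nontrivial M]
    (h : DepthGE A M 1) : ∃ x ∈ maximalIdeal A, IsSMulRegular M x := by
  obtain ⟨rs, hlen, hmem, hreg⟩ := ModuleCat.exists_isRegular_of_exists_subsingleton_ext
    (maximalIdeal A) 1 (ModuleCat.of A M) smul_top_lt_top (ModuleCat.of A (A ⧸ maximalIdeal A))
    (by rw [Module.support_eq_zeroLocus, Ideal.annihilator_quotient]) h
  obtain ⟨x, rfl⟩ := List.length_eq_one_iff.1 hlen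
  exact ⟨x, hmem x (by simp), ((isRegular_cons_iff _ _ _).1 hreg).1⟩

theorem DepthGE.quotSMulTop {x : A} (hx : IsSMulRegular M x) {k : ℕ} (h : DepthGE A M (k + 1)) :
    DepthGE A (QuotSMulTop x M) k := by
  refine DepthGE.of_exact_right (f := LinearMap.lsmul A M x)
    (g := (x • (⊤ : Submodule A M)).mkQ) ?_ hx (Submodule.mkQ_surjective _)
    (h.mono k.le_succ) h
  intro y
  simp [Submodule.mem_smul_pointwise_iff_exists]

omit [IsLocalRing A] in
theorem ringKrullDim_quotient_add_one_le {P P' : Ideal A} [P.IsPrime] (h : P < P') :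
    ringKrullDim (A ⧸ P') + 1 ≤ ringKrullDim (A ⧸ P) := by
  obtain ⟨x, hx', hx⟩ := Set.exists_of_ssubset h
  refine le_trans ?_ (ringKrullDim_quotient_succ_le_of_nonZeroDivisor
    (r := Ideal.Quotient.mk P x) ?_)
  · gcongr
    refine ringKrullDim_le_of_surjective (Ideal.Quotient.lift _ (Ideal.Quotient.factor h.le) ?_)
      (Ideal.Quotient.lift_surjective_of_surjective _ _ (Ideal.Quotient.factor_surjective h.le))
    intro a ha
    obtain ⟨b, rfl⟩ := Ideal.mem_span_singleton'.1 ha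
    simp [Ideal.Quotient.eq_zero_iff_mem.2 hx']
  · exact mem_nonZeroDivisors_of_ne_zero (by rwa [Ne, Ideal.Quotient.eq_zero_iff_mem])

omit [IsLocalRing A] in
theorem le_of_mem_associatedPrimes [IsNoetherianRing A] {I P : Ideal A}
    (hP : P ∈ associatedPrimes A (A ⧸ I)) : I ≤ P := by
  intro a ha
  obtain ⟨y, hy⟩ := (isAssociatedPrime_iff.1 hP).2
  obtain ⟨y, rfl⟩ := Ideal.Quotient.mk_surjective y
  rw [hy, Submodule.mem_colon_singleton, Submodule.mem_bot, Algebra.smul_def,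
    Ideal.Quotient.algebraMap_eq, Ideal.Quotient.eq_zero_iff_mem.2 ha, zero_mul]

theorem DepthGE.le_ringKrullDim_quotient [IsNoetherianRing A] [Module.Finite A M] {k : ℕ}
    (h : DepthGE A M k) {P : Ideal A} (hP : P ∈ associatedPrimes A M) :
    (k : WithBot ℕ∞) ≤ ringKrullDim (A ⧸ P) := by
  induction k generalizing M P with
  | zero =>
    have := hP.isPrime
    simpa using ringKrullDim_nonneg_of_nontrivial
  | succ k ih =>
    have hPp : P.IsPrime := hP.isPrime
    have hM : Nontrivial M := by
      by_contra hM
      rw [not_nontrivial_iff_subsingleton] at hM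
      rw [associatedPrimes.eq_empty_of_subsingleton] at hP
      exact hP
    obtain ⟨x, hxm, hx⟩ := DepthGE.exists_isSMulRegular (h.mono (by omega : 1 ≤ k + 1))
    let N : Submodule A M := Submodule.torsionBySet A M P
    have hN : ∃ n ∈ N, n ∉ x • (⊤ : Submodule A M) := by
      by_contra! hcon
      have hN0 : N = ⊥ := by
        refine Submodule.eq_bot_of_le_smul_of_le_jacobson_bot (maximalIdeal A) N
          (IsNoetherian.noetherian N) (fun n hn => ?_) (maximalIdeal_le_jacobson _)
        obtain ⟨n', -, rfl⟩ := (Submodule.mem_smul_pointwise_iff_exists _ _ _).1 (hcon n hn)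
        refine Submodule.smul_mem_smul hxm ?_
        rw [Submodule.mem_torsionBySet_iff] at hn ⊢
        intro a
        refine hx ?_
        simp only [smul_zero]
        rw [smul_comm]
        exact hn a
      obtain ⟨y, hy⟩ := (isAssociatedPrime_iff.1 hP).2
      have hyN : y ∈ N := by
        rw [Submodule.mem_torsionBySet_iff]
        rintro ⟨a, ha⟩
        rw [SetLike.mem_coe, hy, Submodule.mem_colon_singleton] at ha
        simpa using ha
      rw [hN0, Submodule.mem_bot] at hyN
      refine hPp.ne_top (hy.trans ?_)
      simp [hyN]
    obtain ⟨n, hn, hnx⟩ := hN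
    have hn0 : (x • (⊤ : Submodule A M)).mkQ n ≠ 0 := by
      simpa using hnx
    obtain ⟨P', hP', hle⟩ := exists_le_isAssociatedPrime_of_isNoetherianRing A _ hn0
    have hP'p := hP'.isPrime
    have hlt : P < P' := by
      refine lt_of_le_of_ne (fun a ha => hle ?_) ?_
      · rw [Submodule.mem_colon_singleton, Submodule.mem_bot, ← map_smul,
          show a • n = 0 from (Submodule.mem_torsionBySet_iff _ _).1 hn ⟨a, ha⟩, map_zero]
      · rintro rfl
        have hxP : x ∈ ⋃ p ∈ associatedPrimes A M, (p : Set A) :=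
          Set.mem_biUnion hP (hle (by
            rw [Submodule.mem_colon_singleton, Submodule.mem_bot, ← map_smul]
            rw [Submodule.mkQ_apply, Submodule.Quotient.mk_eq_zero]
            exact Submodule.smul_mem_pointwise_smul n x (⊤ : Submodule A M) trivial))
        rw [biUnion_associatedPrimes_eq_compl_regular] at hxP
        exact hxP hx
    have h1 := ih (h.quotSMulTop hx) hP'
    calc ((k + 1 : ℕ) : WithBot ℕ∞) = k + 1 := by simp
      _ ≤ ringKrullDim (A ⧸ P') + 1 := by gcongr
      _ ≤ _ := ringKrullDim_quotient_add_one_le hlt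

theorem ringKrullDim_quotient_le_length [IsNoetherianRing A] {I : Ideal A} (hI : I ≠ ⊤)
    {l : List A} (hlm : ∀ x ∈ l, x ∈ maximalIdeal A)
    (hl : ∀ P : Ideal A, P.IsPrime → I ⊔ Ideal.ofList l ≤ P → P = maximalIdeal A) :
    ringKrullDim (A ⧸ I) ≤ l.length := by
  classical
  have : Nontrivial (A ⧸ I) := Ideal.Quotient.nontrivial_iff.2 hI
  have : IsLocalRing (A ⧸ I) := .of_surjective' _ Ideal.Quotient.mk_surjective
  have hspan : Ideal.span ((l.map (Ideal.Quotient.mk I)).toFinset : Set (A ⧸ I)) =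
      (Ideal.ofList l).map (Ideal.Quotient.mk I) := by
    rw [Ideal.map_ofList, Ideal.ofList]
    simp
  have htop : Ideal.span ((l.map (Ideal.Quotient.mk I)).toFinset : Set (A ⧸ I)) ≠ ⊤ := by
    intro htop
    have h1 : I ⊔ Ideal.ofList l = ⊤ := by
      rw [hspan] at htop
      rw [← Ideal.mk_ker (I := I), sup_comm, ← Ideal.comap_map_of_surjective'
        (Ideal.Quotient.mk I) Ideal.Quotient.mk_surjective, htop, Ideal.comap_top]
    refine (maximalIdeal.isMaximal A).ne_top (top_le_iff.1 (h1 ▸ sup_le (le_maximalIdeal hI) ?_))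
    exact Ideal.span_le.2 hlm
  obtain ⟨Q, hQ⟩ := Ideal.nonempty_minimalPrimes htop
  have hQp : Q.IsPrime := hQ.1.1
  have hQm : Q = maximalIdeal (A ⧸ I) := by
    refine le_antisymm (le_maximalIdeal hQp.ne_top) ?_
    have h1 := hl (Q.comap (Ideal.Quotient.mk I)) inferInstance ?_
    · rw [← Ideal.map_comap_of_surjective _ Ideal.Quotient.mk_surjective (maximalIdeal (A ⧸ I)),
        Ideal.map_le_iff_le_comap, h1]
      exact le_maximalIdeal (Ideal.comap_ne_top _ (maximalIdeal.isMaximal _).ne_top)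
    · refine sup_le (fun a ha => ?_) ?_
      · rw [Ideal.mem_comap, Ideal.Quotient.eq_zero_iff_mem.2 ha]
        exact Q.zero_mem
      · rw [← Ideal.map_le_iff_le_comap, ← hspan]
        exact hQ.1.2
  rw [hQm] at hQ
  have h1 := Ideal.height_le_card_of_mem_minimalPrimes_span_finset hQ
  have h2 := List.toFinset_card_le (l.map (Ideal.Quotient.mk I))
  rw [List.length_map] at h2
  rw [← maximalIdeal_height_eq_ringKrullDim]
  exact_mod_cast h1.trans (by exact_mod_cast h2)

theorem DepthGE.isRegularModulo [IsNoetherianRing A] {I : Ideal A} {l : List A}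
    (h : DepthGE A (A ⧸ I) l.length) (hlm : ∀ x ∈ l, x ∈ maximalIdeal A)
    (hl : ∀ P : Ideal A, P.IsPrime → I ⊔ Ideal.ofList l ≤ P → P = maximalIdeal A) :
    IsRegularModulo I l := by
  induction l generalizing I with
  | nil => trivial
  | cons x l ih =>
    have hx : IsSMulRegular (A ⧸ I) x := by
      by_contra hx
      have hx' : x ∈ ⋃ p ∈ associatedPrimes A (A ⧸ I), (p : Set A) := by
        rw [biUnion_associatedPrimes_eq_compl_regular]
        exact hx
      simp only [Set.mem_iUnion] at hx'
      obtain ⟨P, hP, hxP⟩ := hx'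
      have hPp : P.IsPrime := hP.isPrime
      have h1 := h.le_ringKrullDim_quotient hP
      have hxle : I ≤ P ∧ x ∈ P := ⟨le_of_mem_associatedPrimes hP, hxP⟩
      have h2 := ringKrullDim_quotient_le_length (l := l) hPp.ne_top
        (fun y hy => hlm y (List.mem_cons_of_mem _ hy))
        (fun P' hP' hle => hl P' hP' ?_)
      · have h3 := h1.trans h2
        rw [List.length_cons, Nat.cast_le] at h3
        omega
      · rw [Ideal.ofList_cons, ← sup_assoc]
        refine le_trans (sup_le_sup_right (sup_le hxle.1 ?_) _) hle
        rw [Ideal.span_singleton_le_iff_mem]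
        exact hxle.2
    refine ⟨(isSMulRegular_quotient_iff_mem_of_smul_mem _ _).1 hx,
      ih ?_ (fun y hy => hlm y (List.mem_cons_of_mem _ hy)) ?_⟩
    · exact (h.quotSMulTop hx).congr (quotSMulTopQuotientEquiv I x)
    · rwa [sup_assoc, ← Ideal.ofList_cons]

end Depth

end MondDoublePoint

namespace MondDoublePoint

open RingTheory.Sequence CategoryTheory Abelian IsLocalRing
open scoped Pointwise

theorem height_add_ringKrullDim_quotient_le {A : Type*} [CommRing A] (P : Ideal A)
    [hP : P.IsPrime] :
    (P.height : WithBot ℕ∞) + ringKrullDim (A ⧸ P) ≤ ringKrullDim A := by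
  have h1 : (PrimeSpectrum.zeroLocus (P : Set A)) = Set.Ici (⟨P, hP⟩ : PrimeSpectrum A) := by
    ext Q; rfl
  have : Nonempty (PrimeSpectrum A) := ⟨⟨P, hP⟩⟩
  rw [ringKrullDim_quotient, h1, ← Order.coheight_eq_krullDim_Ici, ringKrullDim,
    Order.krullDim_eq_iSup_height_add_coheight_of_nonempty,
    PrimeSpectrum.height_eq_orderHeight ⟨P, hP⟩]
  exact_mod_cast le_iSup (fun a : PrimeSpectrum A => Order.height a + Order.coheight a) ⟨P, hP⟩

section ComplexIdeal

variable {S S' : Type*} [CommRing S] [CommRing S']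

/-- The product of the `r`-th row of the matrix `X` with the vector `Y`, using the first `k`
columns only. -/
def rowSum (X : ℕ → ℕ → S) (Y : ℕ → S) (k r : ℕ) : S :=
  ∑ j ∈ Finset.range k, X r j * Y j

/-- The ideal generated by the entries of the product of the `i × k` matrix `X` with the vector
`Y`, together with the `k × k` minors of `X`. -/
def complexIdeal (X : ℕ → ℕ → S) (Y : ℕ → S) (i k : ℕ) : Ideal S :=
  Ideal.span ({s | ∃ r < i, s = rowSum X Y k r} ∪
    {s | ∃ ρ : Fin k → ℕ, (∀ a, ρ a < i) ∧ s = (Matrix.of fun a b : Fin k => X (ρ a) b).det})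

variable {X : ℕ → ℕ → S} {Y : ℕ → S} {i k : ℕ}

theorem map_rowSum (φ : S →+* S') (k r : ℕ) :
    φ (rowSum X Y k r) = rowSum (fun a b => φ (X a b)) (fun b => φ (Y b)) k r := by
  simp [rowSum]

theorem rowSum_succ (k r : ℕ) : rowSum X Y (k + 1) r = rowSum X Y k r + X r k * Y k :=
  Finset.sum_range_succ _ _

theorem complexIdeal_le_iff {I : Ideal S} : complexIdeal X Y i k ≤ I ↔
    (∀ r < i, rowSum X Y k r ∈ I) ∧
      ∀ ρ : Fin k → ℕ, (∀ a, ρ a < i) → (Matrix.of fun a b : Fin k => X (ρ a) b).det ∈ I := by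
  rw [complexIdeal, Ideal.span_le, Set.union_subset_iff]
  constructor
  · rintro ⟨h1, h2⟩
    exact ⟨fun r hr => h1 ⟨r, hr, rfl⟩, fun ρ hρ => h2 ⟨ρ, hρ, rfl⟩⟩
  · rintro ⟨h1, h2⟩
    refine ⟨?_, ?_⟩
    · rintro _ ⟨r, hr, rfl⟩
      exact h1 r hr
    · rintro _ ⟨ρ, hρ, rfl⟩
      exact h2 ρ hρ

theorem rowSum_mem_complexIdeal {r : ℕ} (hr : r < i) : rowSum X Y k r ∈ complexIdeal X Y i k :=
  (complexIdeal_le_iff.1 le_rfl).1 r hr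

theorem det_mem_complexIdeal {ρ : Fin k → ℕ} (hρ : ∀ a, ρ a < i) :
    (Matrix.of fun a b : Fin k => X (ρ a) b).det ∈ complexIdeal X Y i k :=
  (complexIdeal_le_iff.1 le_rfl).2 ρ hρ

theorem map_complexIdeal (φ : S →+* S') : (complexIdeal X Y i k).map φ =
    complexIdeal (fun a b => φ (X a b)) (fun b => φ (Y b)) i k := by
  have hdet (ρ : Fin k → ℕ) : φ (Matrix.of fun a b : Fin k => X (ρ a) b).det =
      (Matrix.of fun a b : Fin k => φ (X (ρ a) b)).det := by
    rw [RingHom.map_det]; rfl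
  refine le_antisymm (Ideal.map_le_iff_le_comap.2 (complexIdeal_le_iff.2 ⟨fun r hr => ?_,
    fun ρ hρ => ?_⟩)) (complexIdeal_le_iff.2 ⟨fun r hr => ?_, fun ρ hρ => ?_⟩)
  · rw [Ideal.mem_comap, map_rowSum]
    exact rowSum_mem_complexIdeal hr
  · rw [Ideal.mem_comap, hdet]
    exact det_mem_complexIdeal hρ
  · rw [← map_rowSum]
    exact Ideal.mem_map_of_mem _ (rowSum_mem_complexIdeal hr)
  · rw [← hdet]
    exact Ideal.mem_map_of_mem _ (det_mem_complexIdeal hρ)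

theorem complexIdeal_mono_row {i' : ℕ} (h : i ≤ i') :
    complexIdeal X Y i k ≤ complexIdeal X Y i' k :=
  complexIdeal_le_iff.2 ⟨fun _ hr => rowSum_mem_complexIdeal (hr.trans_le h),
    fun _ hρ => det_mem_complexIdeal fun a => (hρ a).trans_le h⟩

theorem complexIdeal_zero_right : complexIdeal X Y i 0 = ⊤ := by
  rw [Ideal.eq_top_iff_one]
  simpa using det_mem_complexIdeal (X := X) (Y := Y) (i := i) (ρ := (Fin.elim0 : Fin 0 → ℕ))
    (fun a => a.elim0)

theorem complexIdeal_zero_left : complexIdeal X Y 0 (k + 1) = ⊥ := by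
  refine le_bot_iff.1 (complexIdeal_le_iff.2 ⟨fun r hr => absurd hr (Nat.not_lt_zero r),
    fun ρ hρ => absurd (hρ 0) (Nat.not_lt_zero _)⟩)

theorem complexIdeal_succ_le :
    complexIdeal X Y i (k + 1) ≤ complexIdeal X Y i k ⊔ Ideal.span {Y k} := by
  refine complexIdeal_le_iff.2 ⟨fun r hr => ?_, fun ρ hρ => ?_⟩
  · rw [rowSum_succ]
    exact add_mem (Ideal.mem_sup_left (rowSum_mem_complexIdeal hr))
      (Ideal.mem_sup_right (Ideal.mul_mem_left _ _ (Ideal.mem_span_singleton_self _)))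
  · refine Ideal.mem_sup_left ?_
    rw [Matrix.det_succ_column _ (Fin.last k)]
    refine sum_mem fun a _ => Ideal.mul_mem_left _ _ ?_
    convert det_mem_complexIdeal (X := X) (Y := Y) (ρ := fun b => ρ (a.succAbove b))
      (fun b => hρ _) using 2
    ext b c
    simp

theorem mul_det_eq (k : ℕ) (ρ : Fin (k + 1) → ℕ) :
    Y k * (Matrix.of fun a b : Fin (k + 1) => X (ρ a) b).det =
      ∑ a : Fin (k + 1), (-1) ^ (a + k : ℕ) *
          (Matrix.of fun b c : Fin k => X (ρ (a.succAbove b)) c).det *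
        rowSum X Y (k + 1) (ρ a) := by
  set M : Matrix (Fin (k + 1)) (Fin (k + 1)) S := Matrix.of fun a b => X (ρ a) b
  have h1 : M.adjugate.mulVec (M.mulVec fun b => Y b) = fun b : Fin (k + 1) => M.det * Y b := by
    rw [Matrix.mulVec_mulVec, Matrix.adjugate_mul, Matrix.smul_mulVec, Matrix.one_mulVec]
    rfl
  have h2 := congrFun h1 (Fin.last k)
  rw [Fin.val_last] at h2
  rw [mul_comm, ← h2, Matrix.mulVec, dotProduct]
  refine Finset.sum_congr rfl fun a _ => ?_
  congr 1
  · rw [Matrix.adjugate_fin_succ_eq_det_submatrix, Fin.val_last]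
    congr 2
    ext b c
    simp [M]
  · simp [rowSum, Matrix.mulVec, dotProduct, M, Finset.sum_range]

theorem mul_complexIdeal_sup_eq :
    Ideal.span {Y k} * complexIdeal X Y (i + 1) (k + 1) ⊔ complexIdeal X Y i (k + 1) =
      Ideal.span {rowSum X Y (k + 1) i} * (complexIdeal X Y i k ⊔ Ideal.span {Y k}) ⊔
        complexIdeal X Y i (k + 1) := by
  refine le_antisymm (sup_le ?_ le_sup_right) (sup_le ?_ le_sup_right)
  · rw [Ideal.span_singleton_mul_le_iff]
    set I := Ideal.span {rowSum X Y (k + 1) i} * (complexIdeal X Y i k ⊔ Ideal.span {Y k}) ⊔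
        complexIdeal X Y i (k + 1) with hI
    have hw {z : S} (hz : z ∈ complexIdeal X Y i k ⊔ Ideal.span {Y k}) :
        z * rowSum X Y (k + 1) i ∈ I :=
      Ideal.mem_sup_left (Ideal.mul_mem_mul_rev (Ideal.mem_span_singleton_self _) hz)
    have hle : complexIdeal X Y (i + 1) (k + 1) ≤ Submodule.colon I {Y k} := by
      refine complexIdeal_le_iff.2 ⟨fun r hr => ?_, fun ρ hρ => ?_⟩ <;>
        rw [Submodule.mem_colon_singleton, smul_eq_mul, mul_comm]
      · rcases Nat.lt_succ_iff_lt_or_eq.1 hr with hr | rfl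
        · exact Ideal.mul_mem_left _ _ (Ideal.mem_sup_right (rowSum_mem_complexIdeal hr))
        · exact hw (Ideal.mem_sup_right (Ideal.mem_span_singleton_self _))
      · by_cases hinj : Function.Injective ρ
        · rw [mul_det_eq]
          refine sum_mem fun a _ => ?_
          rcases Nat.lt_succ_iff_lt_or_eq.1 (hρ a) with hr | hr
          · exact Ideal.mul_mem_left _ _ (Ideal.mem_sup_right (rowSum_mem_complexIdeal hr))
          · rw [hr]
            refine hw (Ideal.mem_sup_left (Ideal.mul_mem_left _ _
              (det_mem_complexIdeal fun b => ?_)))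
            refine lt_of_le_of_ne (Nat.lt_succ_iff.1 (hρ _)) fun h => ?_
            exact Fin.succAbove_ne a b (hinj (h.trans hr.symm))
        · rw [Function.Injective] at hinj
          push Not at hinj
          obtain ⟨a, b, hab, hne⟩ := hinj
          rw [Matrix.det_zero_of_row_eq hne (by ext c; simp [hab]), mul_zero]
          exact I.zero_mem
    intro z hz
    simpa [mul_comm] using hle hz
  · rw [Ideal.span_singleton_mul_le_iff]
    set I := Ideal.span {Y k} * complexIdeal X Y (i + 1) (k + 1) ⊔ complexIdeal X Y i (k + 1)
      with hI
    have hY {z : S} (hz : z ∈ complexIdeal X Y (i + 1) (k + 1)) : Y k * z ∈ I :=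
      Ideal.mem_sup_left (Ideal.mul_mem_mul (Ideal.mem_span_singleton_self _) hz)
    have hwi : rowSum X Y (k + 1) i ∈ complexIdeal X Y (i + 1) (k + 1) :=
      rowSum_mem_complexIdeal i.lt_succ_self
    have hle : complexIdeal X Y i k ⊔ Ideal.span {Y k} ≤
        Submodule.colon I {rowSum X Y (k + 1) i} := by
      refine sup_le (complexIdeal_le_iff.2 ⟨fun r hr => ?_, fun ρ hρ => ?_⟩)
        ((Ideal.span_singleton_le_iff_mem _).2 ?_) <;>
        rw [Submodule.mem_colon_singleton, smul_eq_mul]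
      · have h1 : rowSum X Y k r * rowSum X Y (k + 1) i =
            rowSum X Y (k + 1) i * rowSum X Y (k + 1) r -
              Y k * (X r k * rowSum X Y (k + 1) i) := by
          rw [rowSum_succ k r]; ring
        rw [h1]
        exact sub_mem (Ideal.mul_mem_left _ _ (Ideal.mem_sup_right (rowSum_mem_complexIdeal hr)))
          (hY (Ideal.mul_mem_left _ _ hwi))
      · have h1 := mul_det_eq (X := X) (Y := Y) k (Fin.snoc ρ i)
        rw [Fin.sum_univ_castSucc] at h1
        have h2 : ∀ a, (Fin.snoc ρ i : Fin (k + 1) → ℕ) a < i + 1 := by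
          intro a
          refine Fin.lastCases ?_ (fun b => ?_) a
          · simp
          · simpa using (hρ b).trans i.lt_succ_self
        have h3 : ((-1 : S) ^ (k + k)) = 1 := Even.neg_one_pow ⟨k, rfl⟩
        simp only [Fin.succAbove_last, Fin.snoc_castSucc, Fin.snoc_last, Fin.val_last, h3,
          one_mul] at h1
        rw [← sub_eq_iff_eq_add'] at h1
        rw [← h1]
        refine sub_mem (hY (det_mem_complexIdeal h2)) (sum_mem fun a _ => ?_)
        exact Ideal.mul_mem_left _ _ (Ideal.mem_sup_right (rowSum_mem_complexIdeal (hρ a)))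
      · exact hY hwi
    intro z hz
    simpa [mul_comm] using hle hz

end ComplexIdeal

end MondDoublePoint

namespace MondDoublePoint

open RingTheory.Sequence CategoryTheory Abelian IsLocalRing
open scoped Pointwise

section DepthInduction

variable {A : Type} [CommRing A] [IsLocalRing A]

/-- The image of an ideal in a quotient ring, as a submodule over the original ring. -/
abbrev quotientImage (J K : Ideal A) : Submodule A (A ⧸ J) :=
  Submodule.map (Ideal.Quotient.mkₐ A J).toLinearMap K

omit [IsLocalRing A] in
theorem exact_subtype_factor {J K : Ideal A} (h : J ≤ K) :
    Function.Exact (quotientImage J K).subtype (Ideal.Quotient.factorₐ A h).toLinearMap := by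
  intro x
  obtain ⟨a, rfl⟩ := Ideal.Quotient.mk_surjective x
  rw [Submodule.coe_subtype, Subtype.range_coe, SetLike.mem_coe, Submodule.mem_map]
  change Ideal.Quotient.mk K a = 0 ↔ ∃ b ∈ K, Ideal.Quotient.mk J b = _
  rw [Ideal.Quotient.eq_zero_iff_mem]
  constructor
  · exact fun ha => ⟨a, ha, rfl⟩
  · rintro ⟨b, hb, hba⟩
    have : b - a ∈ J := Ideal.Quotient.eq.1 hba
    simpa using sub_mem hb (h this)

omit [IsLocalRing A] in
theorem nonempty_equiv_of_mul_sup_eq {J 𝔟 𝔠 : Ideal A} {y w : A}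
    (h : Ideal.span {y} * 𝔟 ⊔ J = Ideal.span {w} * 𝔠 ⊔ J)
    (hy : IsSMulRegular (A ⧸ J) y) (hw : IsSMulRegular (A ⧸ J) w) :
    Nonempty (quotientImage J 𝔟 ≃ₗ[A] quotientImage J 𝔠) := by
  have key (z : A) (𝔡 : Ideal A) :
      (quotientImage J 𝔡).map (LinearMap.lsmul A (A ⧸ J) z) =
        quotientImage J (Ideal.span {z} * 𝔡 ⊔ J) := by
    have hJ : Submodule.map (Ideal.Quotient.mkₐ A J).toLinearMap J = ⊥ := by
      rw [← le_bot_iff, Submodule.map_le_iff_le_comap]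
      exact fun a ha => Ideal.Quotient.eq_zero_iff_mem.2 ha
    rw [quotientImage, quotientImage, Submodule.map_sup, hJ, sup_bot_eq,
      ← smul_eq_mul, Submodule.map_smul'', Submodule.ideal_span_singleton_smul]
    rfl
  have hy' : Function.Injective (LinearMap.lsmul A (A ⧸ J) y) := hy
  have hw' : Function.Injective (LinearMap.lsmul A (A ⧸ J) w) := hw
  refine ⟨(Submodule.equivMapOfInjective _ hy' _).trans ((LinearEquiv.ofEq _ _ ?_).trans
    (Submodule.equivMapOfInjective _ hw' _).symm)⟩
  rw [key, key, h]

theorem depthGE_complexIdeal_step {X : ℕ → ℕ → A} {Y : ℕ → A} {i k e : ℕ}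
    (h₁ : DepthGE A (A ⧸ complexIdeal X Y i k) e)
    (h₂ : DepthGE A (A ⧸ complexIdeal X Y i (k + 1)) e)
    (hy₁ : IsSMulRegular (A ⧸ complexIdeal X Y i k) (Y k))
    (hy₂ : IsSMulRegular (A ⧸ complexIdeal X Y i (k + 1)) (Y k))
    (hw : IsSMulRegular (A ⧸ complexIdeal X Y i (k + 1)) (rowSum X Y (k + 1) i)) :
    DepthGE A (A ⧸ complexIdeal X Y (i + 1) (k + 1)) (e - 1) := by
  obtain _ | e := e
  · exact fun i hi => absurd hi (Nat.not_lt_zero i)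
  have h𝔞 : DepthGE A (A ⧸ (complexIdeal X Y i k ⊔ Ideal.span {Y k})) e :=
    (h₁.quotSMulTop hy₁).congr (quotSMulTopQuotientEquiv _ _)
  have hle := complexIdeal_succ_le (X := X) (Y := Y) (i := i) (k := k)
  have h𝔠 : DepthGE A (quotientImage (complexIdeal X Y i (k + 1))
      (complexIdeal X Y i k ⊔ Ideal.span {Y k})) (e + 1) :=
    DepthGE.of_exact_left (exact_subtype_factor hle)
      (Submodule.subtype_injective _) (Ideal.Quotient.factor_surjective hle) h₂ h𝔞
  obtain ⟨ε⟩ := nonempty_equiv_of_mul_sup_eq mul_complexIdeal_sup_eq hy₂ hw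
  have hle' := complexIdeal_mono_row (X := X) (Y := Y) (k := k + 1) i.le_succ
  exact DepthGE.of_exact_right (exact_subtype_factor hle')
    (Submodule.subtype_injective _) (Ideal.Quotient.factor_surjective hle') (h₂.mono e.le_succ)
    (h𝔠.congr ε.symm)

theorem DepthGE.isSMulRegular_of_height [IsNoetherianRing A] {d i : ℕ} {J : Ideal A} {s : A}
    (hd : ringKrullDim A ≤ d) (hJ : DepthGE A (A ⧸ J) (d - i))
    (hs : ∀ P : Ideal A, P.IsPrime → J ≤ P → s ∈ P → (i + 1 : ℕ) ≤ P.height) :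
    IsSMulRegular (A ⧸ J) s := by
  by_contra hx
  have hx' : s ∈ ⋃ p ∈ associatedPrimes A (A ⧸ J), (p : Set A) := by
    rw [biUnion_associatedPrimes_eq_compl_regular]
    exact hx
  simp only [Set.mem_iUnion] at hx'
  obtain ⟨P, hP, hxP⟩ := hx'
  have hPp : P.IsPrime := hP.isPrime
  have h1 := hJ.le_ringKrullDim_quotient hP
  have h2 := hs P hPp (le_of_mem_associatedPrimes hP) hxP
  have h3 := (height_add_ringKrullDim_quotient_le P).trans hd
  have h4 : (((i + 1) + (d - i) : ℕ) : WithBot ℕ∞) ≤ d := by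
    refine le_trans ?_ h3
    rw [Nat.cast_add]
    refine add_le_add ?_ h1
    exact_mod_cast h2
  have h5 := Nat.cast_le.1 h4
  omega

theorem depthGE_complexIdeal [IsNoetherianRing A] {X : ℕ → ℕ → A} {Y : ℕ → A} {p n d : ℕ}
    (hA : DepthGE A A d) (hd : ringKrullDim A ≤ d)
    (hH : ∀ i k, i < p → k < n → ∀ P : Ideal A, P.IsPrime → complexIdeal X Y i (k + 1) ≤ P →
      ∀ s ∈ P, (s = Y k ∨ (k + 1 < n ∧ s = Y (k + 1)) ∨ s = rowSum X Y (k + 1) i) →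
        (i + 1 : ℕ) ≤ P.height)
    {i k : ℕ} (hi : i ≤ p) (hk : k ≤ n) :
    DepthGE A (A ⧸ complexIdeal X Y i k) (d - i) := by
  induction i generalizing k with
  | zero =>
    cases k with
    | zero =>
      rw [complexIdeal_zero_right]
      exact .of_subsingleton _
    | succ k =>
      rw [complexIdeal_zero_left]
      exact hA.congr (Submodule.quotEquivOfEqBot _ rfl).symm
  | succ i ih =>
    cases k with
    | zero =>
      rw [complexIdeal_zero_right]
      exact .of_subsingleton _
    | succ k =>
      rw [show d - (i + 1) = d - i - 1 by omega]
      refine depthGE_complexIdeal_step (ih (by omega) (by omega)) (ih (by omega) hk) ?_ ?_ ?_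
      · cases k with
        | zero =>
          rw [complexIdeal_zero_right]
          exact Function.injective_of_subsingleton _
        | succ k =>
          exact (ih (by omega) (by omega)).isSMulRegular_of_height hd fun P hP hJ hs =>
            hH i k hi (by omega) P hP hJ _ hs (.inr (.inl ⟨hk, rfl⟩))
      · exact (ih (by omega) hk).isSMulRegular_of_height hd fun P hP hJ hs =>
          hH i k hi hk P hP hJ _ hs (.inl rfl)
      · exact (ih (by omega) hk).isSMulRegular_of_height hd fun P hP hJ hs =>
          hH i k hi hk P hP hJ _ hs (.inr (.inr rfl))

end DepthInduction

end MondDoublePoint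

namespace MondDoublePoint

section Lift

variable {A B : Type*} [CommRing A] [CommRing B]

/-- Regular sequences lift along a surjection whose kernel is generated by a regular sequence. -/
theorem exists_isRegularModulo_comap {ρ : B →+* A} (hρ : Function.Surjective ρ) {l₁ : List B}
    (hl₁ : IsRegularModulo ⊥ l₁) (hker : Ideal.ofList l₁ = RingHom.ker ρ) {l : List A}
    (hl : IsRegularModulo ⊥ l) :
    ∃ l' : List B, IsRegularModulo ⊥ l' ∧ l'.length = l₁.length + l.length ∧
      Ideal.ofList l' = (Ideal.ofList l).comap ρ := by
  obtain ⟨l₂, rfl⟩ : ∃ l₂ : List B, l₂.map ρ = l := List.map_surjective_iff.2 hρ l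
  refine ⟨l₁ ++ l₂, isRegularModulo_append.2 ⟨hl₁, ?_⟩, by simp, ?_⟩
  · rw [bot_sup_eq, hker]
    exact (isRegularModulo_comap hρ).2 hl
  · rw [Ideal.ofList_append, hker, RingHom.ker_eq_comap_bot, comap_sup_ofList hρ, bot_sup_eq]

end Lift

section MvPolynomial

open MvPolynomial

variable {R : Type*} [CommRing R]

theorem exists_isRegularModulo_ker_eval {σ : Type*} [Finite σ] (a : σ → R) :
    ∃ l : List (MvPolynomial σ R), IsRegularModulo ⊥ l ∧ l.length = Nat.card σ ∧
      Ideal.ofList l = RingHom.ker (eval a) := by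
  revert a
  refine Finite.induction_empty_option (P := fun σ => ∀ a : σ → R,
    ∃ l : List (MvPolynomial σ R), IsRegularModulo ⊥ l ∧ l.length = Nat.card σ ∧
      Ideal.ofList l = RingHom.ker (eval a)) ?_ ?_ ?_ σ
  · intro α β e ih a
    obtain ⟨l, hl, hlen, hker⟩ := ih (a ∘ e)
    obtain ⟨l', hl', hlen', hker'⟩ := exists_isRegularModulo_comap
      (ρ := ((renameEquiv R e).symm : MvPolynomial β R →+* MvPolynomial α R))
      (renameEquiv R e).symm.surjective (l₁ := []) trivial
      (by simp)
      hl
    refine ⟨l', hl', by simp [hlen', hlen, Nat.card_congr e], ?_⟩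
    rw [hker', hker, RingHom.comap_ker]
    congr 1
    ext <;> simp
  · intro a
    refine ⟨[], trivial, by simp, ?_⟩
    rw [Ideal.ofList_nil, eq_comm, ← RingHom.injective_iff_ker_eq_bot]
    intro p q h
    rw [eq_C_of_isEmpty p, eq_C_of_isEmpty q] at h ⊢
    simpa using h
  · intro α _ ih a
    obtain ⟨l, hl, hlen, hker⟩ := ih (fun i => a (some i))
    have hX : IsRegularModulo (⊥ : Ideal (Polynomial (MvPolynomial α R)))
        [Polynomial.X - Polynomial.C (C (a none))] := by
      refine ⟨fun b hb => ?_, trivial⟩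
      simpa using
        (Polynomial.monic_X_sub_C (C (a none) : MvPolynomial α R)).mem_nonZeroDivisors.1 b hb
    obtain ⟨l₁, hl₁, hlen₁, hker₁⟩ := exists_isRegularModulo_comap
      (ρ := Polynomial.evalRingHom (C (a none) : MvPolynomial α R))
      (fun x => ⟨Polynomial.C x, by simp⟩) hX (by
        ext p
        rw [Ideal.ofList_singleton, Ideal.mem_span_singleton, Polynomial.dvd_iff_isRoot]
        rfl) hl
    obtain ⟨l', hl', hlen', hker'⟩ := exists_isRegularModulo_comap
      (ρ := (optionEquivLeft R α : MvPolynomial (Option α) R →+* Polynomial (MvPolynomial α R)))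
      (optionEquivLeft R α).surjective (l₁ := []) trivial
      (by simp)
      hl₁
    refine ⟨l', hl', by simp [hlen', hlen₁, hlen, add_comm], ?_⟩
    rw [hker', hker₁, hker, RingHom.comap_ker, RingHom.comap_ker]
    congr 1
    ext i
    · simp
    · cases i <;> simp

end MvPolynomial

end MondDoublePoint

namespace MondDoublePoint

open MvPolynomial

section NullVector

/-- A matrix over a field all of whose maximal minors vanish kills a nonzero vector. -/
theorem exists_ne_zero_of_det_eq_zero {K ι : Type*} [Field K] {k : ℕ} (v : ι → Fin k → K)
    (h : ∀ ρ : Fin k → ι, (Matrix.of fun a b => v (ρ a) b).det = 0) :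
    ∃ c : Fin k → K, c ≠ 0 ∧ ∀ r, ∑ j, v r j * c j = 0 := by
  by_cases hspan : Submodule.span K (Set.range v) = ⊤
  · exfalso
    obtain ⟨κ, a, -, ha, hli⟩ := exists_linearIndependent' K v
    let b := Module.Basis.mk hli (by rw [ha, hspan])
    let e := (b.indexEquiv (Pi.basisFun K (Fin k))).symm
    have h1 := h (fun i => a (e i))
    have h2 : LinearIndependent K (fun i => v (a (e i))) := hli.comp e e.injective
    have h3 := Matrix.linearIndependent_rows_iff_isUnit
      (A := Matrix.of fun i => v (a (e i))) |>.1 h2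
    rw [Matrix.isUnit_iff_isUnit_det] at h3
    exact h3.ne_zero h1
  · obtain ⟨f, hf, hle⟩ := Submodule.exists_le_ker_of_lt_top _ (lt_top_iff_ne_top.2 hspan)
    have hsum (w : Fin k → K) : ∑ j, w j * f (Pi.single j 1) = f w := by
      conv_rhs => rw [← Finset.univ_sum_single w]
      rw [map_sum]
      refine Finset.sum_congr rfl fun j _ => ?_
      rw [← smul_eq_mul, ← map_smul, ← Pi.single_smul, smul_eq_mul, mul_one]
    refine ⟨fun j => f (Pi.single j 1), fun hc => hf ?_, fun r => ?_⟩
    · ext j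
      exact congrFun hc j
    · rw [hsum]
      exact hle (Submodule.subset_span ⟨r, rfl⟩)

end NullVector

section Generic

variable (R : Type*) [CommRing R] (p n : ℕ)

/-- The index type of the variables of the generic `p × n` matrix and the generic vector of
length `n`. -/
abbrev GenericIndex : Type := (Fin p × Fin n) ⊕ Fin n

/-- The entries of the generic matrix, extended by zero. -/
noncomputable def genericX (r j : ℕ) : MvPolynomial (GenericIndex p n) R :=
  if h : r < p ∧ j < n then X (.inl (⟨r, h.1⟩, ⟨j, h.2⟩)) else 0

/-- The entries of the generic vector, extended by zero. -/
noncomputable def genericY (j : ℕ) : MvPolynomial (GenericIndex p n) R :=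
  if h : j < n then X (.inr ⟨j, h⟩) else 0

variable {R p n}

theorem genericX_of_lt {r j : ℕ} (hr : r < p) (hj : j < n) :
    genericX R p n r j = X (.inl (⟨r, hr⟩, ⟨j, hj⟩)) := dif_pos ⟨hr, hj⟩

theorem genericY_of_lt {j : ℕ} (hj : j < n) : genericY R p n j = X (.inr ⟨j, hj⟩) := dif_pos hj

theorem genericY_ne_zero [Nontrivial R] {j : ℕ} (hj : j < n) : genericY R p n j ≠ 0 := by
  rw [genericY_of_lt hj]
  exact X_ne_zero _

theorem rowSum_generic_ne_zero [Nontrivial R] {k r l : ℕ} (hk : k ≤ n) (hl : l < k) (hr : r < p) :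
    rowSum (genericX R p n) (genericY R p n) k r ≠ 0 := by
  intro h
  have h1 := congrArg
    (eval (Sum.elim (fun _ : Fin p × Fin n => (1 : R))
      fun j : Fin n => if (j : ℕ) = l then 1 else 0)) h
  rw [map_rowSum, map_zero, rowSum, Finset.sum_eq_single l] at h1
  · rw [genericX_of_lt hr (hl.trans_le hk), genericY_of_lt (hl.trans_le hk)] at h1
    simp at h1
  · intro j hj hjl
    rw [genericY_of_lt ((Finset.mem_range.1 hj).trans_le hk)]
    simp [hjl]
  · intro h
    exact absurd (Finset.mem_range.2 hl) h

variable (R p n) in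
/-- Substitute for the entries in column `l` of the first `m` rows of the generic matrix the values
that make the corresponding entries of the product with the generic vector vanish. -/
noncomputable def elimination (k l m : ℕ) :
    MvPolynomial (GenericIndex p n) R →+* Localization.Away (genericY R p n l) :=
  eval₂Hom ((algebraMap (MvPolynomial (GenericIndex p n) R) _).comp C) (Sum.elim
    (fun v : Fin p × Fin n => algebraMap (MvPolynomial (GenericIndex p n) R) _ (X (.inl v)) -
      if (v.1 : ℕ) < m ∧ (v.2 : ℕ) = l then
        algebraMap _ _ (rowSum (genericX R p n) (genericY R p n) k v.1) *
          IsLocalization.Away.invSelf (genericY R p n l) else 0)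
    (fun j : Fin n => algebraMap (MvPolynomial (GenericIndex p n) R) _ (X (.inr j))))

theorem elimination_genericY (k l m : ℕ) {j : ℕ} :
    elimination R p n k l m (genericY R p n j) = algebraMap _ _ (genericY R p n j) := by
  by_cases hj : j < n
  · rw [genericY_of_lt hj]
    simp [elimination]
  · have h0 : genericY R p n j = 0 := dif_neg hj
    rw [h0, map_zero, map_zero]

theorem elimination_genericX (k l m : ℕ) {r j : ℕ} (hr : r < p) (hj : j < n) :
    elimination R p n k l m (genericX R p n r j) = algebraMap _ _ (genericX R p n r j) -
      if r < m ∧ j = l then algebraMap _ _ (rowSum (genericX R p n) (genericY R p n) k r) *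
        IsLocalization.Away.invSelf (genericY R p n l) else 0 := by
  rw [genericX_of_lt hr hj]
  simp [elimination]

theorem elimination_rowSum {k l m r : ℕ} (hk : k ≤ n) (hl : l < k) (hr : r < p) :
    elimination R p n k l m (rowSum (genericX R p n) (genericY R p n) k r) =
      if r < m then 0 else algebraMap _ _ (rowSum (genericX R p n) (genericY R p n) k r) := by
  have h1 : elimination R p n k l m (rowSum (genericX R p n) (genericY R p n) k r) =
      algebraMap _ _ (rowSum (genericX R p n) (genericY R p n) k r) -
      ∑ j ∈ Finset.range k, (if r < m ∧ j = l then
        algebraMap _ _ (rowSum (genericX R p n) (genericY R p n) k r) *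
        IsLocalization.Away.invSelf (genericY R p n l) else 0) *
          algebraMap _ (Localization.Away (genericY R p n l)) (genericY R p n j) := by
    rw [map_rowSum, rowSum, map_rowSum, rowSum, ← Finset.sum_sub_distrib]
    refine Finset.sum_congr rfl fun j hj => ?_
    rw [elimination_genericX _ _ _ hr ((Finset.mem_range.1 hj).trans_le hk), elimination_genericY,
      sub_mul, map_rowSum]
    rfl
  rw [h1, Finset.sum_eq_single l]
  · split_ifs with h h2 h2
    · rw [mul_assoc, mul_comm (IsLocalization.Away.invSelf _), IsLocalization.Away.mul_invSelf]
      simp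
    · exact absurd h.1 h2
    · exact absurd ⟨h2, rfl⟩ h
    · simp
  · intro j _ hjl
    simp [hjl]
  · intro h
    exact absurd (Finset.mem_range.2 hl) h

theorem ker_elimination_le {T : Type*} [CommRing T] (ψ : MvPolynomial (GenericIndex p n) R →+* T)
    {k l m : ℕ} (hu : IsUnit (ψ (genericY R p n l)))
    (hψ : ∀ r < m, r < p → ψ (rowSum (genericX R p n) (genericY R p n) k r) = 0) :
    RingHom.ker (elimination R p n k l m) ≤ RingHom.ker ψ := by
  have h1 : (IsLocalization.Away.lift (genericY R p n l) hu).comp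
      (elimination R p n k l m) = ψ := by
    refine MvPolynomial.ringHom_ext (fun a => ?_) (fun v => ?_)
    · simp [elimination]
    · rcases v with ⟨r, j⟩ | j
      · by_cases h : (r : ℕ) < m ∧ (j : ℕ) = l
        · simp [elimination, h, hψ r h.1 r.2]
        · simp [elimination, h]
      · simp [elimination]
  intro s hs
  rw [RingHom.mem_ker, ← h1, RingHom.comp_apply, RingHom.mem_ker.1 hs, map_zero]

variable [IsDomain R]

theorem algebraMap_away_injective {l : ℕ} (hl : l < n) : Function.Injective
    (algebraMap (MvPolynomial (GenericIndex p n) R) (Localization.Away (genericY R p n l))) :=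
  IsLocalization.injective _ (powers_le_nonZeroDivisors_of_noZeroDivisors (genericY_ne_zero hl))

theorem ker_elimination_isPrime {k l m : ℕ} (hl : l < n) :
    (RingHom.ker (elimination R p n k l m)).IsPrime := by
  have : IsDomain (Localization.Away (genericY R p n l)) :=
    IsLocalization.isDomain_localization
      (powers_le_nonZeroDivisors_of_noZeroDivisors (genericY_ne_zero hl))
  exact RingHom.ker_isPrime _

theorem le_height_ker_elimination {k l m : ℕ} (hk : k ≤ n) (hl : l < k) (hm : m ≤ p) :
    (m : ℕ∞) ≤ (RingHom.ker (elimination R p n k l m)).height := by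
  induction m with
  | zero => simp
  | succ m ih =>
    have hln := hl.trans_le hk
    have := ker_elimination_isPrime (R := R) (p := p) (n := n) (k := k) (m := m) hln
    have := ker_elimination_isPrime (R := R) (p := p) (n := n) (k := k) (m := m + 1) hln
    have hlt : RingHom.ker (elimination R p n k l m) <
        RingHom.ker (elimination R p n k l (m + 1)) := by
      refine lt_of_le_of_ne (ker_elimination_le _ ?_ fun r hr hrp => ?_) fun h => ?_
      · rw [elimination_genericY]
        exact IsLocalization.Away.algebraMap_isUnit _
      · rw [elimination_rowSum hk hl hrp, if_pos (by omega)]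
      · have h1 : rowSum (genericX R p n) (genericY R p n) k m ∈
            RingHom.ker (elimination R p n k l m) := by
          rw [h, RingHom.mem_ker, elimination_rowSum hk hl hm, if_pos m.lt_succ_self]
        rw [RingHom.mem_ker, elimination_rowSum hk hl hm, if_neg (lt_irrefl m)] at h1
        exact rowSum_generic_ne_zero hk hl hm
          ((map_eq_zero_iff _ (algebraMap_away_injective hln)).1 h1)
    have h2 := Ideal.height_add_one_le_of_lt_of_isPrime hlt
    rw [Nat.cast_add, Nat.cast_one]
    exact (add_le_add_left (ih (by omega)) 1).trans h2

theorem le_height_of_genericY_notMem {k l i : ℕ} (hk : k ≤ n) (hl : l < k) (hi : i ≤ p)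
    {Q : Ideal (MvPolynomial (GenericIndex p n) R)} [Q.IsPrime] (hlQ : genericY R p n l ∉ Q)
    (hQ : ∀ r < i, rowSum (genericX R p n) (genericY R p n) k r ∈ Q) :
    (i : ℕ∞) ≤ Q.height ∧ ∀ s ∈ Q, ((∃ j < n, s = genericY R p n j) ∨
      (i < p ∧ s = rowSum (genericX R p n) (genericY R p n) k i)) →
      ((i + 1 : ℕ) : ℕ∞) ≤ Q.height := by
  have hln := hl.trans_le hk
  have hle : RingHom.ker (elimination R p n k l i) ≤ Q := by
    let K := FractionRing (MvPolynomial (GenericIndex p n) R ⧸ Q)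
    let ψ : MvPolynomial (GenericIndex p n) R →+* K := (algebraMap _ K).comp (Ideal.Quotient.mk Q)
    have hψ (s) : ψ s = 0 ↔ s ∈ Q := by
      rw [RingHom.comp_apply, map_eq_zero_iff _ (IsFractionRing.injective _ K),
        Ideal.Quotient.eq_zero_iff_mem]
    refine (ker_elimination_le ψ ?_ fun r hr _ => (hψ _).2 (hQ r hr)).trans fun s hs => (hψ s).1 hs
    rw [isUnit_iff_ne_zero, Ne, hψ]
    exact hlQ
  have := ker_elimination_isPrime (R := R) (p := p) (n := n) (k := k) (m := i) hln
  have h1 := le_height_ker_elimination (R := R) hk hl hi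
  refine ⟨h1.trans (Ideal.height_mono hle), fun s hs hcase => ?_⟩
  have hlt : RingHom.ker (elimination R p n k l i) < Q := by
    refine lt_of_le_of_ne hle fun h => ?_
    rw [← h, RingHom.mem_ker] at hs
    rcases hcase with ⟨j, hj, rfl⟩ | ⟨hip, rfl⟩
    · rw [elimination_genericY] at hs
      exact genericY_ne_zero hj ((map_eq_zero_iff _ (algebraMap_away_injective hln)).1 hs)
    · rw [elimination_rowSum hk hl hip, if_neg (lt_irrefl i)] at hs
      exact rowSum_generic_ne_zero hk hl hip
        ((map_eq_zero_iff _ (algebraMap_away_injective hln)).1 hs)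
  rw [Nat.cast_add, Nat.cast_one]
  exact (add_le_add_left h1 1).trans (Ideal.height_add_one_le_of_lt_of_isPrime hlt)

end Generic

end MondDoublePoint

namespace MondDoublePoint

open MvPolynomial

section Generic

variable {R : Type*} [CommRing R] [IsDomain R] {p n : ℕ}

/-- Primes containing the ideal of the generic complex and all the entries of the generic vector
are large, because a null vector of the matrix deforms the zero vector. -/
theorem le_height_of_genericY_mem {k i : ℕ} (hk : k ≤ n) (hi : i ≤ p)
    {P : Ideal (MvPolynomial (GenericIndex p n) R)} [P.IsPrime]
    (hJ : complexIdeal (genericX R p n) (genericY R p n) i k ≤ P)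
    (hP : ∀ j < k, genericY R p n j ∈ P) : ((i + 1 : ℕ) : ℕ∞) ≤ P.height := by
  let K := FractionRing (MvPolynomial (GenericIndex p n) R ⧸ P)
  let ψ : MvPolynomial (GenericIndex p n) R →+* K := (algebraMap _ K).comp (Ideal.Quotient.mk P)
  have hψ (s) : ψ s = 0 ↔ s ∈ P := by
    rw [RingHom.comp_apply, map_eq_zero_iff _ (IsFractionRing.injective _ K),
      Ideal.Quotient.eq_zero_iff_mem]
  obtain ⟨c, hc0, hc⟩ := exists_ne_zero_of_det_eq_zero
    (fun (r : Fin i) (j : Fin k) => ψ (genericX R p n r j)) (fun ρ => by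
      have h1 := hJ (det_mem_complexIdeal (X := genericX R p n) (Y := genericY R p n)
        (i := i) (ρ := fun a => ρ a) (fun a => (ρ a).2))
      rw [← hψ, RingHom.map_det] at h1
      exact h1)
  let c' : ℕ → K := fun j => if h : j < k then c ⟨j, h⟩ else 0
  let θ : MvPolynomial (GenericIndex p n) R →+* Polynomial K :=
    eval₂Hom (Polynomial.C.comp (ψ.comp C)) (Sum.elim
      (fun v : Fin p × Fin n => Polynomial.C (ψ (X (.inl v))))
      (fun j : Fin n => Polynomial.C (ψ (X (.inr j))) + Polynomial.X * Polynomial.C (c' j)))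
  have hθψ : (Polynomial.evalRingHom 0).comp θ = ψ := by
    refine MvPolynomial.ringHom_ext (fun a => ?_) (fun v => ?_)
    · simp [θ]
    · rcases v with v | j <;> simp [θ]
  have hθY {j : ℕ} (hj : j < k) :
      θ (genericY R p n j) = Polynomial.X * Polynomial.C (c ⟨j, hj⟩) := by
    have h1 := (hψ _).2 (hP j hj)
    rw [genericY_of_lt (hj.trans_le hk)] at h1 ⊢
    simp [θ, h1, c', hj]
  have hθX {r j : ℕ} (hr : r < p) (hj : j < n) :
      θ (genericX R p n r j) = Polynomial.C (ψ (genericX R p n r j)) := by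
    rw [genericX_of_lt hr hj]
    simp [θ]
  have hθ (r : ℕ) (hr : r < i) : rowSum (genericX R p n) (genericY R p n) k r ∈ RingHom.ker θ := by
    rw [RingHom.mem_ker, map_rowSum, rowSum, Finset.sum_range]
    have h1 := hc ⟨r, hr⟩
    calc _ = ∑ j : Fin k, Polynomial.X * Polynomial.C (ψ (genericX R p n r j) * c j) :=
          Finset.sum_congr rfl fun j _ => by
            rw [hθX (hr.trans_le hi) (j.2.trans_le hk), hθY j.2, map_mul]
            ring
      _ = 0 := by rw [← Finset.mul_sum, ← map_sum, h1, map_zero, mul_zero]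
  have hprime : (RingHom.ker θ).IsPrime := RingHom.ker_isPrime _
  have hle : RingHom.ker θ ≤ P := fun s hs => by
    rw [← hψ, ← hθψ, RingHom.comp_apply, RingHom.mem_ker.1 hs, map_zero]
  obtain ⟨l, hl⟩ := Function.ne_iff.1 hc0
  have hlQ : genericY R p n l ∉ RingHom.ker θ := by
    rw [RingHom.mem_ker, hθY l.2]
    exact mul_ne_zero Polynomial.X_ne_zero (Polynomial.C_ne_zero.2 hl)
  have h1 := (le_height_of_genericY_notMem hk l.2 hi hlQ hθ).1
  have hlt : RingHom.ker θ < P := lt_of_le_of_ne hle fun h => hlQ (h.symm ▸ hP l l.2)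
  rw [Nat.cast_add, Nat.cast_one]
  exact (add_le_add_left h1 1).trans (Ideal.height_add_one_le_of_lt_of_isPrime hlt)

theorem le_height_of_complexIdeal_generic_le {i k : ℕ} (hi : i < p) (hk : k < n)
    {P : Ideal (MvPolynomial (GenericIndex p n) R)} [P.IsPrime]
    (hJ : complexIdeal (genericX R p n) (genericY R p n) i (k + 1) ≤ P)
    {s : MvPolynomial (GenericIndex p n) R} (hs : s ∈ P)
    (hcase : s = genericY R p n k ∨ (k + 1 < n ∧ s = genericY R p n (k + 1)) ∨
      s = rowSum (genericX R p n) (genericY R p n) (k + 1) i) :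
    ((i + 1 : ℕ) : ℕ∞) ≤ P.height := by
  by_cases hY : ∀ j < k + 1, genericY R p n j ∈ P
  · exact le_height_of_genericY_mem hk hi.le hJ hY
  · push Not at hY
    obtain ⟨l, hl, hlP⟩ := hY
    refine (le_height_of_genericY_notMem hk hl hi.le hlP
      fun r hr => hJ (rowSum_mem_complexIdeal hr)).2 s hs ?_
    rcases hcase with h | h | h
    · exact .inl ⟨k, hk, h⟩
    · exact .inl ⟨_, h⟩
    · exact .inr ⟨hi, h⟩

end Generic

end MondDoublePoint

namespace MondDoublePoint

open IsLocalRing RingTheory.Sequence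

theorem exists_list_length_eq_ringKrullDim (B : Type*) [CommRing B] [IsLocalRing B]
    [IsNoetherianRing B] : ∃ l : List B, (∀ x ∈ l, x ∈ maximalIdeal B) ∧
      (l.length : WithBot ℕ∞) = ringKrullDim B ∧
      ∀ P : Ideal B, P.IsPrime → Ideal.ofList l ≤ P → P = maximalIdeal B := by
  obtain ⟨s, hs, hcard⟩ := (maximalIdeal B).exists_finset_card_eq_height_of_isNoetherianRing
  have hspan : Ideal.ofList s.toList = Ideal.span (s : Set B) := by
    simp [Ideal.ofList]
  refine ⟨s.toList, fun x hx => hs.1.2 (Ideal.subset_span (by simpa using hx)), ?_,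
    fun P hP hle => ?_⟩
  · rw [← maximalIdeal_height_eq_ringKrullDim, ← hcard, Finset.length_toList]
    rfl
  · rw [hspan] at hle
    exact le_antisymm (le_maximalIdeal hP.ne_top) (hs.2 ⟨hP, hle⟩ (le_maximalIdeal hP.ne_top))

theorem ringKrullDim_le_length_of_ofList_eq {A : Type} [CommRing A] [IsLocalRing A]
    [IsNoetherianRing A] {l : List A} (hl : Ideal.ofList l = maximalIdeal A) :
    ringKrullDim A ≤ l.length := by
  rw [← ringKrullDim_eq_of_ringEquiv (RingEquiv.quotientBot A)]
  refine ringKrullDim_quotient_le_length bot_ne_top (fun x hx => ?_) fun P hP hle => ?_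
  · rw [← hl]
    exact Ideal.subset_span hx
  · rw [bot_sup_eq, hl] at hle
    exact ((maximalIdeal.isMaximal _).eq_of_le hP.ne_top hle).symm

section Specialization

variable {A B : Type} [CommRing A] [IsLocalRing A] [IsNoetherianRing A] [CommRing B] [IsLocalRing B]
  {ε : A →+* B} {I : Ideal A} {l₁ : List A} {e : ℕ}

theorem exists_list_specialization (hε : Function.Surjective ε)
    (hker : RingHom.ker ε = I ⊔ Ideal.ofList l₁) :
    ∃ l₂ : List A, (∀ x ∈ l₁ ++ l₂, x ∈ maximalIdeal A) ∧
      (∀ x ∈ l₂.map ε, x ∈ maximalIdeal B) ∧ (l₂.length : WithBot ℕ∞) = ringKrullDim B ∧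
      ∀ P : Ideal A, P.IsPrime → I ⊔ Ideal.ofList (l₁ ++ l₂) ≤ P → P = maximalIdeal A := by
  have := isNoetherianRing_of_surjective A B ε hε
  have : IsLocalHom ε := hε.isLocalHom
  have hcomap : (maximalIdeal B).comap ε = maximalIdeal A := maximalIdeal_comap ε
  obtain ⟨l, hmem, hlen, hl⟩ := exists_list_length_eq_ringKrullDim B
  obtain ⟨l₂, rfl⟩ : ∃ l₂ : List A, l₂.map ε = l := List.map_surjective_iff.2 hε l
  refine ⟨l₂, ?_, hmem, by simpa using hlen, fun P hP hle => ?_⟩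
  · intro x hx
    rw [← hcomap, Ideal.mem_comap]
    rcases List.mem_append.1 hx with hx | hx
    · have h0 : x ∈ RingHom.ker ε := by
        rw [hker]
        exact Ideal.mem_sup_right (Ideal.subset_span hx)
      rw [RingHom.mem_ker.1 h0]
      exact zero_mem _
    · exact hmem _ (List.mem_map_of_mem hx)
  · rw [Ideal.ofList_append, ← sup_assoc, ← hker, RingHom.ker_eq_comap_bot, comap_sup_ofList hε,
      bot_sup_eq] at hle
    have hkerP : RingHom.ker ε ≤ P := (Ideal.comap_mono bot_le).trans hle
    have hP' : P = (P.map ε).comap ε := by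
      rw [Ideal.comap_map_of_surjective' ε hε, sup_eq_left.2 hkerP]
    have := hl (P.map ε) (Ideal.map_isPrime_of_surjective hε hkerP) (by
      rw [← Ideal.map_comap_of_surjective ε hε (Ideal.ofList _)]
      exact Ideal.map_mono hle)
    rw [hP', this, hcomap]

theorem DepthGE.le_length_add_ringKrullDim (h : DepthGE A (A ⧸ I) e) (hε : Function.Surjective ε)
    (hker : RingHom.ker ε = I ⊔ Ideal.ofList l₁) :
    (e : WithBot ℕ∞) ≤ l₁.length + ringKrullDim B := by
  have hI : I ≠ ⊤ := by
    rintro rfl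
    exact RingHom.ker_ne_top ε (by rw [hker, top_sup_eq])
  have : Nontrivial (A ⧸ I) := Ideal.Quotient.nontrivial_iff.2 hI
  obtain ⟨l₂, hmem, -, hlen, hl⟩ := exists_list_specialization hε hker
  obtain ⟨P, hP⟩ := associatedPrimes.nonempty A (A ⧸ I)
  refine (h.le_ringKrullDim_quotient hP).trans
    ((ringKrullDim_le_of_surjective _
      (Ideal.Quotient.factor_surjective (le_of_mem_associatedPrimes hP))).trans ?_)
  rw [← hlen]
  exact (ringKrullDim_quotient_le_length hI hmem hl).trans (by simp)

theorem DepthGE.isCohenMacaulayRing {s : ℕ} (h : DepthGE A (A ⧸ I) (l₁.length + s))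
    (hε : Function.Surjective ε) (hker : RingHom.ker ε = I ⊔ Ideal.ofList l₁)
    (hs : ringKrullDim B = s) : IsCohenMacaulayRing B := by
  have := isNoetherianRing_of_surjective A B ε hε
  obtain ⟨l₂, hmem, hmem', hlen, hl⟩ := exists_list_specialization hε hker
  obtain rfl : l₂.length = s := by
    rw [hs] at hlen
    exact_mod_cast hlen
  have h1 := (isRegularModulo_append.1
    (DepthGE.isRegularModulo (l := l₁ ++ l₂) (by rwa [List.length_append]) hmem hl)).2
  rw [← hker, RingHom.ker_eq_comap_bot, isRegularModulo_comap hε] at h1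
  have h2 := ((Submodule.quotEquivOfEqBot (⊥ : Ideal B) rfl).isWeaklyRegular_congr _).1
    h1.isWeaklyRegular
  have hle : Ideal.ofList (l₂.map ε) ≤ maximalIdeal B := Ideal.span_le.2 hmem'
  refine ⟨l₂.map ε, fun r hr => ?_, ⟨h2, ?_⟩, by simpa using hs⟩
  · rw [jacobson_eq_maximalIdeal _ bot_ne_top]
    exact hmem' r hr
  · rw [Ideal.smul_top_eq_map, Algebra.algebraMap_self, Ideal.map_id]
    exact fun h => (maximalIdeal.isMaximal B).ne_top (top_le_iff.1 (h.le.trans hle))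

end Specialization

section Main

open MvPolynomial

variable {R : Type} [CommRing R] [IsLocalRing R] {p n : ℕ}

/-- The ideal of the polynomial ring lying over the maximal ideal along an evaluation map. -/
noncomputable abbrev evalIdeal (a : GenericIndex p n → R) :
    Ideal (MvPolynomial (GenericIndex p n) R) :=
  (maximalIdeal R).comap (eval a)

theorem eval_surjective {σ S : Type*} [CommRing S] (a : σ → S) : Function.Surjective (eval a) :=
  fun x => ⟨C x, eval_C x⟩

/-- The local ring of the polynomial ring at a point. -/
abbrev LocalPoly (a : GenericIndex p n → R) : Type := Localization.AtPrime (evalIdeal a)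

theorem exists_isRegularModulo_localPoly (a : GenericIndex p n → R) {rs : List R}
    (hrs : IsRegularModulo ⊥ rs) (hm : Ideal.ofList rs = maximalIdeal R) :
    ∃ l : List (LocalPoly a), IsRegularModulo ⊥ l ∧ l.length = p * n + n + rs.length ∧
      Ideal.ofList l = maximalIdeal (LocalPoly a) := by
  obtain ⟨l₁, hl₁, hlen₁, hker₁⟩ := exists_isRegularModulo_ker_eval a
  obtain ⟨l, hl, hlen, hker⟩ := exists_isRegularModulo_comap (eval_surjective a) hl₁ hker₁ hrs
  have h1 := hl.map_localization (B := LocalPoly a) (evalIdeal a).primeCompl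
  rw [Ideal.map_bot] at h1
  refine ⟨_, h1, by simp [hlen, hlen₁], ?_⟩
  rw [← Ideal.map_ofList, hker, hm,
    ← IsLocalization.AtPrime.map_eq_maximalIdeal (evalIdeal a) (LocalPoly a)]

/-- The ideal of the generic complex in the local ring of the polynomial ring. -/
noncomputable abbrev localComplexIdeal (a : GenericIndex p n → R) : Ideal (LocalPoly a) :=
  (complexIdeal (genericX R p n) (genericY R p n) p n).map (algebraMap _ _)

theorem exists_specialization (a : GenericIndex p n → R)
    {J : Ideal R} (hJ : J = (complexIdeal (genericX R p n) (genericY R p n) p n).map (eval a)) :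
    ∃ (ε : LocalPoly a →+* R ⧸ J) (l₁ : List (LocalPoly a)), Function.Surjective ε ∧
      l₁.length = p * n + n ∧ RingHom.ker ε = localComplexIdeal a ⊔ Ideal.ofList l₁ := by
  obtain ⟨l₁, -, hlen₁, hker₁⟩ := exists_isRegularModulo_ker_eval a
  have hu (t : (evalIdeal a).primeCompl) :
      IsUnit ((eval a) (t : MvPolynomial (GenericIndex p n) R)) := by
    have := t.2
    rwa [Ideal.mem_primeCompl_iff, Ideal.mem_comap, mem_maximalIdeal, mem_nonunits_iff,
      not_not] at this
  let lift : LocalPoly a →+* R := IsLocalization.lift hu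
  have hlift (s) : lift (algebraMap _ _ s) = eval a s := IsLocalization.lift_eq hu s
  refine ⟨(Ideal.Quotient.mk J).comp lift, l₁.map (algebraMap _ _),
    Ideal.Quotient.mk_surjective.comp fun x => ⟨algebraMap _ _ (C x), (hlift _).trans (eval_C x)⟩,
    by simp [hlen₁], ?_⟩
  have hcomap : (J.comap lift).under (MvPolynomial (GenericIndex p n) R) = J.comap (eval a) := by
    ext s
    rw [Ideal.mem_comap, Ideal.mem_comap, hlift, Ideal.mem_comap]
  rw [← Ideal.map_ofList, hker₁, ← Ideal.map_sup,
    ← Ideal.comap_map_of_surjective' _ (eval_surjective a), ← hJ, ← hcomap,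
    IsLocalization.map_under (evalIdeal a).primeCompl, ← RingHom.comap_ker, Ideal.mk_ker]

variable [IsDomain R] [IsNoetherianRing R]

theorem depthGE_localComplexIdeal (a : GenericIndex p n → R) {rs : List R}
    (hrs : IsRegularModulo ⊥ rs) (hm : Ideal.ofList rs = maximalIdeal R) :
    DepthGE (LocalPoly a) (LocalPoly a ⧸ localComplexIdeal a) (p * n + n + rs.length - p) := by
  obtain ⟨l, hl, hlen, hlm⟩ := exists_isRegularModulo_localPoly a hrs hm
  have hmem : ∀ x ∈ l, x ∈ maximalIdeal (LocalPoly a) := fun x hx => by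
    rw [← hlm]
    exact Ideal.subset_span hx
  rw [← hlen, localComplexIdeal, map_complexIdeal]
  refine depthGE_complexIdeal ?_ ?_ ?_ le_rfl le_rfl
  · exact (hl.depthGE hmem).congr (Submodule.quotEquivOfEqBot _ rfl)
  · exact ringKrullDim_le_length_of_ofList_eq hlm
  · intro i k hi hk P hP hJ s hs hcase
    rw [← map_complexIdeal, Ideal.map_le_iff_le_comap] at hJ
    rw [← map_rowSum] at hcase
    rw [← IsLocalization.height_under (evalIdeal a).primeCompl P]
    have hP' : (P.under (MvPolynomial (GenericIndex p n) R)).IsPrime := hP.under _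
    obtain ⟨t, rfl, ht⟩ : ∃ t : MvPolynomial (GenericIndex p n) R, algebraMap _ _ t = s ∧
        (t = genericY R p n k ∨ (k + 1 < n ∧ t = genericY R p n (k + 1)) ∨
          t = rowSum (genericX R p n) (genericY R p n) (k + 1) i) := by
      rcases hcase with h | ⟨hkn, h⟩ | h
      · exact ⟨_, h.symm, .inl rfl⟩
      · exact ⟨_, h.symm, .inr (.inl ⟨hkn, rfl⟩)⟩
      · exact ⟨_, h.symm, .inr (.inr rfl)⟩
    exact_mod_cast le_height_of_complexIdeal_generic_le hi hk hJ hs ht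

theorem le_ringKrullDim_quotient_complexIdeal (a : GenericIndex p n → R) {rs : List R}
    (hrs : IsRegularModulo ⊥ rs) (hm : Ideal.ofList rs = maximalIdeal R) {J : Ideal R}
    (hJ : J = (complexIdeal (genericX R p n) (genericY R p n) p n).map (eval a)) (hJ' : J ≠ ⊤) :
    ((rs.length - p : ℕ) : WithBot ℕ∞) ≤ ringKrullDim (R ⧸ J) := by
  have : Nontrivial (R ⧸ J) := Ideal.Quotient.nontrivial_iff.2 hJ'
  have : IsLocalRing (R ⧸ J) := .of_surjective' _ Ideal.Quotient.mk_surjective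
  obtain ⟨ε, l₁, hε, hlen, hker⟩ := exists_specialization a hJ
  have h := (depthGE_localComplexIdeal a hrs hm).le_length_add_ringKrullDim hε hker
  obtain ⟨l, -, hl, -⟩ := exists_list_length_eq_ringKrullDim (R ⧸ J)
  rw [← hl, hlen] at h
  rw [← hl]
  norm_cast at h ⊢
  omega

theorem isCohenMacaulayRing_quotient_complexIdeal (a : GenericIndex p n → R) {rs : List R}
    (hrs : IsRegularModulo ⊥ rs) (hm : Ideal.ofList rs = maximalIdeal R) {J : Ideal R}
    (hJ : J = (complexIdeal (genericX R p n) (genericY R p n) p n).map (eval a))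
    (hdim : ringKrullDim (R ⧸ J) = (rs.length - p : ℕ)) : IsCohenMacaulayRing (R ⧸ J) := by
  have : Nontrivial (R ⧸ J) := by
    by_contra h
    rw [not_nontrivial_iff_subsingleton] at h
    rw [ringKrullDim_eq_bot_of_subsingleton] at hdim
    exact WithBot.bot_ne_coe hdim
  have : IsLocalRing (R ⧸ J) := .of_surjective' _ Ideal.Quotient.mk_surjective
  by_cases hp : p ≤ rs.length
  · obtain ⟨ε, l₁, hε, hlen, hker⟩ := exists_specialization a hJ
    have h := depthGE_localComplexIdeal a hrs hm
    rw [show p * n + n + rs.length - p = l₁.length + (rs.length - p) by omega] at h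
    exact h.isCohenMacaulayRing hε hker hdim
  · rw [Nat.sub_eq_zero_of_le (by omega)] at hdim
    exact ⟨[], by simp, .nil _ _, by simpa using hdim⟩

end Main

end MondDoublePoint

namespace MondDoublePoint

open Metric

section DiscAlgebra

variable (r : ℝ) (E F : Type*) [NormedAddCommGroup E] [NormedSpace ℂ E]
  [NormedAddCommGroup F] [NormedSpace ℂ F]

/-- The space of continuous functions on a closed disc of radius `r` which are holomorphic in the
interior. -/
def discAlgebra : Submodule ℂ C(closedBall (0 : ℂ) r, E) where
  carrier := {φ | ∃ g : ℂ → E, DifferentiableOn ℂ g (ball 0 r) ∧ ∀ z, φ z = g z}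
  add_mem' := by
    rintro φ ψ ⟨g, hg, hφ⟩ ⟨h, hh, hψ⟩
    exact ⟨g + h, hg.add hh, fun z => by simp [hφ, hψ]⟩
  zero_mem' := ⟨0, differentiableOn_const 0, fun _ => rfl⟩
  smul_mem' := by
    rintro c φ ⟨g, hg, hφ⟩
    exact ⟨c • g, hg.const_smul c, fun z => by simp [hφ]⟩

variable {r E F}

theorem isClosed_discAlgebra [CompleteSpace E] :
    IsClosed (discAlgebra r E : Set C(closedBall (0 : ℂ) r, E)) := by
  classical
  refine isSeqClosed_iff_isClosed.1 fun u φ hu hlim => ?_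
  choose g hg hug using hu
  refine ⟨fun z => if h : z ∈ closedBall (0 : ℂ) r then φ ⟨z, h⟩ else 0, ?_, fun z => by simp⟩
  have h1 := ContinuousMap.tendsto_iff_tendstoUniformly.1 hlim
  refine TendstoLocallyUniformlyOn.differentiableOn (F := g) (φ := Filter.atTop)
    (TendstoUniformlyOn.tendstoLocallyUniformlyOn ?_) (.of_forall hg) isOpen_ball
  rw [tendstoUniformlyOn_iff]
  intro ε hε
  filter_upwards [tendstoUniformly_iff.1 h1 ε hε] with m hm z hz
  have hz' := ball_subset_closedBall hz
  simpa [hz', hug, ← dist_zero_right] using hm ⟨z, hz'⟩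

instance [CompleteSpace E] : CompleteSpace (discAlgebra r E) :=
  isClosed_discAlgebra.completeSpace_coe

namespace discAlgebra

noncomputable instance : FunLike (discAlgebra r E) (closedBall (0 : ℂ) r) E where
  coe φ := φ.1
  coe_injective _ _ h := Subtype.ext (DFunLike.coe_injective h)

theorem exists_differentiableOn (φ : discAlgebra r E) :
    ∃ g : ℂ → E, DifferentiableOn ℂ g (ball 0 r) ∧ ∀ z, φ z = g z := φ.2

theorem norm_apply_le (φ : discAlgebra r E) (z) : ‖φ z‖ ≤ ‖φ‖ := φ.1.norm_coe_le_norm z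

theorem norm_le {φ : discAlgebra r E} {c : ℝ} (hc : 0 ≤ c) (h : ∀ z, ‖φ z‖ ≤ c) : ‖φ‖ ≤ c :=
  (ContinuousMap.norm_le _ hc).2 h

@[simp] theorem add_apply (φ ψ : discAlgebra r E) (z) : (φ + ψ) z = φ z + ψ z := rfl

@[simp] theorem smul_apply (c : ℂ) (φ : discAlgebra r E) (z) : (c • φ) z = c • φ z := rfl

@[simp] theorem zero_apply (z) : (0 : discAlgebra r E) z = 0 := rfl

/-- Evaluation at a point of the closed disc. -/
noncomputable def evalAt (z : closedBall (0 : ℂ) r) : discAlgebra r E →L[ℂ] E :=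
  (ContinuousMap.evalCLM ℂ z).comp (discAlgebra r E).subtypeL

@[simp] theorem evalAt_apply (z) (φ : discAlgebra r E) : evalAt z φ = φ z := rfl

theorem sum_apply {ι : Type*} (s : Finset ι) (φ : ι → discAlgebra r E) (z) :
    (∑ i ∈ s, φ i) z = ∑ i ∈ s, φ i z := map_sum (evalAt z) φ s

/-- Apply a multilinear map pointwise. -/
noncomputable def multilinearLift {m : ℕ} (q : E [×m]→L[ℂ] F) :
    (discAlgebra r E) [×m]→L[ℂ] (discAlgebra r F) :=
  MultilinearMap.mkContinuous
    { toFun φ := ⟨⟨fun z => q fun i => φ i z,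
          q.cont.comp (continuous_pi fun i => (φ i).1.continuous)⟩, by
        choose g hg hφ using fun i => exists_differentiableOn (φ i)
        refine ⟨fun z => q fun i => g i z, fun z hz => ?_, fun z => ?_⟩
        · exact (q.hasFDerivAt _).differentiableAt.comp_differentiableWithinAt z
            (differentiableWithinAt_pi.2 fun i => hg i z hz)
        · simp [← hφ]⟩
      map_update_add' φ i x y := by
        refine DFunLike.ext _ _ fun z => ?_
        have h (w : discAlgebra r E) : (fun j => Function.update φ i w j z) =
            Function.update (fun j => φ j z) i (w z) :=
          funext fun j => Function.apply_update (fun _ (f : discAlgebra r E) => f z) φ i w j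
        change q _ = q _ + q _
        rw [h, h, h]
        exact q.map_update_add _ i _ _
      map_update_smul' φ i c x := by
        refine DFunLike.ext _ _ fun z => ?_
        have h (w : discAlgebra r E) : (fun j => Function.update φ i w j z) =
            Function.update (fun j => φ j z) i (w z) :=
          funext fun j => Function.apply_update (fun _ (f : discAlgebra r E) => f z) φ i w j
        change q _ = c • q _
        rw [h, h]
        exact q.map_update_smul _ i _ _ } ‖q‖ fun φ => by
    refine norm_le (by positivity) fun z => (q.le_opNorm _).trans ?_
    gcongr with i
    exact norm_apply_le _ _

theorem multilinearLift_apply {m : ℕ} (q : E [×m]→L[ℂ] F) (φ : Fin m → discAlgebra r E) (z) :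
    multilinearLift q φ z = q fun i => φ i z := rfl

theorem norm_multilinearLift_le {m : ℕ} (q : E [×m]→L[ℂ] F) :
    ‖multilinearLift (r := r) q‖ ≤ ‖q‖ := MultilinearMap.mkContinuous_norm_le _ (norm_nonneg _) _

/-- Apply a formal multilinear series pointwise. -/
noncomputable def seriesLift (q : FormalMultilinearSeries ℂ E F) :
    FormalMultilinearSeries ℂ (discAlgebra r E) (discAlgebra r F) := fun m => multilinearLift (q m)

theorem radius_le_radius_seriesLift (q : FormalMultilinearSeries ℂ E F) :
    q.radius ≤ (seriesLift (r := r) q).radius :=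
  FormalMultilinearSeries.radius_le_of_le fun m => norm_multilinearLift_le (q m)

theorem seriesLift_sum_apply [CompleteSpace F] {q : FormalMultilinearSeries ℂ E F}
    {φ : discAlgebra r E} (hφ : (‖φ‖₊ : ENNReal) < q.radius) (z) :
    (seriesLift q).sum φ z = q.sum (φ z) := by
  have h1 := (seriesLift (r := r) q).hasSum (x := φ)
    (by simpa [enorm_eq_nnnorm] using hφ.trans_le (radius_le_radius_seriesLift q))
  have h2 := q.hasSum (x := φ z) (by
    have : ‖φ z‖₊ ≤ ‖φ‖₊ := norm_apply_le φ z
    simpa [enorm_eq_nnnorm] using lt_of_le_of_lt (ENNReal.coe_le_coe.2 this) hφ)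
  exact (h1.mapL (evalAt z)).unique h2

variable (r) in
/-- The constant functions. -/
noncomputable def const : E →L[ℂ] discAlgebra r E :=
  LinearMap.mkContinuous
    { toFun e := ⟨ContinuousMap.const _ e, fun _ => e, differentiableOn_const e, fun _ => rfl⟩
      map_add' _ _ := rfl
      map_smul' _ _ := rfl } 1 fun e => norm_le (by positivity) fun z => by
      rw [one_mul]
      exact le_rfl

@[simp] theorem const_apply (e : E) (z) : const r e z = e := rfl

/-- The function `z ↦ z • e`. -/
noncomputable def coord (r : ℝ) (e : E) : discAlgebra r E :=
  ⟨⟨fun z => (z : ℂ) • e, by fun_prop⟩, fun z => z • e, by fun_prop, fun _ => rfl⟩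

@[simp] theorem coord_apply (e : E) (z) : coord r e z = (z : ℂ) • e := rfl

/-- A function which is analytic at the origin of a product `W × ℂ` is an analytic family of
elements of the disc algebra of each small disc. -/
theorem exists_analyticAt {W : Type*} [NormedAddCommGroup W] [NormedSpace ℂ W] {h : W × ℂ → ℂ}
    (hh : AnalyticAt ℂ h 0) : ∃ R > 0, ∀ r, 0 < r → r < R → ∃ H : W → discAlgebra r ℂ,
      AnalyticAt ℂ H 0 ∧ ∀ᶠ w in nhds 0, ∀ z, H w z = h (w, z) := by
  obtain ⟨q, ρ, hq⟩ := hh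
  obtain ⟨R, hR0, hR⟩ := ENNReal.lt_iff_exists_nnreal_btwn.1 hq.r_pos
  have hR' : (R : ENNReal) < q.radius := hR.trans_le hq.r_le
  refine ⟨R, by exact_mod_cast hR0, fun r hr hrR => ?_⟩
  let φ : W → discAlgebra r (W × ℂ) := fun w =>
    (const r).comp (ContinuousLinearMap.inl ℂ W ℂ) w + coord r (0, 1)
  have hφz (w z) : φ w z = (w, (z : ℂ)) := by simp [φ]
  have hφ : AnalyticAt ℂ φ 0 := (ContinuousLinearMap.analyticAt _ _).add analyticAt_const
  have hφ0 : ‖φ 0‖ < R := by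
    refine lt_of_le_of_lt (norm_le hr.le fun z => ?_) hrR
    rw [hφz]
    simpa using mem_closedBall_zero_iff.1 z.2
  have hφ0' : (‖φ 0‖₊ : ENNReal) < R := by exact_mod_cast hφ0
  have hrad : (R : ENNReal) < (seriesLift (r := r) q).radius :=
    hR'.trans_le (radius_le_radius_seriesLift q)
  refine ⟨fun w => (seriesLift q).sum (φ w), ?_, ?_⟩
  · refine AnalyticAt.fun_comp ?_ hφ
    refine ((seriesLift q).hasFPowerSeriesOnBall (hR0.trans hrad)).analyticAt_of_mem ?_
    simpa [enorm_eq_nnnorm] using hφ0'.trans hrad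
  · have : ∀ᶠ w in nhds 0, ‖φ w‖ < R := hφ.continuousAt.norm.eventually_lt_const hφ0
    filter_upwards [this] with w hw z
    have hw' : (‖φ w‖₊ : ENNReal) < R := by exact_mod_cast hw
    have hzw : (‖φ w z‖₊ : ENNReal) ≤ ‖φ w‖₊ := by exact_mod_cast norm_apply_le (φ w) z
    rw [seriesLift_sum_apply (hw'.trans hR'), hφz]
    have := hq.sum (y := φ w z) (by simpa [enorm_eq_nnnorm] using (hzw.trans_lt hw').trans hR)
    rw [zero_add, hφz] at this
    exact this.symm

end discAlgebra

end DiscAlgebra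

end MondDoublePoint

namespace MondDoublePoint

open Metric

theorem analyticAt_clm_apply {U E F : Type*} [NormedAddCommGroup U] [NormedSpace ℂ U]
    [NormedAddCommGroup E] [NormedSpace ℂ E] [NormedAddCommGroup F] [NormedSpace ℂ F]
    {L : U → E →L[ℂ] F} {x : U → E} {u : U} (hL : AnalyticAt ℂ L u) (hx : AnalyticAt ℂ x u) :
    AnalyticAt ℂ (fun v => L v (x v)) u :=
  ((ContinuousLinearMap.id ℂ (E →L[ℂ] F)).analyticAt_bilinear (L u, x u)).comp₂ hL hx

theorem analyticAt_clm_comp_const {U E F G : Type*} [NormedAddCommGroup U] [NormedSpace ℂ U]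
    [NormedAddCommGroup E] [NormedSpace ℂ E] [NormedAddCommGroup F] [NormedSpace ℂ F]
    [NormedAddCommGroup G] [NormedSpace ℂ G]
    {L : U → F →L[ℂ] G} {u : U} (hL : AnalyticAt ℂ L u) (A : E →L[ℂ] F) :
    AnalyticAt ℂ (fun v => (L v).comp A) u :=
  (((ContinuousLinearMap.compL ℂ E F G).flip A).analyticAt (L u)).fun_comp hL

theorem exists_analyticAt_solution {U B : Type*} [NormedAddCommGroup U] [NormedSpace ℂ U]
    [NormedAddCommGroup B] [NormedSpace ℂ B] [CompleteSpace B] {S : U → B →L[ℂ] B} {u : U}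
    (hS : AnalyticAt ℂ S u) (h1 : S u = 1) {G : U → B} (hG : AnalyticAt ℂ G u) :
    ∃ Q : U → B, AnalyticAt ℂ Q u ∧ ∀ᶠ v in nhds u, S v (Q v) = G v := by
  have hinv : AnalyticAt ℂ (Ring.inverse : (B →L[ℂ] B) → _) (S u) := by
    rw [h1]
    exact analyticAt_inverse 1
  have hunit : ∀ᶠ v in nhds u, IsUnit (S v) :=
    hS.continuousAt.eventually_mem (Units.isOpen.mem_nhds (by simp [h1]))
  refine ⟨fun v => Ring.inverse (S v) (G v), analyticAt_clm_apply (hinv.fun_comp hS) hG, ?_⟩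
  filter_upwards [hunit] with v hv
  change (S v * Ring.inverse (S v)) (G v) = _
  rw [Ring.mul_inverse_cancel _ hv]
  rfl

theorem analyticAt_one_sub_smul {U B : Type*} [NormedAddCommGroup U] [NormedSpace ℂ U]
    [NormedAddCommGroup B] [NormedSpace ℂ B] {c : U → ℂ} {u : U} (hc : AnalyticAt ℂ c u)
    (D : B →L[ℂ] B) : AnalyticAt ℂ (fun v => 1 - c v • D) u :=
  analyticAt_const.sub (hc.smul analyticAt_const)

theorem one_sub_smul_clm_apply {B : Type*} [NormedAddCommGroup B] [NormedSpace ℂ B]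
    (D : B →L[ℂ] B) (c : ℂ) (x : B) : (1 - c • D) x = x + (-c) • D x := by
  simp [sub_eq_add_neg]

theorem analyticAt_clm_comp_const_add {U B E F : Type*} [NormedAddCommGroup U] [NormedSpace ℂ U]
    [NormedAddCommGroup B] [NormedSpace ℂ B] [NormedAddCommGroup E] [NormedSpace ℂ E]
    [NormedAddCommGroup F] [NormedSpace ℂ F] (M : F →L[ℂ] F →L[ℂ] B) {c : U → F} {u : U}
    (hc : AnalyticAt ℂ c u) (A : E →L[ℂ] F) (C : E →L[ℂ] B) :
    AnalyticAt ℂ (fun v => (M (c v)).comp A + C) u :=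
  (analyticAt_clm_comp_const ((M.analyticAt _).fun_comp hc) A).add analyticAt_const

namespace discAlgebra

variable {r : ℝ}

@[ext] theorem ext {E : Type*} [NormedAddCommGroup E] [NormedSpace ℂ E]
    {φ ψ : discAlgebra r E} (h : ∀ z, φ z = ψ z) : φ = ψ := DFunLike.ext _ _ h

/-- The element of the disc algebra defined by a function which is continuous on the closed disc
and holomorphic in its interior. -/
noncomputable def ofContinuousOn (g : ℂ → ℂ) (hc : ContinuousOn g (closedBall 0 r))
    (hd : DifferentiableOn ℂ g (ball 0 r)) : discAlgebra r ℂ :=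
  ⟨⟨fun z => g z, hc.domRestrict⟩, g, hd, fun _ => rfl⟩

@[simp] theorem ofContinuousOn_apply (g : ℂ → ℂ) (hc : ContinuousOn g (closedBall 0 r))
    (hd : DifferentiableOn ℂ g (ball 0 r)) (z) : ofContinuousOn g hc hd z = g z := rfl

theorem exists_eq_ofContinuousOn (φ : discAlgebra r ℂ) :
    ∃ g hc hd, φ = ofContinuousOn g hc hd := by
  classical
  obtain ⟨g, hg, hφ⟩ := exists_differentiableOn φ
  let g' : ℂ → ℂ := fun z => if h : z ∈ closedBall (0 : ℂ) r then φ ⟨z, h⟩ else 0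
  have hg' (z : closedBall (0 : ℂ) r) : g' z = φ z := dif_pos z.2
  refine ⟨g', ?_, hg.congr fun z hz => ?_, ?_⟩
  · rw [continuousOn_iff_continuous_domRestrict]
    exact φ.1.continuous.congr fun z => (hg' z).symm
  · exact (hg' ⟨z, ball_subset_closedBall hz⟩).trans (hφ _)
  · ext z
    exact (hg' z).symm

/-- Multiplication in the disc algebra. -/
noncomputable def mulL (r : ℝ) : discAlgebra r ℂ →L[ℂ] discAlgebra r ℂ →L[ℂ] discAlgebra r ℂ :=
  LinearMap.mkContinuous₂ (LinearMap.mk₂ ℂ (fun φ ψ => ⟨φ.1 * ψ.1, by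
      obtain ⟨g, hg, hφ⟩ := exists_differentiableOn φ
      obtain ⟨h, hh, hψ⟩ := exists_differentiableOn ψ
      refine ⟨g * h, hg.mul hh, fun z => ?_⟩
      change φ z * ψ z = _
      rw [hφ, hψ]
      rfl⟩)
    (fun _ _ _ => Subtype.ext (add_mul _ _ _)) (fun _ _ _ => Subtype.ext (smul_mul_assoc _ _ _))
    (fun _ _ _ => Subtype.ext (mul_add _ _ _)) (fun _ _ _ => Subtype.ext (mul_smul_comm _ _ _)))
    1 fun φ ψ => by
      rw [one_mul]
      refine norm_le (by positivity) fun z => ?_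
      change ‖φ z * ψ z‖ ≤ _
      rw [norm_mul]
      exact mul_le_mul (norm_apply_le _ _) (norm_apply_le _ _) (norm_nonneg _) (norm_nonneg _)

@[simp] theorem mulL_apply (φ ψ : discAlgebra r ℂ) (z) : mulL r φ ψ z = φ z * ψ z := rfl

/-- The function `z ↦ z ^ k`. -/
noncomputable def zpow (r : ℝ) (k : ℕ) : discAlgebra r ℂ :=
  ofContinuousOn (fun z => z ^ k) (by fun_prop) (by fun_prop)

@[simp] theorem zpow_apply (k : ℕ) (z) : zpow r k z = (z : ℂ) ^ k := rfl

/-- The map `(q, a) ↦ b q + ∑ aⱼ zʲ`. -/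
noncomputable def divMap (k : ℕ) (b : discAlgebra r ℂ) :
    discAlgebra r ℂ × (Fin k → ℂ) →L[ℂ] discAlgebra r ℂ :=
  (mulL r b).comp (.fst ℂ _ _) +
    (∑ j : Fin k, (ContinuousLinearMap.proj (R := ℂ) (φ := fun _ : Fin k => ℂ) j).smulRight
      (zpow r j)).comp (.snd ℂ _ _)

@[simp] theorem divMap_apply {k : ℕ} (b : discAlgebra r ℂ) (x) (z) :
    divMap k b x z = b z * x.1 z + ∑ j, x.2 j * (z : ℂ) ^ (j : ℕ) := by
  simp [divMap, sum_apply]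

theorem analyticAt_divMap {W : Type*} [NormedAddCommGroup W] [NormedSpace ℂ W]
    {F : W → discAlgebra r ℂ} {w : W} (hF : AnalyticAt ℂ F w) (k : ℕ) :
    AnalyticAt ℂ (fun v => divMap k (F v)) w :=
  analyticAt_clm_comp_const_add (mulL r) hF _ _

theorem exists_eq_mul_add (hr : 0 < r) (φ : discAlgebra r ℂ) :
    ∃ (ψ : discAlgebra r ℂ) (c : ℂ), ∀ z, φ z = z * ψ z + c := by
  obtain ⟨g, hc, hd, rfl⟩ := exists_eq_ofContinuousOn φ
  refine ⟨ofContinuousOn (dslope g 0) ?_ ?_, g 0, fun z => ?_⟩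
  · exact (continuousOn_dslope (closedBall_mem_nhds _ hr)).2
      ⟨hc, hd.differentiableAt (ball_mem_nhds _ hr)⟩
  · exact (Complex.differentiableOn_dslope (ball_mem_nhds _ hr)).2 hd
  · have := sub_smul_dslope g 0 z
    simp only [sub_zero, smul_eq_mul] at this
    simp [this]

theorem eq_zero_of_mul_add_eq_zero (hr : 0 < r) {φ : discAlgebra r ℂ} {c : ℂ}
    (h : ∀ z, z * φ z + c = 0) : φ = 0 ∧ c = 0 := by
  have hc : c = 0 := by simpa using h ⟨0, mem_closedBall_self hr.le⟩
  subst hc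
  have h' (z : closedBall (0 : ℂ) r) (hz : (z : ℂ) ≠ 0) : φ z = 0 := by
    simpa [hz] using h z
  refine ⟨?_, rfl⟩
  ext z
  by_cases hz : (z : ℂ) = 0
  · obtain ⟨g, hg, hφ⟩ := exists_differentiableOn φ
    have hcont : ContinuousAt g 0 := (hg.differentiableAt (ball_mem_nhds _ hr)).continuousAt
    have hev : ∀ᶠ y in nhdsWithin (0 : ℂ) {0}ᶜ, g y = 0 := by
      filter_upwards [self_mem_nhdsWithin,
        mem_nhdsWithin_of_mem_nhds (closedBall_mem_nhds (0 : ℂ) hr)] with y hy hy'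
      rw [← hφ ⟨y, hy'⟩]
      exact h' _ hy
    have := tendsto_nhds_unique (hcont.mono_left nhdsWithin_le_nhds)
      (tendsto_const_nhds.congr' (hev.mono fun _ h => h.symm))
    rw [hφ, hz, this, zero_apply]
  · exact h' z hz

theorem divMap_zpow_surjective (hr : 0 < r) (k : ℕ) :
    Function.Surjective (divMap k (zpow r k)) := by
  intro φ
  induction k with
  | zero => exact ⟨(φ, 0), by ext z; simp⟩
  | succ k ih =>
    obtain ⟨⟨q, a⟩, h⟩ := ih
    obtain ⟨q', c, h'⟩ := exists_eq_mul_add hr q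
    refine ⟨(q', Fin.snoc a c), ?_⟩
    rw [← h]
    ext z
    simp only [divMap_apply, zpow_apply, Fin.sum_univ_castSucc, Fin.snoc_castSucc, Fin.snoc_last,
      Fin.val_castSucc, Fin.val_last, h']
    ring

theorem divMap_zpow_injective (hr : 0 < r) (k : ℕ) :
    Function.Injective (divMap k (zpow r k)) := by
  rw [injective_iff_map_eq_zero]
  rintro ⟨q, a⟩ h
  replace h : ∀ z : closedBall (0 : ℂ) r, (z : ℂ) ^ k * q z + ∑ j, a j * (z : ℂ) ^ (j : ℕ) = 0 :=
      fun z => by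
      simpa using DFunLike.congr_fun h z
  induction k generalizing q with
  | zero => exact Prod.ext (ext fun z => by simpa using h z) (Subsingleton.elim _ _)
  | succ k ih =>
    have key := ih (mulL r (zpow r 1) q + a (Fin.last k) • zpow r 0) (fun j => a j.castSucc)
      fun z => ?_
    · rw [Prod.mk_eq_zero] at key
      obtain ⟨hq, ha⟩ := eq_zero_of_mul_add_eq_zero hr (φ := q) (c := a (Fin.last k))
        fun z => by simpa using DFunLike.congr_fun key.1 z
      refine Prod.ext hq (funext fun j => ?_)
      exact Fin.lastCases ha (fun i => congrFun key.2 i) j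
    · have := h z
      rw [Fin.sum_univ_castSucc] at this
      refine Eq.trans ?_ this
      simp only [add_apply, mulL_apply, smul_apply, smul_eq_mul, zpow_apply]
      simp only [Fin.val_castSucc, Fin.val_last]
      ring

/-- Division by `z ^ k` as a continuous linear equivalence. -/
noncomputable def divEquiv (hr : 0 < r) (k : ℕ) :
    (discAlgebra r ℂ × (Fin k → ℂ)) ≃L[ℂ] discAlgebra r ℂ :=
  .ofBijective (divMap k (zpow r k)) (LinearMap.ker_eq_bot.2 (divMap_zpow_injective hr k))
    (LinearMap.range_eq_top.2 (divMap_zpow_surjective hr k))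

@[simp] theorem coe_divEquiv (hr : 0 < r) (k : ℕ) (x) :
    divEquiv hr k x = divMap k (zpow r k) x := rfl

/-- Evaluation of an element of the disc algebra depends analytically on the element and on the
point. -/
theorem exists_analyticAt_eval (hr : 0 < r) {W : Type*} [NormedAddCommGroup W] [NormedSpace ℂ W]
    {Q : W → discAlgebra r ℂ} (hQ : AnalyticAt ℂ Q 0) :
    ∃ q : W × ℂ → ℂ, AnalyticAt ℂ q 0 ∧
      ∀ᶠ x : W × ℂ in nhds 0, ∀ h : x.2 ∈ closedBall (0 : ℂ) r, q x = Q x.1 ⟨x.2, h⟩ := by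
  let D : discAlgebra r ℂ →L[ℂ] discAlgebra r ℂ :=
    (ContinuousLinearMap.fst ℂ _ (Fin 1 → ℂ)).comp (divEquiv hr 1).symm.toContinuousLinearMap
  have hD (φ : discAlgebra r ℂ) : ∃ c, ∀ z, φ z = z * D φ z + c := by
    refine ⟨((divEquiv hr 1).symm φ).2 0, fun z => ?_⟩
    have := DFunLike.congr_fun ((divEquiv hr 1).apply_symm_apply φ) z
    rw [coe_divEquiv, divMap_apply] at this
    rw [← this]
    simp [D]
  obtain ⟨φ, hφ, hS⟩ := exists_analyticAt_solution (analyticAt_one_sub_smul analyticAt_snd D)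
    (by simp) (G := fun x : W × ℂ => Q x.1) (u := (0 : W × ℂ))
    (AnalyticAt.fun_comp (f := fun x : W × ℂ => x.1) hQ analyticAt_fst)
  refine ⟨fun x => evalAt ⟨0, mem_closedBall_self hr.le⟩ (φ x),
    (ContinuousLinearMap.analyticAt _ _).fun_comp hφ, ?_⟩
  filter_upwards [hS] with x hx h
  obtain ⟨c, hc⟩ := hD (φ x)
  have h2 : (1 - x.2 • D) (φ x) = φ x + (-x.2) • D (φ x) := one_sub_smul_clm_apply D _ _
  rw [← hx, h2, add_apply, smul_apply, evalAt_apply, hc, hc ⟨x.2, h⟩, smul_eq_mul]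
  simp

end discAlgebra

open discAlgebra

/-- The **Weierstrass division theorem**, for a divisor which restricts to `z ^ k`. -/
theorem weierstrass_division_pow {W : Type*} [NormedAddCommGroup W] [NormedSpace ℂ W]
    {f h : W × ℂ → ℂ} (hf : AnalyticAt ℂ f 0) (hh : AnalyticAt ℂ h 0) {k : ℕ}
    (hk : ∀ᶠ z in nhds (0 : ℂ), f (0, z) = z ^ k) :
    ∃ (q : W × ℂ → ℂ) (a : Fin k → W → ℂ), AnalyticAt ℂ q 0 ∧ (∀ j, AnalyticAt ℂ (a j) 0) ∧
      ∀ᶠ x in nhds 0, h x = q x * f x + ∑ j, a j x.1 * x.2 ^ (j : ℕ) := by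
  obtain ⟨R₁, hR₁, H₁⟩ := exists_analyticAt hf
  obtain ⟨R₂, hR₂, H₂⟩ := exists_analyticAt hh
  obtain ⟨R₃, hR₃, H₃⟩ := Metric.eventually_nhds_iff_ball.1 hk
  obtain ⟨r, hr, hlt⟩ := exists_between (lt_min hR₁ (lt_min hR₂ hR₃))
  simp only [lt_min_iff] at hlt
  obtain ⟨F, hF, hFf⟩ := H₁ r hr hlt.1
  obtain ⟨G, hG, hGh⟩ := H₂ r hr hlt.2.1
  have hF0 : F 0 = zpow r k := by
    ext z
    rw [hFf.self_of_nhds, zpow_apply]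
    exact H₃ _ (closedBall_subset_ball hlt.2.2 z.2)
  let e := divEquiv hr k
  obtain ⟨P, hP, hS⟩ := exists_analyticAt_solution
    (analyticAt_clm_comp_const (analyticAt_divMap hF k) e.symm.toContinuousLinearMap)
    (by
      refine ContinuousLinearMap.ext fun φ => ?_
      rw [hF0]
      exact e.apply_symm_apply φ) hG
  let Q : W → discAlgebra r ℂ × (Fin k → ℂ) := fun w => e.symm.toContinuousLinearMap (P w)
  have hQ : AnalyticAt ℂ Q 0 := (e.symm.toContinuousLinearMap.analyticAt _).fun_comp hP
  obtain ⟨q, hq, hqQ⟩ := exists_analyticAt_eval hr (Q := fun w => (Q w).1)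
    (((ContinuousLinearMap.fst ℂ (discAlgebra r ℂ) (Fin k → ℂ)).analyticAt _).fun_comp hQ)
  refine ⟨q, fun j w => (Q w).2 j, hq, fun j => ?_, ?_⟩
  · exact (ContinuousLinearMap.analyticAt
      ((ContinuousLinearMap.proj (R := ℂ) (φ := fun _ : Fin k => ℂ) j).comp
        (.snd ℂ (discAlgebra r ℂ) _)) _).fun_comp hQ
  · have hfst := continuous_fst.tendsto (0 : W × ℂ)
    have hsnd : ∀ᶠ x : W × ℂ in nhds 0, x.2 ∈ closedBall (0 : ℂ) r :=
      (continuous_snd.tendsto (0 : W × ℂ)).eventually (closedBall_mem_nhds _ hr)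
    filter_upwards [hqQ, hsnd, hfst.eventually hS, hfst.eventually hFf, hfst.eventually hGh]
      with x h1 h2 h3 h4 h5
    have h6 : divMap k (F x.1) (Q x.1) = G x.1 := h3
    have h7 := DFunLike.congr_fun h6 ⟨x.2, h2⟩
    rw [divMap_apply, h4, h5] at h7
    rw [h1 h2, ← h7, mul_comm]

end MondDoublePoint

namespace MondDoublePoint

open Metric

section Germs

variable {V W : Type*} [NormedAddCommGroup V] [NormedSpace ℂ V]
  [NormedAddCommGroup W] [NormedSpace ℂ W]

/-- The germ at the origin of an analytic function. -/
def germ (f : V → ℂ) (hf : AnalyticAt ℂ f 0) : analyticGerms V 0 := ⟨f, f, hf, rfl⟩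

theorem exists_eq_germ (γ : analyticGerms V 0) : ∃ f hf, γ = germ f hf := by
  obtain ⟨_, f, hf, rfl⟩ := γ
  exact ⟨f, hf, rfl⟩

theorem germ_eq_germ {f g : V → ℂ} {hf : AnalyticAt ℂ f 0} {hg : AnalyticAt ℂ g 0} :
    germ f hf = germ g hg ↔ ∀ᶠ x in nhds 0, f x = g x :=
  Subtype.ext_iff.trans Filter.Germ.coe_eq

theorem germ_eq_zero {f : V → ℂ} {hf : AnalyticAt ℂ f 0} :
    germ f hf = 0 ↔ ∀ᶠ x in nhds 0, f x = 0 :=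
  germ_eq_germ (hg := analyticAt_const)

theorem germ_eq_one {f : V → ℂ} {hf : AnalyticAt ℂ f 0} :
    germ f hf = 1 ↔ ∀ᶠ x in nhds 0, f x = 1 :=
  germ_eq_germ (hg := analyticAt_const)

theorem germ_mul_germ {f g : V → ℂ} (hf : AnalyticAt ℂ f 0) (hg : AnalyticAt ℂ g 0) :
    germ f hf * germ g hg = germ (fun x => f x * g x) (hf.mul hg) := rfl

theorem germ_add_germ {f g : V → ℂ} (hf : AnalyticAt ℂ f 0) (hg : AnalyticAt ℂ g 0) :
    germ f hf + germ g hg = germ (fun x => f x + g x) (hf.add hg) := rfl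

theorem germ_sum {ι : Type*} (s : Finset ι) {f : ι → V → ℂ} (hf : ∀ i, AnalyticAt ℂ (f i) 0) :
    ∑ i ∈ s, germ (f i) (hf i) =
      germ (fun x => ∑ i ∈ s, f i x) (s.analyticAt_fun_sum fun i _ => hf i) := by
  classical
  induction s using Finset.induction_on with
  | empty => simp only [Finset.sum_empty]; rfl
  | insert a s ha ih =>
    rw [Finset.sum_insert ha, ih, germ_add_germ]
    simp only [Finset.sum_insert ha]

/-- The value of a germ at the origin. -/
noncomputable def value (V : Type*) [NormedAddCommGroup V] [NormedSpace ℂ V] :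
    analyticGerms V 0 →+* ℂ :=
  Filter.Germ.valueRingHom.comp (analyticGerms V 0).subtype

@[simp] theorem value_germ (f : V → ℂ) (hf : AnalyticAt ℂ f 0) : value V (germ f hf) = f 0 := rfl

/-- Composition of germs with a continuous linear map. -/
noncomputable def pullback (L : W →L[ℂ] V) : analyticGerms V 0 →+* analyticGerms W 0 where
  toFun γ := ⟨γ.1.compTendsto L (L.continuous.tendsto' _ _ L.map_zero), by
    obtain ⟨_, f, hf, rfl⟩ := γ
    refine ⟨f ∘ L, ?_, rfl⟩
    exact AnalyticAt.comp (by rwa [L.map_zero]) (L.analyticAt 0)⟩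
  map_one' := rfl
  map_zero' := rfl
  map_mul' γ δ := by
    obtain ⟨f, hf, rfl⟩ := exists_eq_germ γ
    obtain ⟨g, hg, rfl⟩ := exists_eq_germ δ
    rfl
  map_add' γ δ := by
    obtain ⟨f, hf, rfl⟩ := exists_eq_germ γ
    obtain ⟨g, hg, rfl⟩ := exists_eq_germ δ
    rfl

theorem analyticAt_comp_clm {f : V → ℂ} (hf : AnalyticAt ℂ f 0) (L : W →L[ℂ] V) :
    AnalyticAt ℂ (fun x => f (L x)) 0 :=
  AnalyticAt.fun_comp (by rwa [L.map_zero]) (L.analyticAt 0)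

theorem pullback_germ (L : W →L[ℂ] V) (f : V → ℂ) (hf : AnalyticAt ℂ f 0) :
    pullback L (germ f hf) = germ (fun x => f (L x)) (analyticAt_comp_clm hf L) := rfl

theorem pullback_pullback {U : Type*} [NormedAddCommGroup U] [NormedSpace ℂ U]
    (L : W →L[ℂ] V) (M : U →L[ℂ] W) (γ : analyticGerms V 0) :
    pullback M (pullback L γ) = pullback (L.comp M) γ := by
  obtain ⟨f, hf, rfl⟩ := exists_eq_germ γ
  rfl

theorem pullback_id (γ : analyticGerms V 0) : pullback (.id ℂ V) γ = γ := by
  obtain ⟨f, hf, rfl⟩ := exists_eq_germ γ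
  rfl

theorem value_comp_pullback (L : W →L[ℂ] V) : (value W).comp (pullback L) = value V := by
  ext γ
  obtain ⟨f, hf, rfl⟩ := exists_eq_germ γ
  rw [RingHom.comp_apply, pullback_germ, value_germ, value_germ, L.map_zero]

theorem pullback_surjective_of_comp_eq_id {L : W →L[ℂ] V} {M : V →L[ℂ] W}
    (h : M.comp L = .id ℂ W) : Function.Surjective (pullback L) := fun γ =>
  ⟨pullback M γ, by rw [pullback_pullback, h, pullback_id]⟩

theorem isUnit_iff_value_ne_zero {γ : analyticGerms V 0} : IsUnit γ ↔ value V γ ≠ 0 := by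
  refine ⟨fun h => (h.map (value V)).ne_zero, fun h => ?_⟩
  obtain ⟨f, hf, rfl⟩ := exists_eq_germ γ
  refine IsUnit.of_mul_eq_one (germ f⁻¹ (hf.inv h)) ?_
  rw [germ_mul_germ, germ_eq_one]
  filter_upwards [hf.continuousAt.eventually_ne h] with x hx
  exact mul_inv_cancel₀ hx

instance : IsLocalHom (value V) := ⟨fun _ h => isUnit_iff_value_ne_zero.2 h.ne_zero⟩

instance : IsLocalRing (analyticGerms V 0) := (value V).domain_isLocalRing

theorem maximalIdeal_eq_ker_value :
    IsLocalRing.maximalIdeal (analyticGerms V 0) = RingHom.ker (value V) := by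
  ext γ
  rw [IsLocalRing.mem_maximalIdeal, mem_nonunits_iff, isUnit_iff_value_ne_zero, not_not,
    RingHom.mem_ker]

instance : IsDomain (analyticGerms V 0) := by
  have : NoZeroDivisors (analyticGerms V 0) := by
    refine ⟨fun {γ δ} h => ?_⟩
    obtain ⟨f, hf, rfl⟩ := exists_eq_germ γ
    obtain ⟨g, hg, rfl⟩ := exists_eq_germ δ
    rw [germ_mul_germ, germ_eq_zero] at h
    rw [germ_eq_zero, germ_eq_zero]
    obtain ⟨r, hr, H⟩ := Metric.eventually_nhds_iff_ball.1
      (hf.eventually_analyticAt.and (hg.eventually_analyticAt.and h))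
    by_cases hx : ∃ x ∈ ball (0 : V) r, f x ≠ 0
    · obtain ⟨x, hx, hfx⟩ := hx
      right
      have hgx : g =ᶠ[nhds x] 0 := by
        filter_upwards [isOpen_ball.mem_nhds hx, (H x hx).1.continuousAt.eventually_ne hfx]
          with y hy hy'
        exact (mul_eq_zero.1 (H y hy).2.2).resolve_left hy'
      have := AnalyticOnNhd.eqOn_zero_of_preconnected_of_eventuallyEq_zero
        (fun y hy => (H y hy).2.1) (convex_ball (0 : V) r).isPreconnected hx hgx
      filter_upwards [ball_mem_nhds (0 : V) hr] with y hy using this hy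
    · left
      push Not at hx
      filter_upwards [ball_mem_nhds (0 : V) hr] with y hy using hx y hy
  exact NoZeroDivisors.to_isDomain _

/-- The germ of the second coordinate function. -/
noncomputable def sndGerm (W : Type*) [NormedAddCommGroup W] [NormedSpace ℂ W] :
    analyticGerms (W × ℂ) 0 := germ Prod.snd analyticAt_snd

theorem sndGerm_ne_zero : sndGerm W ≠ 0 := fun h => by
  have h := (((ContinuousLinearMap.inr ℂ W ℂ).continuous.tendsto' 0 0
    (map_zero _)).eventually (germ_eq_zero.1 h)).filter_mono (nhdsWithin_le_nhds (s := {0}ᶜ))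
  obtain ⟨z, h0, hz⟩ := (h.and self_mem_nhdsWithin).exists
  exact hz h0

theorem ker_pullback_inl :
    RingHom.ker (pullback (.inl ℂ W ℂ)) = Ideal.span {sndGerm W} := by
  refine le_antisymm (fun γ hγ => ?_) ?_
  · obtain ⟨h, hh, rfl⟩ := exists_eq_germ γ
    rw [RingHom.mem_ker, pullback_germ, germ_eq_zero] at hγ
    obtain ⟨q, a, hq, ha, H⟩ := weierstrass_division_pow (k := 1)
      (analyticAt_snd : AnalyticAt ℂ (Prod.snd : W × ℂ → ℂ) 0) hh
      (.of_forall fun z => (pow_one z).symm)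
    rw [Ideal.mem_span_singleton']
    refine ⟨germ q hq, ?_⟩
    rw [sndGerm, germ_mul_germ, germ_eq_germ]
    have h0 : ∀ᶠ w in nhds (0 : W), a 0 w = 0 := by
      filter_upwards [hγ, ((ContinuousLinearMap.inl ℂ W ℂ).continuous.tendsto' 0 0
        (map_zero _)).eventually H] with w h1 h2
      simpa using h2.symm.trans h1
    filter_upwards [H, (continuous_fst.tendsto (0 : W × ℂ)).eventually h0] with x h1 h2
    simp [h1, h2]
  · rw [Ideal.span_singleton_le_iff_mem, RingHom.mem_ker, sndGerm, pullback_germ, germ_eq_zero]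
    exact .of_forall fun _ => rfl

end Germs

end MondDoublePoint

namespace MondDoublePoint

open Metric

section

variable {V W : Type} [NormedAddCommGroup V] [NormedSpace ℂ V]
  [NormedAddCommGroup W] [NormedSpace ℂ W]

theorem finiteDimensional_induction
    {P : (V : Type) → [NormedAddCommGroup V] → [NormedSpace ℂ V] → Prop}
    (equiv : ∀ (V W : Type) [NormedAddCommGroup V] [NormedSpace ℂ V] [NormedAddCommGroup W]
      [NormedSpace ℂ W], (V ≃L[ℂ] W) → P V → P W)
    (zero : P (Fin 0 → ℂ))
    (prod : ∀ (W : Type) [NormedAddCommGroup W] [NormedSpace ℂ W] [FiniteDimensional ℂ W],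
      P W → P (W × ℂ)) (V : Type) [NormedAddCommGroup V] [NormedSpace ℂ V]
    [FiniteDimensional ℂ V] : P V := by
  have key (n : ℕ) : P (Fin n → ℂ) := by
    induction n with
    | zero => exact zero
    | succ n ih => exact equiv _ _ (.ofFinrankEq (by simp)) (prod _ ih)
  exact equiv _ _ (.ofFinrankEq (by simp)) (key (Module.finrank ℂ V))

theorem pullback_equiv_surjective (e : V ≃L[ℂ] W) :
    Function.Surjective (pullback (e : V →L[ℂ] W)) :=
  pullback_surjective_of_comp_eq_id e.coe_symm_comp_coe

theorem ker_pullback_equiv (e : V ≃L[ℂ] W) : RingHom.ker (pullback (e : V →L[ℂ] W)) = ⊥ := by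
  rw [← RingHom.injective_iff_ker_eq_bot]
  refine Function.LeftInverse.injective (g := pullback (e.symm : W →L[ℂ] V)) fun γ => ?_
  rw [pullback_pullback, e.coe_comp_coe_symm, pullback_id]

/-- The maximal ideal of the ring of germs on a finite-dimensional space is generated by a
regular sequence. -/
theorem exists_isRegularModulo_maximalIdeal (V : Type) [NormedAddCommGroup V] [NormedSpace ℂ V]
    [FiniteDimensional ℂ V] : ∃ rs : List (analyticGerms V 0), IsRegularModulo ⊥ rs ∧
      rs.length = Module.finrank ℂ V ∧
      Ideal.ofList rs = IsLocalRing.maximalIdeal (analyticGerms V 0) := by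
  simp only [maximalIdeal_eq_ker_value]
  refine finiteDimensional_induction
    (P := fun V _ _ => ∃ rs : List (analyticGerms V 0), IsRegularModulo ⊥ rs ∧
      rs.length = Module.finrank ℂ V ∧ Ideal.ofList rs = RingHom.ker (value V)) ?_ ?_ ?_ V
  · rintro V W _ _ _ _ e ⟨rs, h1, h2, h3⟩
    obtain ⟨l, hl, hlen, h⟩ := exists_isRegularModulo_comap (pullback_equiv_surjective e)
      (l₁ := []) trivial (by rw [ker_pullback_equiv, Ideal.ofList_nil]) h1
    refine ⟨l, hl, ?_, ?_⟩
    · rw [hlen, List.length_nil, zero_add, h2, e.toLinearEquiv.finrank_eq]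
    · rw [h, h3, RingHom.comap_ker, value_comp_pullback]
  · refine ⟨[], trivial, by simp, ?_⟩
    rw [Ideal.ofList_nil, eq_comm, RingHom.ker_eq_bot_iff_eq_zero]
    intro γ hγ
    obtain ⟨f, hf, rfl⟩ := exists_eq_germ γ
    rw [germ_eq_zero]
    exact .of_forall fun x => (congrArg f (Subsingleton.elim x 0)).trans hγ
  · rintro W _ _ _ ⟨rs, h1, h2, h3⟩
    have hz : IsRegularModulo ⊥ [sndGerm W] :=
      ⟨fun a ha => (mul_eq_zero.1 ha).resolve_left sndGerm_ne_zero, trivial⟩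
    obtain ⟨l, hl, hlen, h⟩ := exists_isRegularModulo_comap
      (pullback_surjective_of_comp_eq_id (ContinuousLinearMap.fst_comp_inl (R := ℂ))) hz
      (by rw [ker_pullback_inl, Ideal.ofList_singleton]) h1
    refine ⟨l, hl, ?_, ?_⟩
    · rw [hlen, h2, Module.finrank_prod, Module.finrank_self, List.length_singleton, add_comm]
    · rw [h, h3, RingHom.comap_ker, value_comp_pullback]

theorem isNoetherianRing_of_quotient_span_singleton {R : Type*} [CommRing R]
    (h : ∀ x : R, x ≠ 0 → IsNoetherianRing (R ⧸ Ideal.span {x})) : IsNoetherianRing R := by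
  refine (isNoetherianRing_iff_ideal_fg R).2 fun I => ?_
  by_cases hI : I = ⊥
  · rw [hI]
    exact Submodule.fg_bot
  · obtain ⟨x, hx, hx0⟩ := Submodule.exists_mem_ne_zero_of_ne_bot hI
    have := h x hx0
    refine Ideal.fg_of_fg_map_of_fg_inf_ker_of_surjective (f := Ideal.Quotient.mk (.span {x}))
      (IsNoetherian.noetherian _) ?_ Ideal.Quotient.mk_surjective
    rw [Ideal.mk_ker, inf_eq_right.2 ((Ideal.span_singleton_le_iff_mem I).2 hx)]
    exact ⟨{x}, by simp⟩

theorem isNoetherianRing_quotient_germ_of_eventuallyEq_pow [IsNoetherianRing (analyticGerms W 0)]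
    {f : W × ℂ → ℂ} (hf : AnalyticAt ℂ f 0) {k : ℕ}
    (hk : ∀ᶠ z in nhds (0 : ℂ), f (0, z) = z ^ k) :
    IsNoetherianRing (analyticGerms (W × ℂ) 0 ⧸ Ideal.span {germ f hf}) := by
  let φ : analyticGerms W 0 →+* analyticGerms (W × ℂ) 0 ⧸ Ideal.span {germ f hf} :=
    (Ideal.Quotient.mk _).comp (pullback (.fst ℂ W ℂ))
  let _ := φ.toAlgebra
  have : Module.Finite (analyticGerms W 0)
      (analyticGerms (W × ℂ) 0 ⧸ Ideal.span {germ f hf}) := by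
    refine Module.Finite.of_surjective (Fintype.linearCombination (analyticGerms W 0)
      fun j : Fin k => Ideal.Quotient.mk (Ideal.span {germ f hf}) (sndGerm W ^ (j : ℕ))) ?_
    intro y
    obtain ⟨γ, rfl⟩ := Ideal.Quotient.mk_surjective y
    obtain ⟨h, hh, rfl⟩ := exists_eq_germ γ
    obtain ⟨q, a, hq, ha, H⟩ := weierstrass_division_pow hf hh hk
    refine ⟨fun j => germ (a j) (ha j), ?_⟩
    rw [Fintype.linearCombination_apply]
    have hc (j : Fin k) : AnalyticAt ℂ (fun x : W × ℂ => a j x.1 * x.2 ^ (j : ℕ)) 0 :=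
      (analyticAt_comp_clm (ha j) (.fst ℂ W ℂ)).mul (analyticAt_snd.pow _)
    have hsm (j : Fin k) : germ (a j) (ha j) •
        Ideal.Quotient.mk (Ideal.span {germ f hf}) (sndGerm W ^ (j : ℕ)) =
        Ideal.Quotient.mk (Ideal.span {germ f hf}) (germ _ (hc j)) := rfl
    simp only [hsm]
    rw [← map_sum, eq_comm, Ideal.Quotient.eq, Ideal.mem_span_singleton']
    refine ⟨germ q hq, ?_⟩
    rw [eq_sub_iff_add_eq, germ_sum _ hc, germ_mul_germ, germ_add_germ, germ_eq_germ]
    filter_upwards [H] with x hx using hx.symm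
  exact IsNoetherianRing.of_finite (analyticGerms W 0) _

/-- After a linear change of coordinates and multiplication with a unit, a nonzero analytic germ
vanishing at the origin restricts to a power of the last coordinate. -/
theorem exists_eventuallyEq_pow {f : W × ℂ → ℂ} (hf : AnalyticAt ℂ f 0) (h0 : f 0 = 0)
    (hne : ¬ ∀ᶠ x in nhds 0, f x = 0) :
    ∃ (A : (W × ℂ) ≃L[ℂ] (W × ℂ)) (u : W × ℂ → ℂ) (k : ℕ), AnalyticAt ℂ u 0 ∧
      ∀ᶠ z in nhds (0 : ℂ), f (A (0, z)) * u (0, z) = z ^ k := by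
  obtain ⟨r, hr, H⟩ := Metric.eventually_nhds_iff_ball.1 hf.eventually_analyticAt
  obtain ⟨x, hx, hfx⟩ : ∃ x ∈ ball 0 r, f x ≠ 0 := by
    by_contra! h
    exact hne (by filter_upwards [ball_mem_nhds 0 hr] with x hx using h x hx)
  have hx0 : x ≠ 0 := by
    rintro rfl
    exact hfx h0
  have hxn := norm_pos_iff.2 hx0
  obtain ⟨A, hA⟩ := SeparatingDual.exists_continuousLinearEquiv_apply_eq (R := ℂ)
    (x := ((0, 1) : W × ℂ)) (by simp) hx0
  have hA' (z : ℂ) : A (0, z) = z • x := by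
    rw [← hA, ← map_smul]
    simp
  have hφ : AnalyticOnNhd ℂ (fun z : ℂ => f (z • x)) (ball 0 (r / ‖x‖)) := by
    intro z hz
    refine AnalyticAt.fun_comp (g := f) (H _ ?_) (analyticAt_id.smul analyticAt_const)
    rw [mem_ball_zero_iff] at hz
    rw [mem_ball_zero_iff, norm_smul]
    exact (lt_div_iff₀ hxn).1 hz
  have hφ0 : ¬ ∀ᶠ z in nhds (0 : ℂ), f (z • x) = 0 := by
    intro h
    have := hφ.eqOn_zero_of_preconnected_of_eventuallyEq_zero
      (convex_ball _ _).isPreconnected (mem_ball_self (by positivity)) h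
    have h1 : (1 : ℂ) ∈ ball (0 : ℂ) (r / ‖x‖) := by
      rw [mem_ball_zero_iff, norm_one, lt_div_iff₀ hxn, one_mul]
      exact mem_ball_zero_iff.1 hx
    exact hfx (by simpa using this h1)
  obtain ⟨k, g, hg, hg0, hk⟩ := (AnalyticAt.exists_eventuallyEq_pow_smul_nonzero_iff
    (hφ 0 (mem_ball_self (by positivity)))).2 hφ0
  refine ⟨A, fun y => (g y.2)⁻¹, k, ?_, ?_⟩
  · exact AnalyticAt.fun_comp (g := fun z => (g z)⁻¹) (f := fun y : W × ℂ => y.2)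
      (hg.inv hg0) analyticAt_snd
  · filter_upwards [hk, hg.continuousAt.eventually_ne hg0] with z h1 h2
    rw [hA', h1, sub_zero, smul_eq_mul]
    field_simp

instance isNoetherianRing_analyticGerms [FiniteDimensional ℂ V] :
    IsNoetherianRing (analyticGerms V 0) := by
  refine finiteDimensional_induction (P := fun V _ _ => IsNoetherianRing (analyticGerms V 0))
    ?_ ?_ ?_ V
  · intro V W _ _ _ _ e h
    exact isNoetherianRing_of_surjective _ _ _ (pullback_equiv_surjective e.symm)
  · have hv : Function.Bijective (value (Fin 0 → ℂ)) := by
      refine ⟨(injective_iff_map_eq_zero _).2 fun γ hγ => ?_, fun c =>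
        ⟨germ (fun _ => c) analyticAt_const, rfl⟩⟩
      obtain ⟨f, hf, rfl⟩ := exists_eq_germ γ
      rw [germ_eq_zero]
      exact .of_forall fun x => (congrArg f (Subsingleton.elim x 0)).trans hγ
    exact isNoetherianRing_of_ringEquiv ℂ (RingEquiv.ofBijective _ hv).symm
  · intro W _ _ _ _
    refine isNoetherianRing_of_quotient_span_singleton fun γ hγ => ?_
    by_cases hu : IsUnit γ
    · have := Ideal.Quotient.subsingleton_iff.2 (Ideal.span_singleton_eq_top.2 hu)
      exact isNoetherian_of_finite _ _
    obtain ⟨f, hf, rfl⟩ := exists_eq_germ γ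
    rw [isUnit_iff_value_ne_zero, not_not] at hu
    obtain ⟨A, u, k, hua, hk⟩ := exists_eventuallyEq_pow hf hu (mt germ_eq_zero.2 hγ)
    have hA := analyticAt_comp_clm hf (A : (W × ℂ) →L[ℂ] (W × ℂ))
    have := isNoetherianRing_quotient_germ_of_eventuallyEq_pow (hA.mul hua) hk
    let ψ := (Ideal.Quotient.mk (Ideal.span {germ f hf})).comp
      (pullback (A.symm : (W × ℂ) →L[ℂ] (W × ℂ)))
    have hψ : Function.Surjective ψ :=
      Ideal.Quotient.mk_surjective.comp (pullback_equiv_surjective A.symm)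
    have hle : Ideal.span {germ _ (hA.mul hua)} ≤ RingHom.ker ψ := by
      rw [Ideal.span_singleton_le_iff_mem, RingHom.mem_ker]
      change ψ (pullback (A : (W × ℂ) →L[ℂ] (W × ℂ)) (germ f hf) * germ u hua) = 0
      rw [map_mul, RingHom.comp_apply, pullback_pullback, A.coe_comp_coe_symm,
        pullback_id, Ideal.Quotient.eq_zero_iff_mem.2 (Ideal.mem_span_singleton_self _), zero_mul]
    exact isNoetherianRing_of_surjective _ _ (Ideal.Quotient.lift _ ψ hle)
      (Ideal.Quotient.lift_surjective_of_surjective _ hle hψ)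

end

end MondDoublePoint

namespace MondDoublePoint

open MvPolynomial

section

variable {V : Type*} [NormedAddCommGroup V] [NormedSpace ℂ V]

theorem coe_det_germ {k : ℕ} {g : Fin k → Fin k → V → ℂ} (hg : ∀ i j, AnalyticAt ℂ (g i j) 0) :
    ((Matrix.of fun i j => germ (g i j) (hg i j)).det : Filter.Germ (nhds (0 : V)) ℂ) =
      ((fun x => (Matrix.of fun i j => g i j x).det : V → ℂ) : Filter.Germ (nhds (0 : V)) ℂ) := by
  have h1 : (fun x => (Matrix.of fun i j => g i j x).det : V → ℂ) =
      (Matrix.of fun i j => g i j).det := by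
    funext x
    exact ((Pi.evalRingHom (fun _ : V => ℂ) x).map_det (Matrix.of fun i j => g i j)).symm
  rw [h1]
  have h2 := (analyticGerms V 0).subtype.map_det (Matrix.of fun i j => germ (g i j) (hg i j))
  have h3 := (Filter.Germ.coeRingHom (nhds (0 : V))).map_det (Matrix.of fun i j => g i j)
  have h4 : (analyticGerms V 0).subtype.mapMatrix (Matrix.of fun i j => germ (g i j) (hg i j)) =
      (Filter.Germ.coeRingHom (nhds (0 : V))).mapMatrix (Matrix.of fun i j => g i j) :=
    Matrix.ext fun _ _ => rfl
  exact h2.trans ((congrArg Matrix.det h4).trans h3.symm)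

end

theorem det_of_comp_mem {S : Type*} [CommRing S] {p n : ℕ} {M : Fin p → Fin n → S} {J : Ideal S}
    (h : ∀ ρ : Fin n → Fin p, StrictMono ρ → (Matrix.of fun a b => M (ρ a) b).det ∈ J)
    (ρ : Fin n → Fin p) : (Matrix.of fun a b => M (ρ a) b).det ∈ J := by
  by_cases hρ : Function.Injective ρ
  · let σ := Tuple.sort ρ
    have hmono : StrictMono (ρ ∘ σ) :=
      (Tuple.monotone_sort ρ).strictMono_of_injective (hρ.comp σ.injective)
    have h1 := Matrix.det_permute σ (Matrix.of fun a b => M (ρ a) b)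
    have h2 := J.mul_mem_left ((Equiv.Perm.sign σ : ℤ) : S) (h _ hmono)
    have h3 : (Matrix.of fun a b => M ((ρ ∘ σ) a) b) =
        (Matrix.of fun a b => M (ρ a) b).submatrix σ id := rfl
    have h4 : ((Equiv.Perm.sign σ : ℤ) : S) * ((Equiv.Perm.sign σ : ℤ) : S) = 1 := by
      rw [← Int.cast_mul, ← Units.val_mul, Int.units_mul_self]
      simp
    rwa [h3, h1, ← mul_assoc, h4, one_mul] at h2
  · rw [Function.Injective] at hρ
    push Not at hρ
    obtain ⟨a, b, hab, hne⟩ := hρ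
    rw [Matrix.det_zero_of_row_eq hne (by funext c; simp [hab])]
    exact J.zero_mem

theorem analyticAt_fst_sub_snd {n : ℕ} (i : Fin n) :
    AnalyticAt ℂ (fun w : (Fin n → ℂ) × (Fin n → ℂ) => w.1 i - w.2 i) 0 :=
  (((ContinuousLinearMap.proj i).comp
    (ContinuousLinearMap.fst ℂ (Fin n → ℂ) (Fin n → ℂ))).analyticAt 0).fun_sub
  (((ContinuousLinearMap.proj i).comp
    (ContinuousLinearMap.snd ℂ (Fin n → ℂ) (Fin n → ℂ))).analyticAt 0)

/-- The entries of the matrix `α` and of the vector `x - x'`, as germs. -/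
noncomputable def germEntries {n p : ℕ} {α : Fin p → Fin n → ((Fin n → ℂ) × (Fin n → ℂ)) → ℂ}
    (hα : ∀ j i, AnalyticAt ℂ (α j i) 0) :
    GenericIndex p n → analyticGerms ((Fin n → ℂ) × (Fin n → ℂ)) 0 :=
  Sum.elim (fun x => germ (α x.1 x.2) (hα x.1 x.2)) fun i => germ _ (analyticAt_fst_sub_snd i)

theorem mondDoubleIdeal_eq_map {n p : ℕ} {f : (Fin n → ℂ) → (Fin p → ℂ)}
    {α : Fin p → Fin n → ((Fin n → ℂ) × (Fin n → ℂ)) → ℂ}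
    (hα : ∀ j i, AnalyticAt ℂ (α j i) 0)
    (hrelα : ∀ᶠ w : (Fin n → ℂ) × (Fin n → ℂ) in nhds 0,
      ∀ j, f w.1 j - f w.2 j = ∑ i, α j i w * (w.1 i - w.2 i)) :
    (mondDoubleIdeal n p f α : Ideal (analyticGerms ((Fin n → ℂ) × (Fin n → ℂ)) 0)) =
      (complexIdeal (genericX _ p n) (genericY _ p n) p n).map (eval (germEntries hα)) := by
  rw [map_complexIdeal]
  have hX (r : Fin p) (j : Fin n) :
      eval (germEntries hα) (genericX _ p n r j) = germ (α r j) (hα r j) := by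
    rw [genericX_of_lt r.2 j.2, eval_X]
    rfl
  have hY (j : Fin n) : eval (germEntries hα) (genericY _ p n j) =
      germ _ (analyticAt_fst_sub_snd j) := by
    rw [genericY_of_lt j.2, eval_X]
    rfl
  have hrow (j : Fin p) : ((rowSum (fun a b => eval (germEntries hα) (genericX _ p n a b))
      (fun b => eval (germEntries hα) (genericY _ p n b)) n j :
        analyticGerms ((Fin n → ℂ) × (Fin n → ℂ)) 0) :
          Filter.Germ (nhds (0 : (Fin n → ℂ) × (Fin n → ℂ))) ℂ) =
      ((fun w : (Fin n → ℂ) × (Fin n → ℂ) => f w.1 j - f w.2 j) :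
        Filter.Germ (nhds (0 : (Fin n → ℂ) × (Fin n → ℂ))) ℂ) := by
    rw [rowSum, Finset.sum_range]
    simp only [hX, hY, germ_mul_germ]
    rw [germ_sum _ fun i => (hα j i).fun_mul (analyticAt_fst_sub_snd i)]
    refine Filter.Germ.coe_eq.2 ?_
    filter_upwards [hrelα] with w hw using (hw j).symm
  have hdet (ρ : Fin n → Fin p) : (((Matrix.of fun a b : Fin n =>
      eval (germEntries hα) (genericX _ p n (ρ a) b)).det :
        analyticGerms ((Fin n → ℂ) × (Fin n → ℂ)) 0) :
          Filter.Germ (nhds (0 : (Fin n → ℂ) × (Fin n → ℂ))) ℂ) =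
      ((fun w : (Fin n → ℂ) × (Fin n → ℂ) => (Matrix.of fun i i' : Fin n => α (ρ i) i' w).det) :
        Filter.Germ (nhds (0 : (Fin n → ℂ) × (Fin n → ℂ))) ℂ) := by
    simp only [hX]
    exact coe_det_germ fun i j => hα (ρ i) j
  refine le_antisymm (Ideal.span_le.2 ?_) (complexIdeal_le_iff.2 ⟨fun r hr => ?_, fun ρ hρ => ?_⟩)
  · rintro γ (⟨j, hj⟩ | ⟨rows, -, hγ⟩)
    · rw [Subtype.ext (hj.trans (hrow j).symm)]
      exact rowSum_mem_complexIdeal j.2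
    · rw [Subtype.ext (hγ.trans (hdet rows).symm)]
      exact det_mem_complexIdeal fun a => (rows a).2
  · exact Ideal.subset_span (.inl ⟨⟨r, hr⟩, hrow ⟨r, hr⟩⟩)
  · exact det_of_comp_mem (M := fun r b => eval (germEntries hα) (genericX _ p n r b))
      (fun ρ hρ => Ideal.subset_span (.inr ⟨ρ, hρ, hdet ρ⟩)) fun a => ⟨ρ a, hρ a⟩

end MondDoublePoint

/-- Let `f : (ℂⁿ,0) → (ℂᵖ,0)` with `n ≤ p` and let `I²(f)` be Mond's double point ideal
in `O_{2n}`. If `O_{2n}/I²(f) ≠ 0` then `dim O_{2n}/I²(f) ≥ 2n - p`, and if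
`dim O_{2n}/I²(f) = 2n - p` then `O_{2n}/I²(f)` is Cohen–Macaulay. -/
theorem mondDoubleIdeal_dim_ge_and_CM (n p : ℕ) (hnp : n ≤ p)
    (f : (Fin n → ℂ) → (Fin p → ℂ)) (hf : AnalyticAt ℂ f 0) (hf0 : f 0 = 0)
    (α : Fin p → Fin n → ((Fin n → ℂ) × (Fin n → ℂ)) → ℂ)
    (hα : ∀ j i, AnalyticAt ℂ (α j i) (0, 0))
    (hrelα : ∀ᶠ w : (Fin n → ℂ) × (Fin n → ℂ) in nhds (0, 0),
      ∀ j, f w.1 j - f w.2 j = ∑ i, α j i w * (w.1 i - w.2 i)) :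
    (Nontrivial ((analyticGerms ((Fin n → ℂ) × (Fin n → ℂ)) (0, 0)) ⧸ mondDoubleIdeal n p f α) →
      ((2 * n - p : ℕ) : WithBot (WithTop ℕ)) ≤
        ringKrullDim ((analyticGerms ((Fin n → ℂ) × (Fin n → ℂ)) (0, 0)) ⧸ mondDoubleIdeal n p f α)) ∧
    (ringKrullDim ((analyticGerms ((Fin n → ℂ) × (Fin n → ℂ)) (0, 0)) ⧸ mondDoubleIdeal n p f α)
        = ((2 * n - p : ℕ) : WithBot (WithTop ℕ)) →
      IsCohenMacaulayRing
        ((analyticGerms ((Fin n → ℂ) × (Fin n → ℂ)) (0, 0)) ⧸ mondDoubleIdeal n p f α)) := by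
  have hJ := MondDoublePoint.mondDoubleIdeal_eq_map hα hrelα
  obtain ⟨rs, hrs, hlen, hm⟩ :=
    MondDoublePoint.exists_isRegularModulo_maximalIdeal ((Fin n → ℂ) × (Fin n → ℂ))
  replace hlen : rs.length = 2 * n := by
    rw [hlen, Module.finrank_prod, Module.finrank_fin_fun, two_mul]
  rw [← hlen]
  exact ⟨fun h => MondDoublePoint.le_ringKrullDim_quotient_complexIdeal _ hrs hm hJ
      (Ideal.Quotient.nontrivial_iff.1 h),
    MondDoublePoint.isCohenMacaulayRing_quotient_complexIdeal _ hrs hm hJ⟩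
end
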